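/- arXiv:1509.08859 — 2 statements merged into one kernel-verified Lean document; each statement's English description precedes it below -/
import Mathlib

section
/- (Rogers–Shephard, translation body) Let K be a convex body in EuclideanSpace ℝ (Fin d), d ≥ 2. Then (1 + 2·v_{d−1}/v_d) · vol(K) ≤ sup { vol(convexHull ℝ (K ∪ (x +ᵥ K))) : x ∈ EuclideanSpace ℝ (Fin d), K ∩ (x +ᵥ K) ≠ ∅ } ≤ (1 + d) · vol(K). -/
open MeasureTheory Pointwise

/-- The volume of the closed unit ball of Euclidean `n`-space. -/
noncomputable def unitBallVol (n : ℕ) : ℝ :=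
  (volume (Metric.closedBall (0 : EuclideanSpace ℝ (Fin n)) 1)).toReal

open Set Filter Topology
open scoped ENNReal

abbrev Eu (d : ℕ) := EuclideanSpace ℝ (Fin d)

/-- `K + [0,1] x`. -/
def hullT {d : ℕ} (K : Set (Eu d)) (x : Eu d) : Set (Eu d) :=
  {p | ∃ k ∈ K, ∃ l ∈ Icc (0:ℝ) 1, p = k + l • x}

lemma hullT_eq_image {d : ℕ} (K : Set (Eu d)) (x : Eu d) :
    hullT K x = (fun p : Eu d × ℝ => p.1 + p.2 • x) '' (K ×ˢ Icc (0:ℝ) 1) := by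
  ext p
  simp only [hullT, mem_ofPred_eq, mem_image, mem_prod, Prod.exists]
  constructor
  · rintro ⟨k, hk, l, hl, rfl⟩; exact ⟨k, l, ⟨hk, hl⟩, rfl⟩
  · rintro ⟨k, l, ⟨hk, hl⟩, rfl⟩; exact ⟨k, hk, l, hl, rfl⟩

lemma hullT_compact {d : ℕ} {K : Set (Eu d)} (hK : IsCompact K) (x : Eu d) :
    IsCompact (hullT K x) := by
  rw [hullT_eq_image]
  exact (hK.prod isCompact_Icc).image (by fun_prop)

lemma hullT_convex {d : ℕ} {K : Set (Eu d)} (hK : Convex ℝ K) (x : Eu d) :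
    Convex ℝ (hullT K x) := by
  rintro _ ⟨k, hk, l, hl, rfl⟩ _ ⟨k', hk', l', hl', rfl⟩ a b ha hb hab
  refine ⟨a • k + b • k', hK hk hk' ha hb hab, a * l + b * l', ?_, by module⟩
  exact convex_Icc (0:ℝ) 1 hl hl' ha hb hab

lemma subset_hullT {d : ℕ} (K : Set (Eu d)) (x : Eu d) : K ⊆ hullT K x :=
  fun k hk => ⟨k, hk, 0, by simp, by simp⟩

lemma hullT_mono {d : ℕ} {K L : Set (Eu d)} (h : K ⊆ L) (x : Eu d) : hullT K x ⊆ hullT L x := by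
  rintro _ ⟨k, hk, l, hl, rfl⟩
  exact ⟨k, h hk, l, hl, rfl⟩

lemma convexHull_eq_hullT {d : ℕ} {K : Set (Eu d)} (hK : Convex ℝ K) (x : Eu d) :
    convexHull ℝ (K ∪ (x +ᵥ K)) = hullT K x := by
  apply Subset.antisymm
  · apply convexHull_min _ (hullT_convex hK x)
    rintro p (hp | hp)
    · exact subset_hullT K x hp
    · obtain ⟨k, hk, rfl⟩ := hp
      exact ⟨k, hk, 1, by simp, by simp [add_comm]⟩
  · rintro _ ⟨k, hk, l, hl, rfl⟩
    have h1 : k ∈ convexHull ℝ (K ∪ (x +ᵥ K)) := subset_convexHull _ _ (Or.inl hk)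
    have h2 : x + k ∈ convexHull ℝ (K ∪ (x +ᵥ K)) :=
      subset_convexHull _ _ (Or.inr ⟨k, hk, rfl⟩)
    have := convex_convexHull ℝ (K ∪ (x +ᵥ K)) h1 h2 (sub_nonneg.2 hl.2) hl.1 (by ring)
    convert this using 1
    module

lemma vol_le_of_eventually {α : Type*} [MeasurableSpace α] {μ : Measure α} {A : Set α}
    {U : ℕ → Set α} {C : ℝ≥0∞}
    (h : ∀ p ∈ A, ∀ᶠ n in atTop, p ∈ U n) (hC : ∀ n, μ (U n) ≤ C) : μ A ≤ C := by
  have hsub : A ⊆ ⋃ n, ⋂ m ≥ n, U m := by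
    intro p hp
    obtain ⟨n, hn⟩ := eventually_atTop.1 (h p hp)
    exact mem_iUnion.2 ⟨n, mem_iInter₂.2 hn⟩
  have hmono : Monotone (fun n : ℕ => ⋂ m ≥ n, U m) := by
    intro a b hab p hp
    simp only [mem_iInter] at hp ⊢
    exact fun m hm => hp m (le_trans hab hm)
  refine (measure_mono hsub).trans ?_
  rw [hmono.measure_iUnion]
  refine iSup_le fun n => (measure_mono ?_).trans (hC n)
  exact iInter₂_subset n le_rfl

lemma vol_interior_eq {d : ℕ} {K : Set (Eu d)} (hK : Convex ℝ K) :
    volume (interior K) = volume K := by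
  apply le_antisymm (measure_mono interior_subset)
  have : K ⊆ interior K ∪ frontier K := by
    rw [← closure_eq_interior_union_frontier]; exact subset_closure
  refine (measure_mono this).trans ((measure_union_le _ _).trans ?_)
  rw [hK.addHaar_frontier volume, add_zero]

lemma vol_closure_eq {d : ℕ} {K : Set (Eu d)} (hK : Convex ℝ K) :
    volume (closure K) = volume K := by
  apply le_antisymm _ (measure_mono subset_closure)
  rw [closure_eq_self_union_frontier]
  refine (measure_union_le _ _).trans ?_
  rw [hK.addHaar_frontier volume, add_zero]

lemma vol_hullT_interior {d : ℕ} {K : Set (Eu d)} (hK : Convex ℝ K)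
    (hi : (interior K).Nonempty) (x : Eu d) :
    volume (hullT K x) ≤ volume (hullT (interior K) x) := by
  rw [← vol_closure_eq (hullT_convex hK.interior x)]
  apply measure_mono
  rintro _ ⟨k, hk, l, hl, rfl⟩
  have hk' : k ∈ closure (interior K) := by
    rw [hK.closure_interior_eq_closure_of_nonempty_interior hi]; exact subset_closure hk
  have hc : Continuous (fun q : Eu d => q + l • x) := by fun_prop
  exact map_mem_closure (f := fun q : Eu d => q + l • x) hc hk' (fun q hq => ⟨q, hq, l, hl, rfl⟩)

lemma vol_inter_translate {d : ℕ} {K : Set (Eu d)} (hK : Convex ℝ K) {y z : Eu d}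
    (hy : y ∈ K) (hz : z ∈ K) {t : ℝ} (ht0 : 0 ≤ t) (ht1 : t ≤ 1) :
    ENNReal.ofReal ((1 - t) ^ d) * volume K ≤ volume (K ∩ ((t • (y - z)) +ᵥ K)) := by
  have h1 : volume ((t • y) +ᵥ ((1 - t) • K)) = ENNReal.ofReal ((1 - t) ^ d) * volume K := by
    rw [measure_vadd, Measure.addHaar_smul]
    simp [abs_of_nonneg (sub_nonneg.2 ht1)]
  rw [← h1]
  apply measure_mono
  rintro _ ⟨_, ⟨k, hk, rfl⟩, rfl⟩
  constructor
  · have := hK hy hk ht0 (sub_nonneg.2 ht1) (by ring)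
    simpa using this
  · refine ⟨t • z + (1 - t) • k, hK hz hk ht0 (sub_nonneg.2 ht1) (by ring), ?_⟩
    simp only [vadd_eq_add]
    module

lemma vol_union_translates {d : ℕ} {K : Set (Eu d)} (hKc : IsCompact K) (v : Eu d) {a : ℝ≥0∞}
    (ha : volume K ≤ volume (K ∩ (v +ᵥ K)) + a) (n : ℕ) :
    volume (⋃ j ∈ Finset.range (n + 1), ((j : ℝ) • v) +ᵥ K) ≤ volume K + n * a := by
  induction n with
  | zero => simp
  | succ n ih =>
    rw [Finset.range_add_one, Finset.set_biUnion_insert]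
    set U := ⋃ j ∈ Finset.range (n + 1), ((j : ℝ) • v) +ᵥ K with hU
    have hfin : volume (K ∩ (v +ᵥ K)) ≠ ∞ :=
      ne_top_of_le_ne_top hKc.measure_lt_top.ne (measure_mono inter_subset_left)
    have hsub : ((((n + 1 : ℕ) : ℝ) • v) +ᵥ K) ∪ U
        ⊆ U ∪ ((((n + 1 : ℕ) : ℝ) • v +ᵥ K) \ (((n : ℝ) • v) +ᵥ K)) := by
      rintro p (hp | hp)
      · by_cases hq : p ∈ ((n : ℝ) • v) +ᵥ K
        · left
          exact mem_biUnion (x := n) (by simp) hq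
        · right; exact ⟨hp, hq⟩
      · exact Or.inl hp
    have hd : volume ((((n + 1 : ℕ) : ℝ) • v +ᵥ K) \ (((n : ℝ) • v) +ᵥ K)) ≤ a := by
      have e : (((n + 1 : ℕ) : ℝ) • v +ᵥ K) \ (((n : ℝ) • v) +ᵥ K)
          = ((n : ℝ) • v) +ᵥ ((v +ᵥ K) \ K) := by
        rw [vadd_set_sdiff, vadd_vadd]
        congr 2
        push_cast; module
      rw [e, measure_vadd, ← sdiff_inter_self_eq_sdiff, measure_sdiff inter_subset_right
        (hKc.measurableSet.inter (hKc.vadd v).measurableSet).nullMeasurableSet hfin, measure_vadd]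
      rw [tsub_le_iff_left]
      exact ha
    calc _ ≤ _ := measure_mono hsub
      _ ≤ _ := measure_union_le _ _
      _ ≤ (volume K + n * a) + a := add_le_add ih hd
      _ = _ := by push_cast; ring

lemma upper_bound {d : ℕ} {K : Set (Eu d)} (hKc : IsCompact K) (hK : Convex ℝ K)
    (hi : (interior K).Nonempty) {y z : Eu d} (hy : y ∈ K) (hz : z ∈ K) :
    volume (hullT K (y - z)) ≤ ENNReal.ofReal (1 + d) * volume K := by
  refine (vol_hullT_interior hK hi _).trans ?_
  set x := y - z with hx
  set U : ℕ → Set (Eu d) := fun n =>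
    ⋃ j ∈ Finset.range ((n + 1) + 1), ((j : ℝ) • ((1 / ((n : ℝ) + 1)) • x)) +ᵥ K with hUdef
  apply vol_le_of_eventually (U := U)
  · rintro _ ⟨k, hk, l, hl, rfl⟩
    obtain ⟨ε, hε, hball⟩ := Metric.mem_nhds_iff.1 (mem_interior_iff_mem_nhds.1 hk)
    have hlim : Tendsto (fun n : ℕ => (1 / ((n : ℝ) + 1)) * ‖x‖) atTop (𝓝 0) := by
      simpa using tendsto_one_div_add_atTop_nhds_zero_nat.mul_const ‖x‖
    filter_upwards [hlim.eventually_lt_const hε] with n hn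
    have hn0 : (0:ℝ) < (n : ℝ) + 1 := by positivity
    refine mem_biUnion (x := ⌊l * ((n:ℝ) + 1)⌋₊) ?_ ?_
    · simp only [Finset.coe_range, mem_Iio]
      rw [Nat.lt_add_one_iff]
      apply Nat.floor_le_of_le
      push_cast
      nlinarith [hl.2]
    · set j := ⌊l * ((n:ℝ) + 1)⌋₊ with hj
      have h1 : (j : ℝ) ≤ l * ((n:ℝ) + 1) := Nat.floor_le (mul_nonneg hl.1 hn0.le)
      have h2 : l * ((n:ℝ) + 1) < j + 1 := Nat.lt_floor_add_one _
      refine ⟨k + (l - (j : ℝ) * (1 / ((n:ℝ) + 1))) • x, hball ?_, ?_⟩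
      · rw [Metric.mem_ball, dist_eq_norm, add_sub_cancel_left, norm_smul]
        refine lt_of_le_of_lt (mul_le_mul_of_nonneg_right ?_ (norm_nonneg x)) hn
        rw [Real.norm_eq_abs, abs_le]
        constructor
        · have : 0 ≤ l - (j : ℝ) * (1 / ((n:ℝ) + 1)) := by
            rw [sub_nonneg, mul_one_div, div_le_iff₀ hn0]; exact h1
          have : (0:ℝ) < 1 / ((n:ℝ) + 1) := by positivity
          linarith
        · rw [sub_le_iff_le_add, mul_one_div, ← add_div, le_div_iff₀ hn0]
          linarith
      · simp only [vadd_eq_add]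
        module
  · intro n
    have hn0 : (0:ℝ) < (n : ℝ) + 1 := by positivity
    set t : ℝ := 1 / ((n:ℝ) + 1) with ht
    have ht0 : 0 ≤ t := by positivity
    have ht1 : t ≤ 1 := by rw [ht, div_le_one hn0]; linarith [(Nat.cast_nonneg n : (0:ℝ) ≤ n)]
    have hb : 1 - d * t ≤ (1 - t) ^ d := by
      have := one_add_mul_le_pow (a := -t) (by linarith) d
      calc _ = 1 + d * (-t) := by ring
        _ ≤ _ := this
        _ = _ := by ring_nf
    have ha : volume K ≤ volume (K ∩ ((t • x) +ᵥ K)) + ENNReal.ofReal (d * t) * volume K := by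
      calc volume K = ENNReal.ofReal 1 * volume K := by simp
        _ ≤ ENNReal.ofReal ((1 - t) ^ d + d * t) * volume K := by
          gcongr; linarith
        _ = ENNReal.ofReal ((1 - t) ^ d) * volume K + ENNReal.ofReal (d * t) * volume K := by
          rw [ENNReal.ofReal_add (pow_nonneg (by linarith) d) (by positivity), add_mul]
        _ ≤ _ := by gcongr; exact vol_inter_translate hK hy hz ht0 ht1
    refine (vol_union_translates hKc (t • x) ha (n + 1)).trans (le_of_eq ?_)
    rw [ENNReal.ofReal_add zero_le_one (by positivity), add_mul, ENNReal.ofReal_one, one_mul,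
      ← mul_assoc]
    congr 2
    rw [← ENNReal.ofReal_natCast (n + 1), ← ENNReal.ofReal_mul (by positivity)]
    congr 1
    rw [ht]; push_cast; field_simp

/-- fiber of `A` along the line `x + ℝ u` -/
def fib {d : ℕ} (u : Eu d) (A : Set (Eu d)) (x : Eu d) : Set ℝ := {s | x + s • u ∈ A}

def slab {d : ℕ} (u : Eu d) : Set (Eu d) := {x | inner ℝ u x ∈ Ico (0:ℝ) 1}

lemma mem_fib {d : ℕ} {u : Eu d} {A : Set (Eu d)} {x : Eu d} {s : ℝ} :
    s ∈ fib u A x ↔ x + s • u ∈ A := Iff.rfl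

lemma measurableSet_slab {d : ℕ} (u : Eu d) : MeasurableSet (slab u) := by
  have : Measurable (fun x : Eu d => inner ℝ u x) := (by fun_prop : Continuous _).measurable
  exact this measurableSet_Ico

lemma inner_add_smul_self {d : ℕ} {u : Eu d} (hu : ‖u‖ = 1) (x : Eu d) (s : ℝ) :
    inner ℝ u (x + s • u) = inner ℝ u x + s := by
  rw [inner_add_right, inner_smul_right, real_inner_self_eq_norm_sq, hu]; ring

lemma measurable_fib {d : ℕ} (u : Eu d) {A : Set (Eu d)} (hA : MeasurableSet A) :
    Measurable (fun x => volume (fib u A x)) := by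
  have h : MeasurableSet {p : Eu d × ℝ | p.1 + p.2 • u ∈ A} := by
    have : Measurable (fun p : Eu d × ℝ => p.1 + p.2 • u) := (by fun_prop : Continuous _).measurable
    exact this hA
  exact measurable_measure_prodMk_left h

lemma measurableSet_fib {d : ℕ} (u : Eu d) {A : Set (Eu d)} (hA : MeasurableSet A) (x : Eu d) :
    MeasurableSet (fib u A x) := by
  have : Measurable (fun s : ℝ => x + s • u) := (by fun_prop : Continuous _).measurable
  exact this hA

lemma vol_eq_slab {d : ℕ} {u : Eu d} (hu : ‖u‖ = 1) {A : Set (Eu d)} (hA : MeasurableSet A) :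
    volume A = ∫⁻ x in slab u, volume (fib u A x) := by
  symm
  have hsl := measurableSet_slab u
  have hm1 : Measurable (fun p : Eu d × ℝ => p.1 + p.2 • u) := (by fun_prop : Continuous _).measurable
  have hm2 : Measurable (fun p : ℝ × Eu d => p.2 - p.1 • u) := (by fun_prop : Continuous _).measurable
  have mA : Measurable (A.indicator (1 : Eu d → ℝ≥0∞)) := measurable_one.indicator hA
  have mS : Measurable ((slab u).indicator (1 : Eu d → ℝ≥0∞)) := measurable_one.indicator hsl
  calc ∫⁻ x in slab u, volume (fib u A x)
      = ∫⁻ x, ∫⁻ s : ℝ, (slab u).indicator (1 : Eu d → ℝ≥0∞) x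
          * A.indicator (1 : Eu d → ℝ≥0∞) (x + s • u) := by
        rw [← lintegral_indicator hsl]
        refine lintegral_congr fun x => ?_
        have hmx : Measurable (fun s : ℝ => x + s • u) := (by fun_prop : Continuous _).measurable
        have hmA : Measurable (fun s : ℝ => A.indicator (1 : Eu d → ℝ≥0∞) (x + s • u)) :=
          mA.comp hmx
        rw [lintegral_const_mul _ hmA]
        have : ∫⁻ s : ℝ, A.indicator (1 : Eu d → ℝ≥0∞) (x + s • u) = volume (fib u A x) := by
          rw [← lintegral_indicator_one (measurableSet_fib u hA x)]
          rfl
        rw [this]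
        by_cases hx : x ∈ slab u <;> simp [hx]
    _ = ∫⁻ s : ℝ, ∫⁻ x, (slab u).indicator (1 : Eu d → ℝ≥0∞) x
          * A.indicator (1 : Eu d → ℝ≥0∞) (x + s • u) := by
        apply lintegral_lintegral_swap
        exact ((mS.comp measurable_fst).mul (mA.comp hm1)).aemeasurable
    _ = ∫⁻ s : ℝ, ∫⁻ x, (slab u).indicator (1 : Eu d → ℝ≥0∞) (x - s • u)
          * A.indicator (1 : Eu d → ℝ≥0∞) x := by
        refine lintegral_congr fun s => ?_
        rw [← lintegral_add_right_eq_self (μ := volume) (fun x => (slab u).indicator (1 : Eu d → ℝ≥0∞) (x - s • u)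
          * A.indicator (1 : Eu d → ℝ≥0∞) x) (s • u)]
        simp
    _ = ∫⁻ x, ∫⁻ s : ℝ, (slab u).indicator (1 : Eu d → ℝ≥0∞) (x - s • u)
          * A.indicator (1 : Eu d → ℝ≥0∞) x := by
        apply lintegral_lintegral_swap
        exact ((mS.comp hm2).mul (mA.comp measurable_snd)).aemeasurable
    _ = ∫⁻ x, A.indicator (1 : Eu d → ℝ≥0∞) x := by
        refine lintegral_congr fun x => ?_
        have hmx : Measurable (fun s : ℝ => x - s • u) := (by fun_prop : Continuous _).measurable
        have hmS : Measurable (fun s : ℝ => (slab u).indicator (1 : Eu d → ℝ≥0∞) (x - s • u)) :=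
          mS.comp hmx
        rw [lintegral_mul_const _ hmS]
        have h1 : ∫⁻ s : ℝ, (slab u).indicator (1 : Eu d → ℝ≥0∞) (x - s • u) = 1 := by
          have : ∀ s : ℝ, (slab u).indicator (1 : Eu d → ℝ≥0∞) (x - s • u)
              = (Ioc (inner ℝ u x - 1) (inner ℝ u x)).indicator 1 s := by
            intro s
            have e : x - s • u ∈ slab u ↔ s ∈ Ioc (inner ℝ u x - 1) (inner ℝ u x) := by
              have := inner_add_smul_self hu x (-s)
              rw [neg_smul, ← sub_eq_add_neg] at this
              simp only [slab, mem_ofPred_eq, this, mem_Ico, mem_Ioc]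
              constructor <;> rintro ⟨h1, h2⟩ <;> constructor <;> linarith
            by_cases hs : x - s • u ∈ slab u
            · rw [indicator_of_mem hs, indicator_of_mem (e.1 hs)]; rfl
            · rw [indicator_of_notMem hs, indicator_of_notMem (fun h => hs (e.2 h))]
          simp_rw [this]
          rw [lintegral_indicator_one measurableSet_Ioc]
          simp
        rw [h1, one_mul]
    _ = volume A := lintegral_indicator_one hA

lemma fib_empty_or_Icc {d : ℕ} {u : Eu d} (hu : ‖u‖ = 1) {K : Set (Eu d)} (hKc : IsCompact K)
    (hK : Convex ℝ K) (x : Eu d) :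
    fib u K x = ∅ ∨ ∃ a b : ℝ, a ≤ b ∧ fib u K x = Icc a b := by
  rcases (fib u K x).eq_empty_or_nonempty with h | h
  · exact Or.inl h
  right
  have hcl : IsClosed (fib u K x) :=
    hKc.isClosed.preimage (by fun_prop : Continuous (fun s : ℝ => x + s • u))
  obtain ⟨R, hR⟩ := hKc.isBounded.exists_norm_le
  have hbd : Bornology.IsBounded (fib u K x) := by
    refine (Metric.isBounded_closedBall (x := (0:ℝ)) (r := R + ‖x‖)).subset ?_
    intro s hs
    have h1 := hR _ hs
    rw [mem_closedBall_zero_iff]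
    calc ‖s‖ = ‖(x + s • u) - x‖ := by rw [add_sub_cancel_left, norm_smul, hu, mul_one]
      _ ≤ ‖x + s • u‖ + ‖x‖ := norm_sub_le _ _
      _ ≤ _ := by linarith
  have hc : IsCompact (fib u K x) := Metric.isCompact_of_isClosed_isBounded hcl hbd
  have hconv : Convex ℝ (fib u K x) := by
    intro s hs t ht a b ha hb hab
    have := hK hs ht ha hb hab
    rw [mem_fib]
    convert this using 1
    have : x = (a + b) • x := by rw [hab, one_smul]
    simp only [smul_eq_mul]
    nth_rewrite 1 [this]
    module
  have := eq_Icc_of_connected_compact ⟨h, hconv.isPreconnected⟩ hc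
  obtain ⟨y, hy⟩ := h
  refine ⟨_, _, ?_, this⟩
  rw [this] at hy
  exact hy.1.trans hy.2

/-- Steiner symmetral. -/
def stein {d : ℕ} (u : Eu d) (K : Set (Eu d)) : Set (Eu d) :=
  {x | ∃ s t : ℝ, x + s • u ∈ K ∧ x + t • u ∈ K ∧ 2 * |inner ℝ u x| ≤ t - s}

lemma stein_convex {d : ℕ} (u : Eu d) {K : Set (Eu d)} (hK : Convex ℝ K) :
    Convex ℝ (stein u K) := by
  rintro x ⟨s, t, hs, ht, h⟩ x' ⟨s', t', hs', ht', h'⟩ a b ha hb hab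
  refine ⟨a * s + b * s', a * t + b * t', ?_, ?_, ?_⟩
  · convert hK hs hs' ha hb hab using 1; module
  · convert hK ht ht' ha hb hab using 1; module
  · rw [inner_add_right, inner_smul_right, inner_smul_right]
    have h1 := abs_add_le (a * inner ℝ u x) (b * inner ℝ u x')
    rw [abs_mul, abs_mul, abs_of_nonneg ha, abs_of_nonneg hb] at h1
    nlinarith [mul_le_mul_of_nonneg_left h ha, mul_le_mul_of_nonneg_left h' hb]

lemma stein_mono {d : ℕ} (u : Eu d) {K L : Set (Eu d)} (h : K ⊆ L) : stein u K ⊆ stein u L := by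
  rintro x ⟨s, t, hs, ht, h'⟩
  exact ⟨s, t, h hs, h ht, h'⟩

lemma stein_ball {d : ℕ} {u : Eu d} (hu : ‖u‖ = 1) (r : ℝ) :
    stein u (Metric.closedBall 0 r) ⊆ Metric.closedBall 0 r := by
  rintro x ⟨s, t, hs, ht, h⟩
  rw [mem_closedBall_zero_iff] at *
  have key : ∀ σ : ℝ, ‖x + σ • u‖ ^ 2 = ‖x‖ ^ 2 + 2 * σ * inner ℝ u x + σ ^ 2 := by
    intro σ
    rw [norm_add_sq_real, inner_smul_right, norm_smul, hu, real_inner_comm, Real.norm_eq_abs,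
      mul_one, sq_abs]
    ring
  have hr : 0 ≤ r := (norm_nonneg _).trans hs
  have h1 := key s
  have h2 := key t
  have h3 : ‖x + s • u‖ ^ 2 ≤ r ^ 2 := by gcongr
  have h4 : ‖x + t • u‖ ^ 2 ≤ r ^ 2 := by gcongr
  set c := inner ℝ u x with hc
  have h5 := abs_le.1 (by linarith : |c| ≤ (t - s) / 2)
  have : ‖x‖ ^ 2 ≤ r ^ 2 := by
    by_contra! hlt
    have e1 : s * (s + 2 * c) < 0 := by nlinarith
    have e2 : t * (t + 2 * c) < 0 := by nlinarith
    rcases le_total 0 c with hc0 | hc0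
    · have : t < 0 := by
        by_contra! h0; nlinarith [mul_nonneg h0 hc0]
      nlinarith
    · have : 0 < s := by
        by_contra! h0; nlinarith [mul_nonneg_of_nonpos_of_nonpos h0 hc0]
      nlinarith
  exact abs_le_of_sq_le_sq' this hr |>.2

lemma stein_compact {d : ℕ} {u : Eu d} (hu : ‖u‖ = 1) {K : Set (Eu d)} (hK : IsCompact K) :
    IsCompact (stein u K) := by
  obtain ⟨R, hR⟩ := hK.isBounded.exists_norm_le
  have hsub : stein u K ⊆ Metric.closedBall 0 R :=
    (stein_mono u (fun k hk => by simpa using hR k hk)).trans (stein_ball hu R)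
  set T : ℝ := 2 * R with hT
  have e : stein u K = Prod.fst '' (((Metric.closedBall (0 : Eu d) R) ×ˢ (Icc (-T) T ×ˢ Icc (-T) T)) ∩
      {p : Eu d × (ℝ × ℝ) | p.1 + p.2.1 • u ∈ K ∧ p.1 + p.2.2 • u ∈ K ∧
        2 * |inner ℝ u p.1| ≤ p.2.2 - p.2.1}) := by
    ext x
    constructor
    · intro hx
      obtain ⟨s, t, hs, ht, h⟩ := hx
      have hxR := hsub ⟨s, t, hs, ht, h⟩
      have hb : ∀ σ : ℝ, x + σ • u ∈ K → σ ∈ Icc (-T) T := by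
        intro σ hσ
        rw [mem_Icc, ← abs_le]
        rw [mem_closedBall_zero_iff] at hxR
        calc |σ| = ‖(x + σ • u) - x‖ := by
              rw [add_sub_cancel_left, norm_smul, hu, mul_one, Real.norm_eq_abs]
          _ ≤ ‖x + σ • u‖ + ‖x‖ := norm_sub_le _ _
          _ ≤ _ := by linarith [hR _ hσ]
      exact ⟨(x, (s, t)), ⟨⟨hxR, hb s hs, hb t ht⟩, hs, ht, h⟩, rfl⟩
    · rintro ⟨⟨x, s, t⟩, ⟨_, hs, ht, h⟩, rfl⟩
      exact ⟨s, t, hs, ht, h⟩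
  rw [e]
  refine IsCompact.image (IsCompact.inter_right ?_ ?_) continuous_fst
  · exact (isCompact_closedBall 0 R).prod (isCompact_Icc.prod isCompact_Icc)
  · refine IsClosed.and ?_ (IsClosed.and ?_ ?_)
    · exact hK.isClosed.preimage (by fun_prop)
    · exact hK.isClosed.preimage (by fun_prop)
    · exact isClosed_le (by fun_prop) (by fun_prop)

lemma fib_stein_of_empty {d : ℕ} {u : Eu d} {K : Set (Eu d)} {x : Eu d} (h : fib u K x = ∅) :
    fib u (stein u K) x = ∅ := by
  rw [eq_empty_iff_forall_notMem] at *
  rintro σ ⟨s, t, hs, -, -⟩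
  apply h (σ + s)
  rw [mem_fib]; convert hs using 1; module

lemma fib_stein_of_Icc {d : ℕ} {u : Eu d} (hu : ‖u‖ = 1) {K : Set (Eu d)} {x : Eu d} {a b : ℝ}
    (hab : a ≤ b) (h : fib u K x = Icc a b) :
    fib u (stein u K) x = Icc (-inner ℝ u x - (b - a) / 2) (-inner ℝ u x + (b - a) / 2) := by
  have hmem : ∀ s, x + s • u ∈ K ↔ s ∈ Icc a b := fun s => by rw [← h, mem_fib]
  ext σ
  have hcomb : ∀ s : ℝ, x + σ • u + s • u = x + (σ + s) • u := fun s => by module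
  rw [mem_fib]
  constructor
  · rintro ⟨s, t, hs, ht, h2⟩
    rw [hcomb, hmem] at hs ht
    rw [inner_add_smul_self hu] at h2
    have h3 := abs_le.1 (by linarith : |inner ℝ u x + σ| ≤ (t - s) / 2)
    constructor <;> linarith [hs.1, ht.2]
  · rintro ⟨h1, h2⟩
    refine ⟨a - σ, b - σ, ?_, ?_, ?_⟩
    · rw [hcomb, hmem]; constructor <;> linarith
    · rw [hcomb, hmem]; constructor <;> linarith
    · rw [inner_add_smul_self hu]
      have : |inner ℝ u x + σ| ≤ (b - a) / 2 := abs_le.2 ⟨by linarith, by linarith⟩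
      linarith

lemma vol_fib_stein {d : ℕ} {u : Eu d} (hu : ‖u‖ = 1) {K : Set (Eu d)} (hKc : IsCompact K)
    (hK : Convex ℝ K) (x : Eu d) :
    volume (fib u (stein u K) x) = volume (fib u K x) := by
  rcases fib_empty_or_Icc hu hKc hK x with h | ⟨a, b, hab, h⟩
  · rw [h, fib_stein_of_empty h]
  · rw [h, fib_stein_of_Icc hu hab h, Real.volume_Icc, Real.volume_Icc]
    congr 1; ring

lemma vol_stein {d : ℕ} {u : Eu d} (hu : ‖u‖ = 1) {K : Set (Eu d)} (hKc : IsCompact K)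
    (hK : Convex ℝ K) : volume (stein u K) = volume K := by
  rw [vol_eq_slab hu (stein_compact hu hKc).measurableSet, vol_eq_slab hu hKc.measurableSet]
  simp_rw [vol_fib_stein hu hKc hK]

lemma le_vol_fib {d : ℕ} {u : Eu d} {K : Set (Eu d)} (hu : ‖u‖ = 1) (hKc : IsCompact K)
    (hK : Convex ℝ K) {x : Eu d} {s t : ℝ} (hs : s ∈ fib u K x) (ht : t ∈ fib u K x) :
    ENNReal.ofReal (t - s) ≤ volume (fib u K x) := by
  rcases fib_empty_or_Icc hu hKc hK x with h | ⟨a, b, hab, h⟩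
  · rw [h] at hs; exact absurd hs (notMem_empty _)
  · rw [h] at hs ht ⊢
    rw [Real.volume_Icc]
    exact ENNReal.ofReal_le_ofReal (by linarith [hs.1, ht.2])

lemma vol_hullT_stein {d : ℕ} {u : Eu d} (hu : ‖u‖ = 1) {K : Set (Eu d)} (hKc : IsCompact K)
    (hK : Convex ℝ K) (x : Eu d) (m : ℝ) :
    2 * volume (hullT (stein u K) x) ≤ volume (hullT K (x + (m + inner ℝ u x) • u))
      + volume (hullT K (x + (m - inner ℝ u x) • u)) := by
  set τ : ℝ := inner ℝ u x with hτ
  set xp := x + (m + τ) • u with hxp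
  set xm := x + (m - τ) • u with hxm
  have hSc := hullT_compact (stein_compact hu hKc) x
  have hSv := hullT_convex (stein_convex u hK) x
  have hpc := hullT_compact hKc xp
  have hpv := hullT_convex hK xp
  have hmc := hullT_compact hKc xm
  have hmv := hullT_convex hK xm
  rw [vol_eq_slab hu hSc.measurableSet, vol_eq_slab hu hpc.measurableSet,
    vol_eq_slab hu hmc.measurableSet, ← lintegral_add_left (measurable_fib u hpc.measurableSet),
    ← lintegral_const_mul _ (measurable_fib u hSc.measurableSet)]
  apply lintegral_mono
  intro p
  show 2 * volume (fib u (hullT (stein u K) x) p) ≤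
    volume (fib u (hullT K xp) p) + volume (fib u (hullT K xm) p)
  rcases fib_empty_or_Icc hu hSc hSv p with h | ⟨A, B, hAB, h⟩
  · rw [h]; simp
  · have hA : A ∈ fib u (hullT (stein u K) x) p := by rw [h]; exact ⟨le_rfl, hAB⟩
    have hB : B ∈ fib u (hullT (stein u K) x) p := by rw [h]; exact ⟨hAB, le_rfl⟩
    rw [h, Real.volume_Icc]
    obtain ⟨k1, ⟨s1, t1, hs1, ht1, h1⟩, l, hl, e1⟩ := hA
    obtain ⟨k2, ⟨s2, t2, hs2, ht2, h2⟩, q, hq, e2⟩ := hB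
    have f1 := congrArg (inner ℝ u) e1
    have f2 := congrArg (inner ℝ u) e2
    rw [inner_add_smul_self hu, inner_add_right, inner_smul_right, ← hτ] at f1 f2
    have g1 := le_vol_fib hu hpc hpv (x := p) (s := A + s1 + l * (m + τ))
      (t := B + t2 + q * (m + τ))
      (by
        refine ⟨k1 + s1 • u, hs1, l, hl, ?_⟩
        rw [show p + (A + s1 + l * (m + τ)) • u = (p + A • u) + (s1 + l * (m + τ)) • u by module,
          e1, hxp]
        module)
      (by
        refine ⟨k2 + t2 • u, ht2, q, hq, ?_⟩
        rw [show p + (B + t2 + q * (m + τ)) • u = (p + B • u) + (t2 + q * (m + τ)) • u by module,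
          e2, hxp]
        module)
    have g2 := le_vol_fib hu hmc hmv (x := p) (s := B + s2 + q * (m - τ))
      (t := A + t1 + l * (m - τ))
      (by
        refine ⟨k2 + s2 • u, hs2, q, hq, ?_⟩
        rw [show p + (B + s2 + q * (m - τ)) • u = (p + B • u) + (s2 + q * (m - τ)) • u by module,
          e2, hxm]
        module)
      (by
        refine ⟨k1 + t1 • u, ht1, l, hl, ?_⟩
        rw [show p + (A + t1 + l * (m - τ)) • u = (p + A • u) + (t1 + l * (m - τ)) • u by module,
          e1, hxm]
        module)
    refine le_trans ?_ (add_le_add g1 g2)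
    refine le_trans ?_ ENNReal.ofReal_add_le
    rw [show (2 : ℝ≥0∞) = ENNReal.ofReal 2 by simp, ← ENNReal.ofReal_mul (by norm_num)]
    apply ENNReal.ofReal_le_ofReal
    have a1 := abs_le.1 (by linarith : |inner ℝ u k1| ≤ (t1 - s1) / 2)
    have a2 := abs_le.1 (by linarith : |inner ℝ u k2| ≤ (t2 - s2) / 2)
    linarith [a1.1, a2.2]

lemma stein_bound {d : ℕ} {u : Eu d} (hu : ‖u‖ = 1) {K : Set (Eu d)} (hKc : IsCompact K)
    (hK : Convex ℝ K) {C : ℝ≥0∞} (hC : ∀ y ∈ K, ∀ z ∈ K, volume (hullT K (y - z)) ≤ C) :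
    ∀ y ∈ stein u K, ∀ z ∈ stein u K, volume (hullT (stein u K) (y - z)) ≤ C := by
  rintro y ⟨s, t, hs, ht, h⟩ z ⟨s', t', hs', ht', h'⟩
  have hD : ∀ δ ∈ Icc (s - t') (t - s'), volume (hullT K ((y - z) + δ • u)) ≤ C := by
    intro δ hδ
    rw [mem_Icc] at hδ
    have hst : 0 ≤ t - s := (by positivity : (0:ℝ) ≤ 2 * |inner ℝ u y|).trans h
    have hst' : 0 ≤ t' - s' := (by positivity : (0:ℝ) ≤ 2 * |inner ℝ u z|).trans h'
    obtain ⟨θ, hθ, rfl⟩ : ∃ θ ∈ Icc (0:ℝ) 1, (1 - θ) * (s - t') + θ * (t - s') = δ := by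
      have : δ ∈ segment ℝ (s - t') (t - s') := by
        rw [segment_eq_Icc (by linarith)]; exact hδ
      obtain ⟨a, b, ha, hb, hab, e⟩ := this
      refine ⟨b, ⟨hb, by linarith⟩, ?_⟩
      rw [← e, ← eq_sub_iff_add_eq.2 hab]; simp
    have p1 := hK hs ht (sub_nonneg.2 hθ.2) hθ.1 (by ring)
    have p2 := hK ht' hs' (sub_nonneg.2 hθ.2) hθ.1 (by ring)
    convert hC _ p1 _ p2 using 3
    module
  set m : ℝ := (s + t - s' - t') / 2 with hm
  have b1 := abs_le.1 (by linarith : |inner ℝ u y| ≤ (t - s) / 2)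
  have b2 := abs_le.1 (by linarith : |inner ℝ u z| ≤ (t' - s') / 2)
  have key := vol_hullT_stein hu hKc hK (y - z) m
  have q1 := hD (m + inner ℝ u (y - z)) (by
    rw [inner_sub_right]; constructor <;> linarith [b1.1, b1.2, b2.1, b2.2])
  have q2 := hD (m - inner ℝ u (y - z)) (by
    rw [inner_sub_right]; constructor <;> linarith [b1.1, b1.2, b2.1, b2.2])
  have := key.trans (add_le_add q1 q2)
  rw [← two_mul] at this
  exact (ENNReal.mul_le_mul_iff_right (by simp) (by simp)).1 this

lemma fib_inter {d : ℕ} (u : Eu d) (A B : Set (Eu d)) (x : Eu d) :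
    fib u (A ∩ B) x = fib u A x ∩ fib u B x := rfl

lemma fib_open_pos {d : ℕ} (u : Eu d) {A : Set (Eu d)} (hA : IsOpen A) {x : Eu d} {s : ℝ}
    (hs : x + s • u ∈ A) : 0 < volume (fib u A x) := by
  have ho : IsOpen (fib u A x) := hA.preimage (by fun_prop : Continuous (fun s : ℝ => x + s • u))
  exact ho.measure_pos volume ⟨s, hs⟩

lemma lt_of_fib {d : ℕ} {u : Eu d} {A B O : Set (Eu d)} (hA : MeasurableSet A) {x : Eu d}
    (hAB : A ⊆ B) (hOB : O ⊆ B) (hd : Disjoint O A) (hO : IsOpen O) {s : ℝ}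
    (hs : x + s • u ∈ O) (hfin : volume (fib u B x) ≠ ∞) :
    volume (fib u A x) < volume (fib u B x) := by
  have h1 : volume (fib u O x) + volume (fib u A x) ≤ volume (fib u B x) := by
    rw [← measure_union _ (measurableSet_fib u hA x)]
    · apply measure_mono
      rintro σ (h | h)
      · exact hOB h
      · exact hAB h
    · rw [Set.disjoint_left]
      intro σ h h'
      exact Set.disjoint_left.1 hd h h'
  have hA' : volume (fib u A x) ≠ ∞ :=
    ne_top_of_le_ne_top hfin (measure_mono fun σ hσ => hAB hσ)
  refine lt_of_lt_of_le ?_ h1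
  rw [add_comm]
  exact ENNReal.lt_add_right hA' (fib_open_pos u hO hs).ne'

lemma stein_strict {d : ℕ} {K : Set (Eu d)} (hKc : IsCompact K) (hK : Convex ℝ K) {r : ℝ}
    {x0 y0 : Eu d} (hx0 : x0 ∈ Metric.ball (0 : Eu d) r) (hx0K : x0 ∉ K)
    (hy0 : y0 ∈ interior K) (hy0B : y0 ∉ Metric.closedBall (0 : Eu d) r) :
    ∃ u : Eu d, ‖u‖ = 1 ∧ volume (K ∩ Metric.closedBall 0 r)
      < volume (stein u K ∩ Metric.closedBall 0 r) := by
  set B := Metric.closedBall (0 : Eu d) r with hB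
  have hBc : IsCompact B := isCompact_closedBall 0 r
  have hBv : Convex ℝ B := convex_closedBall 0 r
  have hne : y0 - x0 ≠ 0 := by
    intro h
    exact hx0K ((sub_eq_zero.1 h) ▸ interior_subset hy0)
  have hnpos : 0 < ‖y0 - x0‖ := norm_pos_iff.2 hne
  set u : Eu d := (‖y0 - x0‖)⁻¹ • (y0 - x0) with hudef
  have hu : ‖u‖ = 1 := by
    rw [hudef, norm_smul, norm_inv, norm_norm, inv_mul_cancel₀ hnpos.ne']
  have hyx : y0 = x0 + ‖y0 - x0‖ • u := by
    rw [hudef, smul_smul, mul_inv_cancel₀ hnpos.ne', one_smul]; abel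
  refine ⟨u, hu, ?_⟩
  have hKBc : IsCompact (K ∩ B) := hKc.inter_right hBc.isClosed
  have hKBv : Convex ℝ (K ∩ B) := hK.inter hBv
  have hSc := stein_compact hu hKc
  have hSBc : IsCompact (stein u K ∩ B) := hSc.inter_right hBc.isClosed
  have hsub : stein u (K ∩ B) ⊆ stein u K ∩ B :=
    subset_inter (stein_mono u inter_subset_left)
      ((stein_mono u inter_subset_right).trans (stein_ball hu r))
  have hO1 : IsOpen (Metric.ball (0 : Eu d) r \ K) := Metric.isOpen_ball.sdiff hKc.isClosed
  have hO2 : IsOpen (interior K \ B) := isOpen_interior.sdiff hBc.isClosed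
  rw [vol_eq_slab hu hKBc.measurableSet, vol_eq_slab hu hSBc.measurableSet]
  set N : Set (Eu d) := {p | ∃ s : ℝ, p + s • u ∈ Metric.ball (0 : Eu d) r \ K} ∩
    {p | ∃ s : ℝ, p + s • u ∈ interior K \ B} ∩ {p | inner ℝ u p ∈ Ioo (0:ℝ) 1} with hN
  have hopen : ∀ O : Set (Eu d), IsOpen O → IsOpen {p : Eu d | ∃ s : ℝ, p + s • u ∈ O} := by
    intro O hO
    have : {p : Eu d | ∃ s : ℝ, p + s • u ∈ O} = ⋃ s : ℝ, (fun p => p + s • u) ⁻¹' O := by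
      ext p; simp
    rw [this]
    exact isOpen_iUnion fun s => hO.preimage (by fun_prop)
  have hNo : IsOpen N := by
    refine ((hopen _ hO1).inter (hopen _ hO2)).inter ?_
    exact isOpen_Ioo.preimage (by fun_prop : Continuous (fun p : Eu d => inner ℝ u p))
  have hNne : N.Nonempty := by
    set c : ℝ := 1 / 2 - inner ℝ u x0 with hc
    refine ⟨x0 + c • u, ⟨⟨-c, ?_⟩, ⟨-c + ‖y0 - x0‖, ?_⟩⟩, ?_⟩
    · rw [show x0 + c • u + (-c) • u = x0 by module]; exact ⟨hx0, hx0K⟩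
    · rw [show x0 + c • u + (-c + ‖y0 - x0‖) • u = x0 + ‖y0 - x0‖ • u by module, ← hyx]
      exact ⟨hy0, hy0B⟩
    · show inner ℝ u (x0 + c • u) ∈ Ioo (0:ℝ) 1
      rw [inner_add_smul_self hu, hc]; constructor <;> norm_num
  refine lintegral_strict_mono_of_ae_le_of_ae_lt_on (s := N)
    (measurable_fib u hSBc.measurableSet).aemeasurable ?_ ?_ ?_ ?_
  · rw [← vol_eq_slab hu hKBc.measurableSet]; exact hKBc.measure_lt_top.ne
  · refine Eventually.of_forall fun p => ?_
    show volume (fib u (K ∩ B) p) ≤ volume (fib u (stein u K ∩ B) p)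
    rw [← vol_fib_stein hu hKBc hKBv]
    exact measure_mono fun σ hσ => hsub hσ
  · rw [Measure.restrict_apply hNo.measurableSet, inter_eq_left.2]
    · exact (hNo.measure_pos volume hNne).ne'
    · intro p hp
      exact ⟨hp.2.1.le, hp.2.2⟩
  · refine Eventually.of_forall ?_
    rintro p ⟨⟨⟨s, hs⟩, ⟨t, ht⟩⟩, -⟩
    have hsB : s ∈ fib u B p := Metric.ball_subset_closedBall hs.1
    have htK : t ∈ fib u K p := mem_fib.2 (interior_subset ht.1)
    rcases fib_empty_or_Icc hu hKc hK p with h | ⟨a, b, hab, h⟩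
    · rw [h] at htK; exact absurd htK (notMem_empty _)
    rcases fib_empty_or_Icc hu hBc hBv p with h' | ⟨a', b', hab', h'⟩
    · rw [h'] at hsB; exact absurd hsB (notMem_empty _)
    have l1 : volume (fib u (K ∩ B) p) < volume (fib u K p) := by
      refine lt_of_fib hKBc.measurableSet inter_subset_left
        (sdiff_subset.trans interior_subset) ?_ hO2 ht ?_
      · rw [Set.disjoint_left]; intro q hq hq'; exact hq.2 hq'.2
      · rw [h]; simp
    have l2 : volume (fib u (K ∩ B) p) < volume (fib u B p) := by
      refine lt_of_fib hKBc.measurableSet inter_subset_right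
        (sdiff_subset.trans Metric.ball_subset_closedBall) ?_ hO1 hs ?_
      · rw [Set.disjoint_left]; intro q hq hq'; exact hq.2 hq'.1
      · rw [h']; simp
    rw [h, Real.volume_Icc] at l1
    rw [h', Real.volume_Icc] at l2
    have hsubfib : fib u (stein u K) p ∩ fib u (stein u B) p ⊆ fib u (stein u K ∩ B) p := by
      rintro σ ⟨h1, h2⟩
      exact ⟨h1, stein_ball hu r h2⟩
    refine lt_of_lt_of_le ?_ (measure_mono hsubfib)
    rw [fib_stein_of_Icc hu hab h, fib_stein_of_Icc hu hab' h', Icc_inter_Icc, Real.volume_Icc]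
    rcases le_total (b - a) (b' - a') with hle | hle
    · refine lt_of_lt_of_le l1 (ENNReal.ofReal_le_ofReal ?_)
      rw [sup_eq_left.2 (by linarith), inf_eq_left.2 (by linarith)]; linarith
    · refine lt_of_lt_of_le l2 (ENNReal.ofReal_le_ofReal ?_)
      rw [sup_eq_right.2 (by linarith), inf_eq_right.2 (by linarith)]; linarith

lemma mem_of_ball_near {d : ℕ} {H : Set (Eu d)} (hH : IsClosed H) (hv : Convex ℝ H) {p : Eu d}
    {r δ : ℝ} (hδ0 : 0 ≤ δ) (hδ : δ < r)
    (h : ∀ q ∈ Metric.ball p r, ∃ q' ∈ H, dist q q' ≤ δ) : p ∈ H := by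
  by_contra hp
  obtain ⟨f, s, hfs, hfp⟩ := geometric_hahn_banach_closed_point hv hH hp
  set u := (InnerProductSpace.toDual ℝ (Eu d)).symm f with hu
  have hf : ∀ q, f q = inner ℝ u q := fun q => by
    rw [hu, InnerProductSpace.toDual_symm_apply]
  have hu0 : u ≠ 0 := by
    intro h0
    obtain ⟨q', hq', -⟩ := h p (Metric.mem_ball_self (by linarith))
    have := (hfs q' hq').trans hfp
    rw [hf, hf, h0] at this
    simp at this
  have hn : 0 < ‖u‖ := norm_pos_iff.2 hu0
  set ρ := (δ + r) / 2 with hρ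
  have hρ0 : 0 ≤ ρ := by linarith
  obtain ⟨q', hq', hd⟩ := h (p + (ρ / ‖u‖) • u) (by
    rw [Metric.mem_ball, dist_eq_norm, add_sub_cancel_left, norm_smul, Real.norm_eq_abs,
      abs_of_nonneg (by positivity), div_mul_cancel₀ _ hn.ne']
    linarith)
  have h1 := (hfs q' hq').trans hfp
  rw [hf, hf] at h1
  have h2 : inner ℝ u ((p + (ρ / ‖u‖) • u) - q') ≤ ‖u‖ * δ := by
    refine (real_inner_le_norm _ _).trans ?_
    rw [← dist_eq_norm]
    gcongr
  rw [inner_sub_right, inner_add_right, inner_smul_right, real_inner_self_eq_norm_sq] at h2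
  have h3 : ρ / ‖u‖ * ‖u‖ ^ 2 = ‖u‖ * ρ := by field_simp
  rw [h3] at h2
  have : ‖u‖ * δ < ‖u‖ * ρ := by
    apply mul_lt_mul_of_pos_left _ hn; linarith
  linarith

open TopologicalSpace in
lemma near_pt {d : ℕ} {L L' : NonemptyCompacts (Eu d)} {ε : ℝ} (h : dist L L' < ε) {x : Eu d}
    (hx : x ∈ (L : Set (Eu d))) : ∃ y ∈ (L' : Set (Eu d)), dist x y < ε := by
  rw [Metric.NonemptyCompacts.dist_eq] at h
  refine Metric.exists_dist_lt_of_hausdorffDist_lt hx h ?_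
  exact Metric.hausdorffEDist_ne_top_of_nonempty_of_bounded L.nonempty L'.nonempty
    L.isCompact.isBounded L'.isCompact.isBounded

open TopologicalSpace in
lemma isClosed_convex {d : ℕ} : IsClosed {L : NonemptyCompacts (Eu d) | Convex ℝ (L : Set (Eu d))} := by
  apply isClosed_of_closure_subset
  intro L hL
  show Convex ℝ (L : Set (Eu d))
  intro x hx y hy a b ha hb hab
  rw [← L.isCompact.isClosed.closure_eq, Metric.mem_closure_iff]
  intro ε hε
  obtain ⟨L', hL', hd⟩ := Metric.mem_closure_iff.1 hL (ε / 2) (by positivity)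
  obtain ⟨x', hx', hxx⟩ := near_pt hd hx
  obtain ⟨y', hy', hyy⟩ := near_pt hd hy
  have hp' : a • x' + b • y' ∈ (L' : Set (Eu d)) := (hL' : Convex ℝ (L' : Set (Eu d))) hx' hy' ha hb hab
  rw [dist_comm] at hd
  obtain ⟨q, hq, hqq⟩ := near_pt hd hp'
  refine ⟨q, hq, ?_⟩
  have : dist (a • x + b • y) (a • x' + b • y') ≤ ε / 2 := by
    rw [dist_eq_norm] at hxx hyy ⊢
    rw [show a • x + b • y - (a • x' + b • y') = a • (x - x') + b • (y - y') by module]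
    refine (norm_add_le _ _).trans ?_
    rw [norm_smul, norm_smul, Real.norm_of_nonneg ha, Real.norm_of_nonneg hb]
    calc _ ≤ a * (ε / 2) + b * (ε / 2) := by gcongr
      _ = ε / 2 := by rw [← add_mul, hab, one_mul]
  linarith [dist_triangle (a • x + b • y) (a • x' + b • y') q]

open TopologicalSpace in
lemma isClosed_bound {d : ℕ} (C : ℝ≥0∞) : IsClosed {L : NonemptyCompacts (Eu d) |
    Convex ℝ (L : Set (Eu d)) ∧ ∀ y ∈ (L : Set (Eu d)), ∀ z ∈ (L : Set (Eu d)),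
      volume (hullT (L : Set (Eu d)) (y - z)) ≤ C} := by
  apply isClosed_of_closure_subset
  intro L hL
  have hLv : Convex ℝ (L : Set (Eu d)) := by
    have := closure_mono (t := {L : NonemptyCompacts (Eu d) | Convex ℝ (L : Set (Eu d))})
      (fun L hL => hL.1) hL
    rwa [isClosed_convex.closure_eq] at this
  refine ⟨hLv, fun y hy z hz => ?_⟩
  have hpos : ∀ n : ℕ, 0 < 1 / ((n:ℝ) + 1) := fun n => by positivity
  choose M hM hMd using fun n : ℕ => Metric.mem_closure_iff.1 hL (1 / ((n:ℝ) + 1)) (hpos n)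
  choose Y hY hYd using fun n : ℕ => near_pt (hMd n) hy
  choose Z hZ hZd using fun n : ℕ => near_pt (hMd n) hz
  rw [← vol_interior_eq (hullT_convex hLv _)]
  refine vol_le_of_eventually (U := fun n => hullT (M n : Set (Eu d)) (Y n - Z n)) ?_
    (fun n => (hM n).2 _ (hY n) _ (hZ n))
  intro p hp
  obtain ⟨r, hr, hball⟩ := Metric.mem_nhds_iff.1 (mem_interior_iff_mem_nhds.1 hp)
  have hlim : Tendsto (fun n : ℕ => 3 * (1 / ((n : ℝ) + 1))) atTop (𝓝 0) := by
    simpa using tendsto_one_div_add_atTop_nhds_zero_nat.const_mul (3:ℝ)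
  filter_upwards [hlim.eventually_lt_const hr] with n hn
  have hε := hpos n
  have hd1 := hYd n
  have hd2 := hZd n
  set ε := 1 / ((n : ℝ) + 1) with hεdef
  refine mem_of_ball_near (hullT_compact (M n).isCompact _).isClosed
    (hullT_convex (hM n).1 _) (by positivity) hn ?_
  intro q hq
  obtain ⟨k, hk, l, hl, rfl⟩ := hball hq
  obtain ⟨k', hk', hkk⟩ := near_pt (hMd n) hk
  refine ⟨k' + l • (Y n - Z n), ⟨k', hk', l, hl, rfl⟩, ?_⟩
  rw [← hεdef] at hkk
  rw [dist_eq_norm] at *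
  rw [show k + l • (y - z) - (k' + l • (Y n - Z n)) = (k - k') + l • ((y - Y n) - (z - Z n)) by module]
  refine (norm_add_le _ _).trans ?_
  rw [norm_smul, Real.norm_of_nonneg hl.1]
  have h1 := norm_sub_le (y - Y n) (z - Z n)
  have h2 : l * ‖y - Y n - (z - Z n)‖ ≤ 1 * ‖y - Y n - (z - Z n)‖ :=
    mul_le_mul_of_nonneg_right hl.2 (norm_nonneg _)
  linarith

open TopologicalSpace in
lemma usc_vol {d : ℕ} (μ : Measure (Eu d)) [μ.OuterRegular] :
    UpperSemicontinuous (fun L : NonemptyCompacts (Eu d) => μ (L : Set (Eu d))) := by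
  intro L c hc
  obtain ⟨U, hLU, hU, hUc⟩ := (L : Set (Eu d)).exists_isOpen_lt_of_lt c hc
  filter_upwards [(NonemptyCompacts.isOpen_subsets_of_isOpen hU).mem_nhds hLU] with L' hL'
  exact lt_of_le_of_lt (measure_mono hL') hUc

open TopologicalSpace in
lemma exists_ball_sup {d : ℕ} {K : Set (Eu d)} (hKc : IsCompact K)
    (hK : Convex ℝ K) {C : ℝ≥0∞} (hC : ∀ y ∈ K, ∀ z ∈ K, volume (hullT K (y - z)) ≤ C) {r : ℝ}
    (hr : 0 < r) (hV : volume (Metric.closedBall (0 : Eu d) r) = volume K) :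
    ∃ L : Set (Eu d), Metric.closedBall (0 : Eu d) r ⊆ L ∧
      ∀ y ∈ L, ∀ z ∈ L, volume (hullT L (y - z)) ≤ C := by
  set B := Metric.closedBall (0 : Eu d) r with hB
  have hballpos : 0 < volume B := Metric.measure_closedBall_pos volume 0 hr
  have hBm : MeasurableSet B := Metric.isClosed_closedBall.measurableSet
  have hBfin : volume B ≠ ∞ := (isCompact_closedBall (0 : Eu d) r).measure_lt_top.ne
  obtain ⟨R, hR⟩ := hKc.isBounded.exists_norm_le
  have hKne : K.Nonempty := by
    rw [nonempty_iff_ne_empty]; rintro rfl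
    rw [hV] at hballpos; simp at hballpos
  set S : Set (NonemptyCompacts (Eu d)) := {L | (L : Set (Eu d)) ⊆ Metric.closedBall 0 R} ∩
    ({L | volume B ≤ volume (L : Set (Eu d))} ∩ {L : NonemptyCompacts (Eu d) |
    Convex ℝ (L : Set (Eu d)) ∧ ∀ y ∈ (L : Set (Eu d)), ∀ z ∈ (L : Set (Eu d)),
      volume (hullT (L : Set (Eu d)) (y - z)) ≤ C}) with hS
  have hScpt : IsCompact S := by
    refine (NonemptyCompacts.isCompact_subsets_of_isCompact (isCompact_closedBall 0 R)).inter_right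
      (IsClosed.inter ?_ (isClosed_bound C))
    exact (usc_vol volume).isClosed_preimage (volume B)
  have hSne : S.Nonempty := by
    refine ⟨⟨⟨K, hKc⟩, hKne⟩, ?_, ?_, hK, hC⟩
    · intro k hk; simpa using hR k hk
    · exact hV.le
  obtain ⟨L, ⟨hLR, hLV, hLv, hLC⟩, hmax⟩ := UpperSemicontinuousOn.exists_isMaxOn hSne hScpt
    ((usc_vol (volume.restrict B)).upperSemicontinuousOn S)
  refine ⟨L, ?_, hLC⟩
  by_contra hnot
  have hLm : MeasurableSet (L : Set (Eu d)) := L.isCompact.measurableSet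
  obtain ⟨x0, hx0, hx0L⟩ : ∃ x0 ∈ Metric.ball (0 : Eu d) r, x0 ∉ (L : Set (Eu d)) := by
    by_contra! h
    apply hnot
    rw [hB, ← closure_ball _ hr.ne']
    exact closure_minimal h L.isCompact.isClosed
  have hO1 : IsOpen (Metric.ball (0 : Eu d) r \ L) := Metric.isOpen_ball.sdiff L.isCompact.isClosed
  have hlt : volume ((L : Set (Eu d)) ∩ B) < volume B := by
    have hLB : volume ((L : Set (Eu d)) ∩ B) ≠ ∞ :=
      ne_top_of_le_ne_top hBfin (measure_mono inter_subset_right)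
    have h1 : volume ((L : Set (Eu d)) ∩ B) + volume (Metric.ball (0 : Eu d) r \ L) ≤ volume B := by
      rw [← measure_union _ hO1.measurableSet]
      · apply measure_mono
        rintro q (h | h)
        · exact h.2
        · exact Metric.ball_subset_closedBall h.1
      · rw [Set.disjoint_left]; intro q hq hq'; exact hq'.2 hq.1
    exact lt_of_lt_of_le
      (ENNReal.lt_add_right hLB (hO1.measure_pos volume ⟨x0, hx0, hx0L⟩).ne') h1
  obtain ⟨y0, hy0, hy0B⟩ : ∃ y0 ∈ interior (L : Set (Eu d)), y0 ∉ B := by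
    by_contra! h
    have : volume (L : Set (Eu d)) ≤ volume ((L : Set (Eu d)) ∩ B) := by
      rw [← vol_interior_eq hLv]
      exact measure_mono fun q hq => ⟨interior_subset hq, h q hq⟩
    exact absurd (hLV.trans this) (not_le.2 hlt)
  obtain ⟨u, hu, hstrict⟩ := stein_strict L.isCompact hLv hx0 hx0L hy0 hy0B
  have hSvol := vol_stein hu L.isCompact hLv
  have hstne : (stein u (L : Set (Eu d))).Nonempty := by
    rw [nonempty_iff_ne_empty]; intro h
    rw [h, measure_empty] at hSvol
    have : volume B ≤ 0 := by rw [hSvol]; exact hLV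
    exact absurd this (not_le.2 hballpos)
  set L' : NonemptyCompacts (Eu d) := ⟨⟨stein u L, stein_compact hu L.isCompact⟩, hstne⟩ with hL'
  have hL'S : L' ∈ S := by
    refine ⟨?_, ?_, ?_, ?_⟩
    · exact (stein_mono u hLR).trans (stein_ball hu R)
    · show volume B ≤ volume (stein u (L : Set (Eu d)))
      rw [hSvol]; exact hLV
    · exact stein_convex u hLv
    · exact stein_bound hu L.isCompact hLv hLC
  have hle := hmax hL'S
  have hle' : volume.restrict B (stein u (L : Set (Eu d))) ≤ volume.restrict B (L : Set (Eu d)) := hle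
  rw [Measure.restrict_apply (stein_compact hu L.isCompact).measurableSet,
    Measure.restrict_apply hLm] at hle'
  exact absurd hle' (not_le.2 hstrict)

def splitE (n : ℕ) (p : Eu (n + 1)) : ℝ × Eu n := (p 0, WithLp.toLp 2 (fun i : Fin n => p i.succ))

lemma splitE_mp (n : ℕ) : MeasurePreserving (splitE n) volume volume := by
  have h1 := EuclideanSpace.volume_preserving_symm_measurableEquiv_toLp (Fin (n + 1))
  have h2 := volume_preserving_piFinSuccAbove (fun _ : Fin (n + 1) => ℝ) 0
  have h3 := (MeasurePreserving.id (volume : Measure ℝ)).prod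
    ((EuclideanSpace.volume_preserving_symm_measurableEquiv_toLp (Fin n)).symm)
  exact h3.comp (h2.comp h1)

lemma vol_hullT_ball (n : ℕ) {r : ℝ} (hr : 0 < r) :
    ∃ u : Eu (n + 1), ‖u‖ = 1 ∧
    volume (Metric.closedBall (0 : Eu (n + 1)) r) + ENNReal.ofReal (2 * r) *
      volume (Metric.closedBall (0 : Eu n) r) ≤
    volume (hullT (Metric.closedBall (0 : Eu (n + 1)) r) ((2 * r) • u)) := by
  set u : Eu (n + 1) := EuclideanSpace.single 0 1 with hudef
  have hu : ‖u‖ = 1 := by simp [hudef]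
  have hin : ∀ p : Eu (n + 1), inner ℝ u p = p 0 := by
    intro p
    rw [hudef, EuclideanSpace.inner_single_left]; simp
  refine ⟨u, hu, ?_⟩
  set B := Metric.closedBall (0 : Eu (n + 1)) r with hB
  have hBc : IsCompact B := isCompact_closedBall 0 r
  have hBv : Convex ℝ B := convex_closedBall 0 r
  have hHc := hullT_compact hBc ((2 * r) • u)
  have hHv := hullT_convex hBv ((2 * r) • u)
  set D : Set (Eu (n + 1)) := splitE n ⁻¹' (univ ×ˢ Metric.closedBall (0 : Eu n) r) with hD
  have hDm : MeasurableSet D :=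
    (splitE_mp n).measurable (MeasurableSet.univ.prod Metric.isClosed_closedBall.measurableSet)
  have hDs : volume (D ∩ slab u) = volume (Metric.closedBall (0 : Eu n) r) := by
    have e : D ∩ slab u = splitE n ⁻¹' (Ico (0:ℝ) 1 ×ˢ Metric.closedBall (0 : Eu n) r) := by
      ext p
      simp only [hD, slab, mem_inter_iff, mem_preimage, mem_prod, mem_univ, true_and,
        mem_ofPred_eq, hin, splitE]
      exact and_comm
    rw [e, (splitE_mp n).measure_preimage
      (measurableSet_Ico.prod Metric.isClosed_closedBall.measurableSet).nullMeasurableSet,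
      Measure.volume_eq_prod, Measure.prod_prod]
    simp
  have hDfib : ∀ p ∈ D, -p 0 ∈ fib u B p := by
    intro p hp
    have hp2 : ‖(splitE n p).2‖ ≤ r := by simpa using hp.2
    rw [mem_fib, hB, mem_closedBall_zero_iff]
    refine le_trans (le_of_eq ?_) hp2
    rw [EuclideanSpace.norm_eq, EuclideanSpace.norm_eq, Fin.sum_univ_succ]
    simp [hudef, splitE]
  rw [vol_eq_slab hu hBc.measurableSet, vol_eq_slab hu hHc.measurableSet, ← hDs]
  have : ENNReal.ofReal (2 * r) * volume (D ∩ slab u) =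
      ∫⁻ p in slab u, D.indicator (fun _ => ENNReal.ofReal (2 * r)) p := by
    rw [lintegral_indicator_const hDm, Measure.restrict_apply hDm]
  rw [this, ← lintegral_add_left (measurable_fib u hBc.measurableSet)]
  apply lintegral_mono
  intro p
  show volume (fib u B p) + D.indicator (fun _ => ENNReal.ofReal (2 * r)) p ≤
    volume (fib u (hullT B ((2 * r) • u)) p)
  by_cases hp : p ∈ D
  · rw [indicator_of_mem hp]
    have h0 := hDfib p hp
    rcases fib_empty_or_Icc hu hBc hBv p with h | ⟨a, b, hab, h⟩
    · rw [h] at h0; exact absurd h0 (notMem_empty _)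
    have ha : a ∈ fib u B p := by rw [h]; exact ⟨le_rfl, hab⟩
    have hb : b ∈ fib u B p := by rw [h]; exact ⟨hab, le_rfl⟩
    rw [h, Real.volume_Icc, ← ENNReal.ofReal_add (by linarith) (by linarith)]
    refine le_trans (le_of_eq ?_) (le_vol_fib hu hHc hHv (s := a) (t := b + 2 * r) ?_ ?_)
    · congr 1; ring
    · exact subset_hullT _ _ ha
    · refine ⟨p + b • u, hb, 1, by simp, ?_⟩
      module
  · rw [indicator_of_notMem hp, add_zero]
    exact measure_mono fun σ hσ => subset_hullT _ _ hσ

lemma unitBallVol_pos (n : ℕ) : 0 < unitBallVol n := by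
  unfold unitBallVol
  exact ENNReal.toReal_pos (Metric.measure_closedBall_pos volume 0 one_pos).ne'
    (isCompact_closedBall _ _).measure_lt_top.ne

lemma vol_closedBall_toReal (n : ℕ) {r : ℝ} (hr : 0 < r) :
    volume (Metric.closedBall (0 : Eu n) r) = ENNReal.ofReal (r ^ n * unitBallVol n) := by
  rw [Measure.addHaar_closedBall' volume _ hr.le, ENNReal.ofReal_mul (by positivity), unitBallVol,
    ENNReal.ofReal_toReal (isCompact_closedBall _ _).measure_lt_top.ne]
  simp

lemma lower_bound (n : ℕ) {K : Set (Eu (n + 1))} (hKc : IsCompact K) (hK : Convex ℝ K)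
    (hi : (interior K).Nonempty) {C : ℝ} (hC0 : 0 ≤ C)
    (hC : ∀ y ∈ K, ∀ z ∈ K, (volume (hullT K (y - z))).toReal ≤ C) :
    (1 + 2 * unitBallVol n / unitBallVol (n + 1)) * (volume K).toReal ≤ C := by
  have hV0 : 0 < (volume K).toReal :=
    ENNReal.toReal_pos ((isOpen_interior.measure_pos volume hi).trans_le
      (measure_mono interior_subset)).ne' hKc.measure_lt_top.ne
  set V := (volume K).toReal with hV
  have hv := unitBallVol_pos (n + 1)
  have hv' := unitBallVol_pos n
  set r : ℝ := (V / unitBallVol (n + 1)) ^ ((1:ℝ) / ((n + 1 : ℕ) : ℝ)) with hrdef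
  have hr : 0 < r := by positivity
  have hrpow : r ^ (n + 1) = V / unitBallVol (n + 1) := by
    rw [hrdef, one_div]
    exact Real.rpow_inv_natCast_pow (by positivity) (Nat.succ_ne_zero n)
  have hballV : volume (Metric.closedBall (0 : Eu (n + 1)) r) = volume K := by
    rw [vol_closedBall_toReal _ hr, hrpow, div_mul_cancel₀ _ hv.ne', hV,
      ENNReal.ofReal_toReal hKc.measure_lt_top.ne]
  obtain ⟨L, hBL, hL⟩ := exists_ball_sup hKc hK (C := ENNReal.ofReal C) (fun y hy z hz => by
    rw [← ENNReal.ofReal_toReal (hullT_compact hKc (y - z)).measure_lt_top.ne]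
    exact ENNReal.ofReal_le_ofReal (hC y hy z hz)) hr hballV
  obtain ⟨u, hu, hvol⟩ := vol_hullT_ball n hr
  have h1 := hL (r • u) (hBL (by simp [norm_smul, hu, abs_of_pos hr]))
    (-(r • u)) (hBL (by simp [norm_smul, hu, abs_of_pos hr]))
  rw [show r • u - -(r • u) = (2 * r) • u by module] at h1
  have h2 := hvol.trans ((measure_mono (hullT_mono hBL _)).trans h1)
  rw [vol_closedBall_toReal _ hr, vol_closedBall_toReal _ hr, ← ENNReal.ofReal_mul (by positivity),
    ← ENNReal.ofReal_add (by positivity) (by positivity), ENNReal.ofReal_le_ofReal_iff hC0,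
    hrpow] at h2
  refine le_trans (le_of_eq ?_) h2
  have : 2 * r * (r ^ n * unitBallVol n) = 2 * r ^ (n + 1) * unitBallVol n := by ring
  rw [this, hrpow]
  field_simp

/-- Rogers–Shephard (translation body): for a convex body `K` in Euclidean `d`-space, the
maximal volume of the convex hull of `K` and a meeting translate of `K` lies between
`(1 + 2·v_{d−1}/v_d)·vol(K)` and `(1+d)·vol(K)`. -/
theorem rogers_shephard_translation_body (d : ℕ) (hd : 2 ≤ d)
    (K : Set (EuclideanSpace ℝ (Fin d)))
    (hKc : IsCompact K) (hKconv : Convex ℝ K) (hKint : (interior K).Nonempty) :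
    (1 + 2 * unitBallVol (d - 1) / unitBallVol d) * (volume K).toReal ≤
      sSup {v : ℝ | ∃ x : EuclideanSpace ℝ (Fin d), (K ∩ (x +ᵥ K)).Nonempty ∧
        v = (volume (convexHull ℝ (K ∪ (x +ᵥ K)))).toReal} ∧
    sSup {v : ℝ | ∃ x : EuclideanSpace ℝ (Fin d), (K ∩ (x +ᵥ K)).Nonempty ∧
        v = (volume (convexHull ℝ (K ∪ (x +ᵥ K)))).toReal} ≤
      (1 + (d : ℝ)) * (volume K).toReal := by
  have hle : ∀ v ∈ {v : ℝ | ∃ x : EuclideanSpace ℝ (Fin d), (K ∩ (x +ᵥ K)).Nonempty ∧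
        v = (volume (convexHull ℝ (K ∪ (x +ᵥ K)))).toReal},
      v ≤ (1 + (d : ℝ)) * (volume K).toReal := by
    rintro v ⟨x, ⟨y, hy, z, hz, hyz⟩, rfl⟩
    have hx : x = y - z := by rw [← hyz]; simp
    rw [convexHull_eq_hullT hKconv, hx]
    have := ENNReal.toReal_mono (ENNReal.mul_ne_top (by simp) hKc.measure_lt_top.ne)
      (upper_bound hKc hKconv hKint hy hz)
    rwa [ENNReal.toReal_mul, ENNReal.toReal_ofReal (by positivity)] at this
  have hmem : ∀ y ∈ K, ∀ z ∈ K, (volume (hullT K (y - z))).toReal ∈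
      {v : ℝ | ∃ x : EuclideanSpace ℝ (Fin d), (K ∩ (x +ᵥ K)).Nonempty ∧
        v = (volume (convexHull ℝ (K ∪ (x +ᵥ K)))).toReal} := by
    intro y hy z hz
    refine ⟨y - z, ⟨y, hy, z, hz, by simp⟩, ?_⟩
    rw [convexHull_eq_hullT hKconv]
  have hbdd : BddAbove {v : ℝ | ∃ x : EuclideanSpace ℝ (Fin d), (K ∩ (x +ᵥ K)).Nonempty ∧
        v = (volume (convexHull ℝ (K ∪ (x +ᵥ K)))).toReal} := ⟨_, hle⟩
  obtain ⟨k, hk⟩ := hKint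
  have hk' := interior_subset hk
  refine ⟨?_, csSup_le ⟨_, hmem k hk' k hk'⟩ hle⟩
  obtain ⟨n, rfl⟩ : ∃ n, d = n + 1 := ⟨d - 1, by omega⟩
  rw [Nat.add_sub_cancel]
  refine lower_bound n hKc hKconv ⟨k, hk⟩ ?_ (fun y hy z hz => le_csSup hbdd (hmem y hy z hz))
  exact le_trans ENNReal.toReal_nonneg (le_csSup hbdd (hmem k hk' k hk'))
end

section
/- (G.Horváth–Lángi) Let K be a convex body in EuclideanSpace ℝ (Fin d), d ≥ 2, and define c^{tr}(K) = (1/vol(K)) · sup { vol(convexHull ℝ (K ∪ (x +ᵥ K))) : x ∈ EuclideanSpace ℝ (Fin d), K ∩ (x +ᵥ K) ≠ ∅ }. Then c^{tr}(K) ≥ 1 + 2·v_{d−1}/v_d, with equality if and only if K is an ellipsoid, i.e., K is the image of the closed unit Euclidean ball under an invertible affine map. -/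
open MeasureTheory Pointwise

/-- `ctr K` is the relative maximal volume of the convex hull of `K` and a meeting
translate of `K`. -/
noncomputable def ctr {d : ℕ} (K : Set (EuclideanSpace ℝ (Fin d))) : ℝ :=
  (1 / (volume K).toReal) *
    sSup {v : ℝ | ∃ x : EuclideanSpace ℝ (Fin d), (K ∩ (x +ᵥ K)).Nonempty ∧
      v = (volume (convexHull ℝ (K ∪ (x +ᵥ K)))).toReal}


open MeasureTheory Pointwise
set_option linter.unusedSectionVars false

namespace HL

section Fiber

variable {E : Type*} [NormedAddCommGroup E] [InnerProductSpace ℝ E]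

/-- The fiber of `A` over `y` in direction `u`. -/
def fib (u : E) (A : Set E) (y : E) : Set ℝ := {t : ℝ | y + t • u ∈ A}

/-- The component of `p` orthogonal to the unit vector `u`. -/
noncomputable def prj (u p : E) : E := p - (inner ℝ u p) • u

/-- Fiberwise linear combination. -/
noncomputable def comb (u : E) (a b : ℝ) (p q : E) : E :=
  prj u p + (a * inner ℝ u p + b * inner ℝ u q) • u

/-- Fiberwise linear combination of sets. -/
def mix (u : E) (a b : ℝ) (A B : Set E) : Set E :=
  {x | ∃ p ∈ A, ∃ q ∈ B, prj u p = prj u q ∧ comb u a b p q = x}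

/-- Steiner symmetrization. -/
noncomputable def stein (u : E) (K : Set E) : Set E := mix u (1/2) (-1/2) K K

/-- `K + [0,x]`. -/
def ext (K : Set E) (x : E) : Set E := {z | ∃ k ∈ K, ∃ t ∈ Set.Icc (0:ℝ) 1, k + t • x = z}

lemma prj_add (u p q : E) : prj u (p + q) = prj u p + prj u q := by
  simp only [prj, inner_add_right]; module

lemma prj_smul (u : E) (c : ℝ) (p : E) : prj u (c • p) = c • prj u p := by
  simp only [prj, inner_smul_right]; module

lemma prj_sub (u p q : E) : prj u (p - q) = prj u p - prj u q := by
  simp only [prj, inner_sub_right]; module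

lemma comb_add (u : E) (a b : ℝ) (p q p' q' : E) :
    comb u a b (p + p') (q + q') = comb u a b p q + comb u a b p' q' := by
  simp only [comb, prj_add, inner_add_right]; module

lemma comb_sub (u : E) (a b : ℝ) (p q p' q' : E) :
    comb u a b (p - p') (q - q') = comb u a b p q - comb u a b p' q' := by
  simp only [comb, prj_sub, inner_sub_right]; module

lemma comb_smul (u : E) (a b c : ℝ) (p q : E) :
    comb u a b (c • p) (c • q) = c • comb u a b p q := by
  simp only [comb, prj_smul, inner_smul_right]; module

lemma inner_self_one {u : E} (hu : ‖u‖ = 1) : inner ℝ u u = (1:ℝ) := by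
  rw [real_inner_self_eq_norm_sq, hu]; norm_num

lemma inner_prj {u : E} (hu : ‖u‖ = 1) (p : E) : inner ℝ u (prj u p) = (0:ℝ) := by
  simp [prj, inner_sub_right, inner_smul_right, hu]

lemma prj_u {u : E} (hu : ‖u‖ = 1) : prj u u = 0 := by
  simp [prj, hu]

lemma prj_of_orth {u y : E} (hy : inner ℝ u y = (0:ℝ)) : prj u y = y := by
  simp [prj, hy]

lemma prj_line {u y : E} (hu : ‖u‖ = 1) (hy : inner ℝ u y = (0:ℝ)) (t : ℝ) :
    prj u (y + t • u) = y := by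
  rw [prj_add, prj_smul, prj_u hu, prj_of_orth hy]; simp

lemma inner_line {u y : E} (hu : ‖u‖ = 1) (hy : inner ℝ u y = (0:ℝ)) (t : ℝ) :
    inner ℝ u (y + t • u) = t := by
  simp [inner_add_right, inner_smul_right, hu, hy]

lemma prj_add_inner (u p : E) : prj u p + (inner ℝ u p : ℝ) • u = p := by
  simp [prj]

lemma prj_comb {u : E} (hu : ‖u‖ = 1) (a b : ℝ) (p q : E) :
    prj u (comb u a b p q) = prj u p := by
  rw [comb, prj_line hu (inner_prj hu p)]

lemma inner_comb {u : E} (hu : ‖u‖ = 1) (a b : ℝ) (p q : E) :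
    inner ℝ u (comb u a b p q) = a * inner ℝ u p + b * inner ℝ u q := by
  rw [comb, inner_line hu (inner_prj hu p)]

lemma comb_line {u y : E} (hu : ‖u‖ = 1) (hy : inner ℝ u y = (0:ℝ)) (a b s t : ℝ) :
    comb u a b (y + s • u) (y + t • u) = y + (a * s + b * t) • u := by
  rw [comb, prj_line hu hy, inner_line hu hy, inner_line hu hy]

lemma fib_mix {u y : E} (hu : ‖u‖ = 1) (hy : inner ℝ u y = (0:ℝ)) (a b : ℝ) (A B : Set E) :
    fib u (mix u a b A B) y =
      {t | ∃ s ∈ fib u A y, ∃ r ∈ fib u B y, a * s + b * r = t} := by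
  ext t
  constructor
  · rintro ⟨p, hp, q, hq, hpq, h⟩
    have h1 : prj u p = y := by
      rw [← prj_comb hu a b p q, h, prj_line hu hy]
    refine ⟨inner ℝ u p, ?_, inner ℝ u q, ?_, ?_⟩
    · change y + _ ∈ A
      rw [← h1, prj_add_inner]; exact hp
    · change y + _ ∈ B
      rw [← h1, hpq, prj_add_inner]; exact hq
    · rw [← inner_comb hu, h, inner_line hu hy]
  · rintro ⟨s, hs, r, hr, h⟩
    refine ⟨_, hs, _, hr, ?_, ?_⟩
    · rw [prj_line hu hy, prj_line hu hy]
    · rw [comb_line hu hy, h]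

lemma continuous_prj (u : E) : Continuous (prj u) := by unfold prj; fun_prop

lemma continuous_comb (u : E) (a b : ℝ) : Continuous (fun z : E × E => comb u a b z.1 z.2) := by
  unfold comb prj; fun_prop

lemma mix_eq_image (u : E) (a b : ℝ) (A B : Set E) :
    mix u a b A B = (fun z : E × E => comb u a b z.1 z.2) ''
      ((A ×ˢ B) ∩ {z | prj u z.1 = prj u z.2}) := by
  ext x
  constructor
  · rintro ⟨p, hp, q, hq, h, h'⟩
    exact ⟨(p, q), ⟨⟨hp, hq⟩, h⟩, h'⟩
  · rintro ⟨⟨p, q⟩, ⟨⟨hp, hq⟩, h⟩, h'⟩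
    exact ⟨p, hp, q, hq, h, h'⟩

lemma mix_compact {u : E} {a b : ℝ} {A B : Set E} (hA : IsCompact A) (hB : IsCompact B) :
    IsCompact (mix u a b A B) := by
  rw [mix_eq_image]
  refine IsCompact.image ?_ (continuous_comb u a b)
  exact (hA.prod hB).inter_right (isClosed_eq ((continuous_prj u).comp continuous_fst)
    ((continuous_prj u).comp continuous_snd))

lemma mix_convex {u : E} {a b : ℝ} {A B : Set E} (hA : Convex ℝ A) (hB : Convex ℝ B) :
    Convex ℝ (mix u a b A B) := by
  rintro x ⟨p, hp, q, hq, h, rfl⟩ x' ⟨p', hp', q', hq', h', rfl⟩ s t hs ht hst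
  refine ⟨s • p + t • p', hA hp hp' hs ht hst, s • q + t • q', hB hq hq' hs ht hst, ?_, ?_⟩
  · simp only [prj_add, prj_smul, h, h']
  · rw [comb_add, comb_smul, comb_smul]

lemma ext_eq_image (K : Set E) (x : E) :
    ext K x = (fun z : E × ℝ => z.1 + z.2 • x) '' (K ×ˢ Set.Icc (0:ℝ) 1) := by
  ext z
  constructor
  · rintro ⟨k, hk, t, ht, h⟩; exact ⟨(k, t), ⟨hk, ht⟩, h⟩
  · rintro ⟨⟨k, t⟩, ⟨hk, ht⟩, h⟩; exact ⟨k, hk, t, ht, h⟩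

lemma ext_compact {K : Set E} (hK : IsCompact K) (x : E) : IsCompact (ext K x) := by
  rw [ext_eq_image]
  exact (hK.prod isCompact_Icc).image (by fun_prop)

lemma ext_convex {K : Set E} (hK : Convex ℝ K) (x : E) : Convex ℝ (ext K x) := by
  rintro _ ⟨k, hk, t, ht, rfl⟩ _ ⟨k', hk', t', ht', rfl⟩ a b ha hb hab
  refine ⟨a • k + b • k', hK hk hk' ha hb hab, a * t + b * t', ?_, by module⟩
  exact (convex_Icc (0:ℝ) 1) ht ht' ha hb hab

lemma subset_ext (K : Set E) (x : E) : K ⊆ ext K x :=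
  fun k hk => ⟨k, hk, 0, by simp, by simp⟩

lemma ext_mono {K L : Set E} (h : K ⊆ L) (x : E) : ext K x ⊆ ext L x := by
  rintro _ ⟨k, hk, t, ht, rfl⟩; exact ⟨k, h hk, t, ht, rfl⟩

lemma ext_mix {u : E} {a b : ℝ} {K L : Set E} {x₁ x₂ : E} (h : prj u x₁ = prj u x₂) :
    ext (mix u a b K L) (comb u a b x₁ x₂) ⊆ mix u a b (ext K x₁) (ext L x₂) := by
  rintro _ ⟨_, ⟨p, hp, q, hq, hpq, rfl⟩, t, ht, rfl⟩
  refine ⟨p + t • x₁, ⟨p, hp, t, ht, rfl⟩, q + t • x₂, ⟨q, hq, t, ht, rfl⟩, ?_, ?_⟩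
  · simp only [prj_add, prj_smul, h, hpq]
  · rw [comb_add, comb_smul]

lemma fib_ext {u y : E} {A : Set E} {c : ℝ} :
    fib u (ext A (c • u)) y = {t | ∃ s ∈ fib u A y, ∃ r ∈ Set.Icc (0:ℝ) 1, s + r * c = t} := by
  ext t
  constructor
  · rintro ⟨k, hk, r, hr, h⟩
    refine ⟨t - r * c, ?_, r, hr, by ring⟩
    change y + _ ∈ A
    have : y + (t - r * c) • u = k := by
      have : k = y + t • u - r • c • u := by rw [← h]; simp
      rw [this]; module
    rw [this]; exact hk
  · rintro ⟨s, hs, r, hr, rfl⟩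
    exact ⟨_, hs, r, hr, by module⟩

lemma fib_compact {u : E} (hu : ‖u‖ = 1) {A : Set E} (hA : IsCompact A) (y : E) :
    IsCompact (fib u A y) := by
  have hcl : Topology.IsClosedEmbedding (fun t : ℝ => y + t • u) := by
    refine Isometry.isClosedEmbedding (Isometry.of_dist_eq fun s t => ?_)
    rw [dist_eq_norm, dist_eq_norm, add_sub_add_left_eq_sub, ← sub_smul, norm_smul, hu, mul_one]
  exact hcl.isCompact_preimage hA

lemma fib_convex {u : E} {A : Set E} (hA : Convex ℝ A) (y : E) : Convex ℝ (fib u A y) := by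
  intro s hs t ht a b ha hb hab
  have := hA hs ht ha hb hab
  have e : a • (y + s • u) + b • (y + t • u) = y + (a • s + b • t) • u := by
    simp only [smul_eq_mul]
    calc _ = (a + b) • y + (a * s + b * t) • u := by module
      _ = _ := by rw [hab, one_smul]
  rw [e] at this
  exact this

lemma fib_Icc {u : E} (hu : ‖u‖ = 1) {A : Set E} (hA : IsCompact A) (hA' : Convex ℝ A) (y : E)
    (hne : (fib u A y).Nonempty) : ∃ a b, a ≤ b ∧ fib u A y = Set.Icc a b := by
  have hc := fib_compact hu hA y
  have hcon : IsPreconnected (fib u A y) := (fib_convex hA' y).isPreconnected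
  refine ⟨_, _, ?_, eq_Icc_of_connected_compact ⟨hne, hcon⟩ hc⟩
  exact csInf_le_csSup hne hc.bddBelow hc.bddAbove

lemma mem_orth {u : E} (y : (Submodule.span ℝ {u})ᗮ) : inner ℝ u (y:E) = (0:ℝ) :=
  Submodule.mem_orthogonal_singleton_iff_inner_right.1 y.2

variable [FiniteDimensional ℝ E] [MeasurableSpace E] [BorelSpace E]

/-- Cavalieri along the direction `u`. -/
lemma fiber_volume {u : E} (hu : ‖u‖ = 1) {A : Set E} (hA : MeasurableSet A) :
    volume A = ∫⁻ y : (Submodule.span ℝ {u})ᗮ, volume (fib u A y) := by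
  set F := Submodule.span ℝ {u}
  let f : WithLp 2 (F × Fᗮ) ≃ₗᵢ[ℝ] E := F.orthogonalDecomposition.symm
  have h1 : MeasurePreserving f volume volume := f.measurePreserving
  have h2 := WithLp.volume_preserving_toLp F Fᗮ
  have h3 : MeasurePreserving (LinearIsometryEquiv.toSpanUnitSingleton (𝕜 := ℝ) u hu) volume volume :=
    LinearIsometryEquiv.measurePreserving _
  have h4 : MeasurePreserving (Prod.map (LinearIsometryEquiv.toSpanUnitSingleton (𝕜 := ℝ) u hu) (id : Fᗮ → Fᗮ))
      (volume.prod volume) (volume.prod volume) := h3.prod (MeasurePreserving.id _)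
  have h5 : MeasurePreserving (Prod.swap : Fᗮ × ℝ → ℝ × Fᗮ) (volume.prod volume) (volume.prod volume) :=
    Measure.measurePreserving_swap
  have h6 := h1.comp (h2.comp (h4.comp h5))
  rw [← h6.measure_preimage hA.nullMeasurableSet, Measure.prod_apply (h6.measurable hA)]
  refine lintegral_congr fun y => ?_
  congr 1
  ext t
  simp only [Set.mem_preimage, Function.comp, Prod.swap, Prod.map, id, fib, Set.mem_ofPred_eq]
  have : f (WithLp.toLp 2 ((LinearIsometryEquiv.toSpanUnitSingleton (𝕜 := ℝ) u hu) t, y)) = y + t • u := by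
    change ((LinearIsometryEquiv.toSpanUnitSingleton (𝕜 := ℝ) u hu t : F) : E) + (y:E) = _
    simp [add_comm]
  rw [this]

lemma fib_measurable {u : E} {A : Set E} (hA : MeasurableSet A) :
    Measurable (fun y : (Submodule.span ℝ {u})ᗮ => volume (fib u A y)) := by
  have : MeasurableSet {z : (Submodule.span ℝ {u})ᗮ × ℝ | (z.1:E) + z.2 • u ∈ A} := by
    have hm : Measurable (fun z : (Submodule.span ℝ {u})ᗮ × ℝ => (z.1:E) + z.2 • u) := by
      apply Continuous.measurable; fun_prop
    exact hm hA
  exact measurable_measure_prodMk_left this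

lemma vol_mix_le {u : E} (hu : ‖u‖ = 1) {a b : ℝ} {A B : Set E} (hA : IsCompact A)
    (hA' : Convex ℝ A) (hB : IsCompact B) (hB' : Convex ℝ B) :
    volume (mix u a b A B) ≤ ENNReal.ofReal |a| * volume A + ENNReal.ofReal |b| * volume B := by
  rw [fiber_volume hu (mix_compact hA hB).measurableSet, fiber_volume hu hA.measurableSet,
    fiber_volume hu hB.measurableSet, ← lintegral_const_mul _ (fib_measurable hA.measurableSet),
    ← lintegral_const_mul _ (fib_measurable hB.measurableSet),
    ← lintegral_add_left ((fib_measurable hA.measurableSet).const_mul _)]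
  refine lintegral_mono fun y => ?_
  dsimp only
  rw [fib_mix hu (mem_orth y)]
  rcases (fib u A y).eq_empty_or_nonempty with h | h
  · simp [h]
  rcases (fib u B y).eq_empty_or_nonempty with h' | h'
  · simp [h']
  obtain ⟨i, j, hij, hI⟩ := fib_Icc hu hA hA' y h
  obtain ⟨k, l, hkl, hJ⟩ := fib_Icc hu hB hB' y h'
  rw [hI, hJ]
  calc volume {t | ∃ s ∈ Set.Icc i j, ∃ r ∈ Set.Icc k l, a * s + b * r = t}
      ≤ volume (Metric.closedBall (a * ((i+j)/2) + b * ((k+l)/2)) (|a| * ((j-i)/2) + |b| * ((l-k)/2))) := by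
        apply measure_mono
        rintro _ ⟨s, hs, r, hr, rfl⟩
        rw [Metric.mem_closedBall, Real.dist_eq]
        have e : a * s + b * r - (a * ((i+j)/2) + b * ((k+l)/2)) = a * (s - (i+j)/2) + b * (r - (k+l)/2) := by ring
        rw [e]
        refine (abs_add_le _ _).trans ?_
        rw [abs_mul, abs_mul]
        gcongr
        · rw [abs_le]; constructor <;> linarith [hs.1, hs.2]
        · rw [abs_le]; constructor <;> linarith [hr.1, hr.2]
    _ ≤ _ := by
        rw [Real.volume_closedBall, Real.volume_Icc, Real.volume_Icc, ← ENNReal.ofReal_mul (abs_nonneg _),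
          ← ENNReal.ofReal_mul (abs_nonneg _), ← ENNReal.ofReal_add]
        · apply ENNReal.ofReal_le_ofReal; linarith
        · exact mul_nonneg (abs_nonneg _) (by linarith)
        · exact mul_nonneg (abs_nonneg _) (by linarith)

lemma vol_stein {u : E} (hu : ‖u‖ = 1) {A : Set E} (hA : IsCompact A)
    (hA' : Convex ℝ A) : volume (stein u A) = volume A := by
  apply le_antisymm
  · refine (vol_mix_le hu hA hA' hA hA').trans ?_
    rw [← add_mul, ← ENNReal.ofReal_add (abs_nonneg _) (abs_nonneg _)]
    norm_num
  · unfold stein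
    rw [fiber_volume hu (mix_compact hA hA).measurableSet, fiber_volume hu hA.measurableSet]
    refine lintegral_mono fun y => ?_
    dsimp only
    rw [fib_mix hu (mem_orth y)]
    rcases (fib u A y).eq_empty_or_nonempty with h | h
    · simp [h]
    obtain ⟨i, j, hij, hI⟩ := fib_Icc hu hA hA' y h
    rw [hI, Real.volume_Icc]
    calc ENNReal.ofReal (j - i) = volume (Metric.closedBall (0:ℝ) ((j-i)/2)) := by
          rw [Real.volume_closedBall]; congr 1; ring
      _ ≤ _ := by
        apply measure_mono
        intro t ht
        rw [Metric.mem_closedBall, dist_zero_right, Real.norm_eq_abs, abs_le] at ht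
        exact ⟨(i+j)/2 + t, ⟨by linarith [ht.1], by linarith [ht.2]⟩, (i+j)/2 - t,
          ⟨by linarith [ht.2], by linarith [ht.1]⟩, by ring⟩

/-- The shadow of `A` in direction `u`. -/
def shadow (u : E) (A : Set E) : Set ((Submodule.span ℝ {u})ᗮ) := {y | (fib u A y).Nonempty}

lemma shadow_compact {u : E} (hu : ‖u‖ = 1) {A : Set E} (hA : IsCompact A) :
    IsCompact (shadow u A) := by
  have hcl : Topology.IsClosedEmbedding (Subtype.val : (Submodule.span ℝ {u})ᗮ → E) :=
    (Submodule.isClosed_orthogonal _).isClosedEmbedding_subtypeVal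
  have : shadow u A = Subtype.val ⁻¹' (prj u '' A) := by
    ext y
    constructor
    · rintro ⟨t, ht⟩
      exact ⟨_, ht, prj_line hu (mem_orth y) t⟩
    · rintro ⟨p, hp, h⟩
      refine ⟨inner ℝ u p, ?_⟩
      change (y:E) + _ ∈ A
      rw [← h, prj_add_inner]; exact hp
  rw [this]
  exact hcl.isCompact_preimage (hA.image (continuous_prj u))

lemma vol_ext {u : E} (hu : ‖u‖ = 1) {A : Set E} (hA : IsCompact A)
    (hA' : Convex ℝ A) {c : ℝ} (hc : 0 ≤ c) :
    volume (ext A (c • u)) = volume A + ENNReal.ofReal c * volume (shadow u A) := by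
  have hs := (shadow_compact hu hA).measurableSet
  rw [fiber_volume hu (ext_compact hA _).measurableSet, fiber_volume hu hA.measurableSet,
    ← setLIntegral_one, ← lintegral_indicator hs, ← lintegral_const_mul,
    ← lintegral_add_left (fib_measurable hA.measurableSet)]
  swap
  · exact measurable_one.indicator hs
  refine lintegral_congr fun y => ?_
  rw [fib_ext]
  rcases (fib u A y).eq_empty_or_nonempty with h | h
  · have : y ∉ shadow u A := by
      intro h'; exact (Set.not_nonempty_iff_eq_empty.2 h) h'
    simp [h, this]
  obtain ⟨i, j, hij, hI⟩ := fib_Icc hu hA hA' y h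
  have : y ∈ shadow u A := h
  rw [Set.indicator_of_mem this, hI, mul_one, Real.volume_Icc, ← ENNReal.ofReal_add (by linarith) hc]
  have : {t | ∃ s ∈ Set.Icc i j, ∃ r ∈ Set.Icc (0:ℝ) 1, s + r * c = t} = Set.Icc i (j + c) := by
    ext t
    constructor
    · rintro ⟨s, hs, r, hr, rfl⟩
      exact ⟨by nlinarith [hs.1, hr.1], by nlinarith [hs.2, hr.2]⟩
    · intro ht
      by_cases htj : t ≤ j
      · exact ⟨t, ⟨ht.1, htj⟩, 0, by simp, by simp⟩
      · push Not at htj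
        have hcp : 0 < c := by linarith [ht.2]
        refine ⟨j, ⟨hij, le_rfl⟩, (t - j)/c, ⟨div_nonneg (by linarith) hc, ?_⟩, by field_simp; ring⟩
        rw [div_le_one hcp]; linarith [ht.2]
  rw [this, Real.volume_Icc]
  congr 1; ring

end Fiber
end HL

open MeasureTheory Pointwise
set_option linter.unusedSectionVars false

namespace HL

section Phi

variable {E : Type*} [NormedAddCommGroup E] [InnerProductSpace ℝ E]
variable [FiniteDimensional ℝ E] [MeasurableSpace E] [BorelSpace E]

/-- Volume of a set as a real number. -/
noncomputable def vol (K : Set E) : ℝ := (volume K).toReal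

/-- The volume increment. -/
noncomputable def phi (K : Set E) (x : E) : ℝ := vol (ext K x) - vol K

/-- Compact convex sets. -/
def CC (K : Set E) : Prop := IsCompact K ∧ Convex ℝ K

lemma CC.ext {K : Set E} (h : CC K) (x : E) : CC (ext K x) := ⟨ext_compact h.1 x, ext_convex h.2 x⟩
lemma CC.mix {K L : Set E} (h : CC K) (h' : CC L) (u : E) (a b : ℝ) : CC (mix u a b K L) :=
  ⟨mix_compact h.1 h'.1, mix_convex h.2 h'.2⟩
lemma CC.stein {K : Set E} (h : CC K) (u : E) : CC (stein u K) := h.mix h u _ _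

lemma CC.fin {K : Set E} (h : CC K) : volume K ≠ ⊤ := h.1.measure_lt_top.ne

lemma vol_nonneg (K : Set E) : 0 ≤ vol K := ENNReal.toReal_nonneg

lemma vol_mono {K L : Set E} (hL : IsCompact L) (h : K ⊆ L) : vol K ≤ vol L :=
  ENNReal.toReal_mono hL.measure_lt_top.ne (measure_mono h)

lemma phi_nonneg {K : Set E} (h : CC K) (x : E) : 0 ≤ phi K x :=
  sub_nonneg.2 (vol_mono (h.ext x).1 (subset_ext K x))

lemma phi_unit {K : Set E} (h : CC K) {u : E} (hu : ‖u‖ = 1) {c : ℝ} (hc : 0 ≤ c) :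
    phi K (c • u) = c * (volume (shadow u K)).toReal := by
  rw [phi, vol, vol, vol_ext hu h.1 h.2 hc, ENNReal.toReal_add h.fin
    (ENNReal.mul_ne_top ENNReal.ofReal_ne_top (shadow_compact hu h.1).measure_lt_top.ne),
    ENNReal.toReal_mul, ENNReal.toReal_ofReal hc]
  ring

lemma phi_zero {K : Set E} : phi K 0 = 0 := by
  have : HL.ext K 0 = K := by
    apply Set.Subset.antisymm
    · rintro _ ⟨k, hk, t, ht, rfl⟩; simpa using hk
    · exact subset_ext K 0
  rw [phi, this, sub_self]

lemma exists_unit {x : E} (hx : x ≠ 0) : ∃ u : E, ‖u‖ = 1 ∧ x = ‖x‖ • u := by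
  refine ⟨‖x‖⁻¹ • x, ?_, ?_⟩
  · rw [norm_smul, norm_inv, norm_norm, inv_mul_cancel₀ (norm_ne_zero_iff.2 hx)]
  · rw [smul_smul, mul_inv_cancel₀ (norm_ne_zero_iff.2 hx), one_smul]

lemma phi_smul {K : Set E} (h : CC K) (x : E) {t : ℝ} (ht : 0 ≤ t) :
    phi K (t • x) = t * phi K x := by
  by_cases hx : x = 0
  · simp [hx, phi_zero]
  obtain ⟨u, hu, hxu⟩ := exists_unit hx
  rw [hxu, smul_smul, phi_unit h hu (by positivity), phi_unit h hu (by positivity)]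
  ring

lemma ext_neg_eq (K : Set E) (x : E) : HL.ext K (-x) = (-x) +ᵥ HL.ext K x := by
  ext z
  rw [Set.mem_vadd_set]
  constructor
  · rintro ⟨k, hk, t, ht, rfl⟩
    exact ⟨k + (1 - t) • x, ⟨k, hk, 1 - t, ⟨by linarith [ht.2], by linarith [ht.1]⟩, rfl⟩,
      by rw [vadd_eq_add]; module⟩
  · rintro ⟨_, ⟨k, hk, t, ht, rfl⟩, rfl⟩
    exact ⟨k, hk, 1 - t, ⟨by linarith [ht.2], by linarith [ht.1]⟩, by rw [vadd_eq_add]; module⟩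

lemma vol_vadd (x : E) (K : Set E) : vol (x +ᵥ K) = vol K := by
  rw [vol, vol, measure_vadd]

lemma phi_neg (K : Set E) (x : E) : phi K (-x) = phi K x := by
  rw [phi, ext_neg_eq, vol_vadd, phi]

lemma ext_vadd (K : Set E) (z x : E) : HL.ext (z +ᵥ K) x = z +ᵥ HL.ext K x := by
  ext w
  simp only [Set.mem_vadd_set]
  constructor
  · rintro ⟨_, ⟨k, hk, rfl⟩, t, ht, rfl⟩
    exact ⟨_, ⟨k, hk, t, ht, rfl⟩, by simp only [vadd_eq_add]; module⟩
  · rintro ⟨_, ⟨k, hk, t, ht, rfl⟩, rfl⟩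
    exact ⟨_, ⟨k, hk, rfl⟩, t, ht, by simp only [vadd_eq_add]; module⟩

lemma phi_vadd (K : Set E) (z x : E) : phi (z +ᵥ K) x = phi K x := by
  rw [phi, ext_vadd, vol_vadd, vol_vadd, phi]

lemma vol_mix_le_real {u : E} (hu : ‖u‖ = 1) {a b : ℝ} {A B : Set E} (hA : CC A) (hB : CC B) :
    vol (mix u a b A B) ≤ |a| * vol A + |b| * vol B := by
  have := vol_mix_le hu (a := a) (b := b) hA.1 hA.2 hB.1 hB.2
  have h1 : ENNReal.ofReal |a| * volume A ≠ ⊤ := ENNReal.mul_ne_top ENNReal.ofReal_ne_top hA.fin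
  have h2 : ENNReal.ofReal |b| * volume B ≠ ⊤ := ENNReal.mul_ne_top ENNReal.ofReal_ne_top hB.fin
  have := ENNReal.toReal_mono (ENNReal.add_ne_top.2 ⟨h1, h2⟩) this
  rwa [ENNReal.toReal_add h1 h2, ENNReal.toReal_mul, ENNReal.toReal_mul,
    ENNReal.toReal_ofReal (abs_nonneg _), ENNReal.toReal_ofReal (abs_nonneg _)] at this

lemma vol_stein_real {u : E} (hu : ‖u‖ = 1) {K : Set E} (h : CC K) : vol (stein u K) = vol K := by
  rw [vol, vol, vol_stein hu h.1 h.2]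

lemma phi_stein {u : E} (hu : ‖u‖ = 1) {K : Set E} (h : CC K) {x₁ x₂ : E}
    (hx : prj u x₁ = prj u x₂) :
    phi (stein u K) (comb u (1/2) (-1/2) x₁ x₂) ≤ (phi K x₁ + phi K x₂) / 2 := by
  have h1 := vol_mono ((h.ext x₁).mix (h.ext x₂) u _ _).1 (ext_mix (a := 1/2) (b := -1/2) (K := K) (L := K) hx)
  have h2 := vol_mix_le_real hu (a := 1/2) (b := -1/2) (h.ext x₁) (h.ext x₂)
  have h3 := vol_stein_real hu h
  have e1 : |(1/2:ℝ)| = 1/2 := by norm_num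
  have e2 : |(-1/2:ℝ)| = 1/2 := by norm_num
  rw [e1, e2] at h2
  unfold phi
  unfold stein at h3 ⊢
  rw [h3]
  linarith

lemma phi_convex {K : Set E} (h : CC K) : ConvexOn ℝ Set.univ (phi K) := by
  refine ⟨convex_univ, fun x _ y _ a b ha hb hab => ?_⟩
  by_cases hxy : x = y
  · subst hxy
    rw [← add_smul, hab, one_smul, ← add_smul, hab, one_smul]
  obtain ⟨u, hu, hxu⟩ := exists_unit (sub_ne_zero.2 hxy)
  have hp : prj u x = prj u y := by
    have : prj u (x - y) = 0 := by rw [hxu, prj_smul, prj_u hu, smul_zero]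
    rw [prj_sub] at this
    exact sub_eq_zero.1 this
  have e1 : comb u a b x y = a • x + b • y := by
    nth_rw 2 [← prj_add_inner u x]
    nth_rw 2 [← prj_add_inner u y]
    rw [← hp, comb]
    calc _ = (a + b) • prj u x + (a * inner ℝ u x + b * inner ℝ u y) • u := by rw [hab, one_smul]
      _ = _ := by module
  have e2 : K ⊆ mix u a b K K := by
    intro k hk
    refine ⟨k, hk, k, hk, rfl, ?_⟩
    rw [comb, ← add_mul, hab, one_mul, prj_add_inner]
  have h1 := vol_mono ((h.ext x).mix (h.ext y) u a b).1
    ((ext_mono e2 _).trans (ext_mix (a := a) (b := b) (K := K) (L := K) hp))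
  have h2 := vol_mix_le_real hu (a := a) (b := b) (h.ext x) (h.ext y)
  rw [abs_of_nonneg ha, abs_of_nonneg hb] at h2
  rw [e1] at h1
  unfold phi
  simp only [smul_eq_mul]
  have : vol K = a * vol K + b * vol K := by rw [← add_mul, hab, one_mul]
  linarith

lemma phi_continuous {K : Set E} (h : CC K) : Continuous (phi K) :=
  continuousOn_univ.1 ((phi_convex h).continuousOn isOpen_univ)

lemma phi_pos {K : Set E} (h : CC K) (hi : (interior K).Nonempty) {x : E} (hx : x ≠ 0) :
    0 < phi K x := by
  obtain ⟨u, hu, hxu⟩ := exists_unit hx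
  rw [hxu, phi_unit h hu (norm_nonneg _)]
  refine mul_pos (norm_pos_iff.2 hx) (ENNReal.toReal_pos ?_ (shadow_compact hu h.1).measure_lt_top.ne)
  intro h0
  have hv : volume K ≠ 0 := (Measure.measure_pos_of_nonempty_interior _ hi).ne'
  apply hv
  rw [fiber_volume hu h.1.measurableSet]
  rw [lintegral_eq_zero_iff (fib_measurable h.1.measurableSet)]
  have := compl_mem_ae_iff.2 h0
  filter_upwards [this] with y hy
  have : fib u K y = ∅ := Set.not_nonempty_iff_eq_empty.1 hy
  simp [this]

lemma vol_pos {K : Set E} (h : CC K) (hi : (interior K).Nonempty) : 0 < vol K :=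
  ENNReal.toReal_pos (Measure.measure_pos_of_nonempty_interior _ hi).ne' h.fin

end Phi
end HL

open MeasureTheory Pointwise
set_option linter.unusedSectionVars false

namespace HL

section Stein

variable {E : Type*} [NormedAddCommGroup E] [InnerProductSpace ℝ E]

lemma norm_sq_prj {u : E} (hu : ‖u‖ = 1) (p : E) : ‖p‖ ^ 2 = ‖prj u p‖ ^ 2 + (inner ℝ u p) ^ 2 := by
  have h := inner_prj hu p
  nth_rw 1 [← prj_add_inner u p]
  rw [norm_add_sq_real, inner_smul_right, real_inner_comm u (prj u p), h, norm_smul, hu]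
  simp

lemma norm_comb_le {u : E} (hu : ‖u‖ = 1) {p q : E} {R : ℝ} (hp : ‖p‖ ≤ R) (hq : ‖q‖ ≤ R)
    (h : prj u p = prj u q) : ‖comb u (1/2) (-1/2) p q‖ ≤ R := by
  have hR : 0 ≤ R := (norm_nonneg _).trans hp
  refine (abs_le_of_sq_le_sq' ?_ hR).2
  rw [norm_sq_prj hu, prj_comb hu, inner_comb hu]
  have h1 := norm_sq_prj hu p
  have h2 := norm_sq_prj hu q
  rw [← h] at h2
  have h3 : ‖p‖ ^ 2 ≤ R ^ 2 := by gcongr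
  have h4 : ‖q‖ ^ 2 ≤ R ^ 2 := by gcongr
  nlinarith [sq_nonneg ((inner ℝ u p : ℝ) + inner ℝ u q)]

lemma stein_mono {u : E} {K L : Set E} (h : K ⊆ L) : stein u K ⊆ stein u L := by
  rintro x ⟨p, hp, q, hq, hx⟩
  exact ⟨p, h hp, q, h hq, hx⟩

lemma stein_ball {u : E} (hu : ‖u‖ = 1) (R : ℝ) :
    stein u (Metric.closedBall (0:E) R) ⊆ Metric.closedBall 0 R := by
  rintro x ⟨p, hp, q, hq, h, rfl⟩
  rw [mem_closedBall_zero_iff] at *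
  exact norm_comb_le hu hp hq h

lemma stein_interior {u : E} (hu : ‖u‖ = 1) {K : Set E} {x : E} (hx : x ∈ interior K) :
    prj u x ∈ interior (stein u K) := by
  rw [mem_interior_iff_mem_nhds, Metric.mem_nhds_iff] at hx ⊢
  obtain ⟨ε, hε, h⟩ := hx
  refine ⟨ε, hε, fun z hz => ?_⟩
  rw [Metric.mem_ball, dist_eq_norm] at hz
  set w := z - prj u x with hw
  set w' := prj u w - (inner ℝ u w : ℝ) • u with hw'
  have hpw : prj u w' = prj u w := by
    rw [hw', sub_eq_add_neg, ← neg_smul, prj_line hu (inner_prj hu w)]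
  have hiw : inner ℝ u w' = -(inner ℝ u w : ℝ) := by
    rw [hw', sub_eq_add_neg, ← neg_smul, inner_line hu (inner_prj hu w)]
  have hn : ‖w'‖ = ‖w‖ := by
    have : ‖w'‖ ^ 2 = ‖w‖ ^ 2 := by
      rw [norm_sq_prj hu w', norm_sq_prj hu w, hpw, hiw]; ring
    exact (sq_eq_sq₀ (norm_nonneg _) (norm_nonneg _)).1 this
  refine ⟨x + w, h ?_, x + w', h ?_, ?_, ?_⟩
  · rw [Metric.mem_ball, dist_eq_norm, add_sub_cancel_left]; exact hz
  · rw [Metric.mem_ball, dist_eq_norm, add_sub_cancel_left, hn]; exact hz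
  · rw [prj_add, prj_add, hpw]
  · rw [comb, prj_add, inner_add_right, inner_add_right, hiw]
    have : z = prj u x + w := by rw [hw]; simp
    rw [this]
    calc _ = prj u x + (prj u w + (inner ℝ u w : ℝ) • u) := by module
      _ = _ := by rw [prj_add_inner]

lemma sub_stein {u : E} (K : Set E) : stein u K - stein u K ⊆ stein u (K - K) := by
  rintro _ ⟨_, ⟨p, hp, q, hq, h, rfl⟩, _, ⟨p', hp', q', hq', h', rfl⟩, rfl⟩
  refine ⟨p - p', Set.sub_mem_sub hp hp', q - q', Set.sub_mem_sub hq hq', ?_, ?_⟩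
  · rw [prj_sub, prj_sub, h, h']
  · rw [comb_sub]

/-- Invariance under the reflection orthogonal to `e`. -/
def RInv (e : E) (K : Set E) : Prop := ∀ x ∈ K, x - (2 * inner ℝ e x : ℝ) • e ∈ K

lemma rinv_stein {u : E} (hu : ‖u‖ = 1) (K : Set E) : RInv u (stein u K) := by
  rintro x ⟨p, hp, q, hq, h, rfl⟩
  refine ⟨q, hq, p, hp, h.symm, ?_⟩
  rw [inner_comb hu, comb, comb, h]
  module

lemma rinv_stein' {u e : E} (hue : inner ℝ u e = (0:ℝ)) {K : Set E} (h : RInv e K) :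
    RInv e (stein u K) := by
  rintro x ⟨p, hp, q, hq, hpq, rfl⟩
  have hpe : prj u e = e := prj_of_orth hue
  have hpr : ∀ z : E, inner ℝ e (prj u z) = (inner ℝ e z : ℝ) := by
    intro z; rw [prj, inner_sub_right, inner_smul_right, real_inner_comm, real_inner_comm u e, hue]; simp [real_inner_comm]
  have heq : inner ℝ e p = (inner ℝ e q : ℝ) := by rw [← hpr p, hpq, hpr]
  refine ⟨_, h p hp, _, h q hq, ?_, ?_⟩
  · rw [prj_sub, prj_sub, prj_smul, prj_smul, hpq, heq]
  · have : inner ℝ e (comb u (1/2) (-1/2) p q) = (inner ℝ e p : ℝ) := by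
      rw [comb, inner_add_right, inner_smul_right, real_inner_comm u e, hue, hpr]; simp
    rw [this, ← heq, comb_sub]
    congr 1
    rw [comb, prj_smul, hpe, inner_smul_right, hue]; simp

/-- Convex bodies. -/
def Body (K : Set E) : Prop := IsCompact K ∧ Convex ℝ K ∧ (interior K).Nonempty

lemma Body.stein {u : E} (hu : ‖u‖ = 1) {K : Set E} (h : Body K) : Body (stein u K) :=
  ⟨mix_compact h.1 h.1, mix_convex h.2.1 h.2.1, by
    obtain ⟨x, hx⟩ := h.2.2
    exact ⟨_, stein_interior hu hx⟩⟩

lemma stein_induction [FiniteDimensional ℝ E] {P : Set E → Prop}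
    (hsym : ∀ K, Body K → (∀ x ∈ K, -x ∈ K) → P K)
    (hS : ∀ u : E, ‖u‖ = 1 → ∀ K, Body K → P (stein u K) → P K) : ∀ K, Body K → P K := by
  let b := stdOrthonormalBasis ℝ E
  have key : ∀ s : Finset (Fin (Module.finrank ℝ E)), ∀ K, Body K →
      (∀ i, i ∉ s → RInv (b i) K) → P K := by
    intro s
    induction s using Finset.induction_on with
    | empty =>
      intro K hK h
      refine hsym K hK fun x hx => ?_
      have : ∀ t : Finset (Fin (Module.finrank ℝ E)),
          x - ∑ i ∈ t, (2 * inner ℝ (b i) x : ℝ) • b i ∈ K := by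
        intro t
        induction t using Finset.induction_on with
        | empty => simpa using hx
        | insert j t hj ih =>
          have := h j (Finset.notMem_empty _) _ ih
          rw [Finset.sum_insert hj]
          have e : (inner ℝ (b j) (x - ∑ i ∈ t, (2 * inner ℝ (b i) x : ℝ) • b i) : ℝ) = inner ℝ (b j) x := by
            rw [inner_sub_right, inner_sum, Finset.sum_eq_zero, sub_zero]
            intro i hi
            rw [inner_smul_right, b.inner_eq_zero, mul_zero]
            rintro rfl; exact hj hi
          rw [e] at this
          convert this using 1
          abel
      have h2 := this Finset.univ
      have e : ∑ i, (2 * inner ℝ (b i) x : ℝ) • b i = (2:ℝ) • x := by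
        simp_rw [mul_smul]
        rw [← Finset.smul_sum, b.sum_repr' x]
      rw [e] at h2
      convert h2 using 1
      module
    | insert j s hj ih =>
      intro K hK h
      have hn : ‖b j‖ = 1 := b.norm_eq_one j
      refine hS (b j) hn K hK (ih _ (hK.stein hn) fun i hi => ?_)
      by_cases hij : i = j
      · subst hij; exact rinv_stein hn K
      · refine rinv_stein' (b.inner_eq_zero fun h => hij h.symm) (h i ?_)
        rw [Finset.mem_insert]; tauto
  intro K hK
  exact key Finset.univ K hK fun i hi => absurd (Finset.mem_univ i) hi

end Stein

section Ball
variable {E : Type*} [NormedAddCommGroup E] [InnerProductSpace ℝ E]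
variable [FiniteDimensional ℝ E] [MeasurableSpace E] [BorelSpace E]

lemma Body.cc {K : Set E} (h : Body K) : CC K := ⟨h.1, h.2.1⟩

lemma cc_ball (r : ℝ) : CC (Metric.closedBall (0:E) r) :=
  ⟨isCompact_closedBall _ _, convex_closedBall _ _⟩

lemma unitBallVol_pos (n : ℕ) : 0 < unitBallVol n := by
  unfold unitBallVol
  exact ENNReal.toReal_pos (Metric.measure_closedBall_pos volume _ one_pos).ne'
    (isCompact_closedBall _ _).measure_lt_top.ne

lemma vol_ball {n : ℕ} (hn : Module.finrank ℝ E = n) {r : ℝ} (hr : 0 ≤ r) :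
    vol (Metric.closedBall (0:E) r) = r ^ n * unitBallVol n := by
  subst hn
  let f := (stdOrthonormalBasis ℝ E).repr
  have h : volume (Metric.closedBall (0:E) r) =
      volume (Metric.closedBall (0:EuclideanSpace ℝ (Fin (Module.finrank ℝ E))) r) := by
    rw [← f.measurePreserving.measure_preimage measurableSet_closedBall.nullMeasurableSet]
    congr 1
    ext x
    simp
  rw [vol, h, unitBallVol, Measure.addHaar_closedBall' _ _ hr, ENNReal.toReal_mul,
    ENNReal.toReal_ofReal (by positivity)]
  simp

lemma shadow_ball {n : ℕ} (hn : Module.finrank ℝ E = n) {u : E} (hu : ‖u‖ = 1) {r : ℝ} (hr : 0 ≤ r) :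
    (volume (shadow u (Metric.closedBall (0:E) r))).toReal = r ^ (n-1) * unitBallVol (n-1) := by
  have e : shadow u (Metric.closedBall (0:E) r) = Metric.closedBall 0 r := by
    ext y
    rw [mem_closedBall_zero_iff]
    constructor
    · rintro ⟨t, ht⟩
      have ht : ‖(y:E) + t • u‖ ≤ r := by simpa [fib] using ht
      have := norm_sq_prj hu ((y:E) + t • u)
      rw [prj_line hu (mem_orth y)] at this
      refine le_trans ?_ ht
      refine abs_le_of_sq_le_sq' ?_ (norm_nonneg _) |>.2
      change ‖(y:E)‖ ^ 2 ≤ _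
      nlinarith [sq_nonneg (inner ℝ u ((y:E) + t • u) : ℝ)]
    · intro h
      refine ⟨0, ?_⟩
      simpa [fib] using h
  have h1 : Module.finrank ℝ (Submodule.span ℝ {u})ᗮ = n - 1 := by
    have h := Submodule.finrank_add_finrank_orthogonal (Submodule.span ℝ {u})
    have hu0 : u ≠ 0 := by rintro rfl; simp at hu
    rw [finrank_span_singleton hu0] at h
    omega
  have := vol_ball h1 hr
  rw [e]; exact this

lemma phi_ball {n : ℕ} (hn : Module.finrank ℝ E = n) {r : ℝ} (hr : 0 ≤ r) (x : E) :
    phi (Metric.closedBall (0:E) r) x = ‖x‖ * (r ^ (n-1) * unitBallVol (n-1)) := by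
  by_cases hx : x = 0
  · simp [hx, phi_zero]
  obtain ⟨u, hu, hxu⟩ := exists_unit hx
  nth_rw 1 [hxu]
  rw [phi_unit (cc_ball r) hu (norm_nonneg _), shadow_ball hn hu hr]

end Ball
end HL

open MeasureTheory Pointwise
set_option linter.unusedSectionVars false

namespace HL

section Strict

variable {E : Type*} [NormedAddCommGroup E] [InnerProductSpace ℝ E]
variable [FiniteDimensional ℝ E] [MeasurableSpace E] [BorelSpace E]

lemma norm_prj_le {u : E} (hu : ‖u‖ = 1) (p : E) : ‖prj u p‖ ≤ ‖p‖ := by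
  have := norm_sq_prj hu p
  refine abs_le_of_sq_le_sq' ?_ (norm_nonneg _) |>.2
  nlinarith [sq_nonneg (inner ℝ u p : ℝ)]

lemma CC.inter {K L : Set E} (h : CC K) (h' : CC L) : CC (K ∩ L) :=
  ⟨h.1.inter_right h'.1.isClosed, h.2.inter h'.2⟩

lemma stein_inter {u : E} (hu : ‖u‖ = 1) (K : Set E) (r : ℝ) :
    stein u (K ∩ Metric.closedBall 0 r) ⊆ stein u K ∩ Metric.closedBall 0 r :=
  Set.subset_inter (stein_mono Set.inter_subset_left)
    ((stein_mono Set.inter_subset_right).trans (stein_ball hu r))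

lemma vol_stein_inter {u : E} (hu : ‖u‖ = 1) {K : Set E} (h : CC K) (r : ℝ) :
    vol (K ∩ Metric.closedBall 0 r) ≤ vol (stein u K ∩ Metric.closedBall 0 r) := by
  rw [← vol_stein_real hu (h.inter (cc_ball r))]
  exact vol_mono ((h.stein u).inter (cc_ball r)).1 (stein_inter hu K r)

lemma vol_interior {K : Set E} (h : Convex ℝ K) : vol (interior K) = vol K := by
  have : volume (interior K) = volume K := by
    apply le_antisymm (measure_mono interior_subset)
    have : K ⊆ interior K ∪ frontier K := by
      intro x hx
      by_cases hi : x ∈ interior K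
      · exact Or.inl hi
      · exact Or.inr ⟨subset_closure hx, hi⟩
    calc volume K ≤ volume (interior K ∪ frontier K) := measure_mono this
      _ ≤ volume (interior K) + volume (frontier K) := measure_union_le _ _
      _ = _ := by rw [h.addHaar_frontier volume]; simp
  rw [vol, vol, this]

/-- A closed subset of full volume is everything. -/
lemma eq_of_vol_le {A C : Set E} (hA : IsClosed A) (hC : CC C) (hi : (interior C).Nonempty)
    (hAC : A ⊆ C) (hv : vol C ≤ vol A) : A = C := by
  have hAfin : volume A ≠ ⊤ := ((measure_mono hAC).trans_lt hC.1.measure_lt_top).ne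
  have h0 : volume (C \ A) = 0 := by
    rw [measure_sdiff hAC hA.measurableSet.nullMeasurableSet hAfin, tsub_eq_zero_iff_le]
    exact (ENNReal.toReal_le_toReal hC.fin hAfin).1 hv
  have h1 : interior C \ A = ∅ := by
    have ho : IsOpen (interior C \ A) := isOpen_interior.sdiff hA
    refine ho.eq_empty_of_measure_zero (μ := volume) ?_
    exact measure_mono_null (Set.sdiff_subset_sdiff_left interior_subset) h0
  apply hAC.antisymm
  have h2 : interior C ⊆ A := Set.sdiff_eq_empty.1 h1
  calc C ⊆ closure C := subset_closure
    _ = closure (interior C) := (hC.2.closure_interior_eq_closure_of_nonempty_interior hi).symm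
    _ ⊆ A := closure_minimal h2 hA

lemma strict_step {K : Set E} (hK : CC K) {r : ℝ} (hr : 0 < r)
    (hv : vol (Metric.closedBall (0:E) r) ≤ vol K) (hn : ¬ Metric.closedBall 0 r ⊆ K) :
    ∃ u : E, ‖u‖ = 1 ∧
      vol (K ∩ Metric.closedBall 0 r) < vol (stein u K ∩ Metric.closedBall 0 r) := by
  have hy : ∃ y ∈ Metric.ball (0:E) r, y ∉ K := by
    by_contra! h
    apply hn
    rw [← closure_ball (0:E) hr.ne']
    exact closure_minimal h hK.1.isClosed
  obtain ⟨y, hyB, hyK⟩ := hy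
  have hBi : (interior (Metric.closedBall (0:E) r)).Nonempty :=
    ⟨0, Metric.ball_subset_interior_closedBall (Metric.mem_ball_self hr)⟩
  have hx : ∃ x ∈ interior K, x ∉ Metric.closedBall (0:E) r := by
    by_contra! h
    have h1 : vol K ≤ vol (K ∩ Metric.closedBall 0 r) := by
      rw [← vol_interior hK.2]
      exact vol_mono (hK.inter (cc_ball r)).1 fun x hx => ⟨interior_subset hx, h x hx⟩
    have h2 := eq_of_vol_le (hK.inter (cc_ball r)).1.isClosed (cc_ball r) hBi
      Set.inter_subset_right (hv.trans h1)
    exact hn (h2 ▸ Set.inter_subset_left)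
  obtain ⟨x, hxK, hxB⟩ := hx
  have hxy : x - y ≠ 0 := sub_ne_zero.2 (by rintro rfl; exact hyK (interior_subset hxK))
  obtain ⟨u, hu, hxu⟩ := exists_unit hxy
  refine ⟨u, hu, lt_of_not_ge fun hle => ?_⟩
  have hp : prj u y = prj u x := by
    have : prj u (x - y) = 0 := by rw [hxu, prj_smul, prj_u hu, smul_zero]
    rw [prj_sub] at this
    exact (sub_eq_zero.1 this).symm
  have hlt : (inner ℝ u y : ℝ) < inner ℝ u x := by
    have : (inner ℝ u (x - y) : ℝ) = ‖x - y‖ := by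
      nth_rw 1 [hxu]; rw [inner_smul_right, inner_self_one hu, mul_one]
    rw [inner_sub_right] at this
    have := norm_pos_iff.2 hxy
    linarith
  set w := prj u x with hw
  have hwo : inner ℝ u w = (0:ℝ) := inner_prj hu x
  have hyB' : ‖y‖ < r := by simpa using hyB
  have hxB' : r < ‖x‖ := by simpa using hxB
  have hwr : ‖w‖ < r := by rw [← hp]; exact (norm_prj_le hu y).trans_lt hyB'
  set s := Real.sqrt (r^2 - ‖w‖^2) with hs
  have hpos : 0 < r^2 - ‖w‖^2 := by nlinarith [norm_nonneg w]
  have hs2 : s^2 = r^2 - ‖w‖^2 := Real.sq_sqrt hpos.le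
  have hs0 : 0 < s := Real.sqrt_pos.2 hpos
  have hnl : ∀ t : ℝ, ‖w + t • u‖^2 = ‖w‖^2 + t^2 := by
    intro t; rw [norm_sq_prj hu, prj_line hu hwo, inner_line hu hwo]
  have hBmem : ∀ t : ℝ, w + t • u ∈ Metric.closedBall (0:E) r ↔ |t| ≤ s := by
    intro t
    rw [mem_closedBall_zero_iff, ← sq_le_sq₀ (norm_nonneg _) hr.le, hnl,
      ← sq_le_sq₀ (abs_nonneg t) hs0.le, sq_abs, hs2]
    constructor <;> intro h <;> linarith
  have hxe : w + (inner ℝ u x : ℝ) • u = x := prj_add_inner u x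
  have hye : w + (inner ℝ u y : ℝ) • u = y := by rw [← hp]; exact prj_add_inner u y
  set X := (inner ℝ u x : ℝ)
  set Y := (inner ℝ u y : ℝ)
  have hYs : |Y| ≤ s := by
    rw [← hBmem, hye]; exact Metric.ball_subset_closedBall hyB
  have hYs' : -s ≤ Y := (abs_le.1 hYs).1
  have hXs : s < X := by
    by_contra! h
    apply hxB
    rw [← hxe, hBmem, abs_le]; exact ⟨by linarith, h⟩
  obtain ⟨a, b, hab, hI⟩ := fib_Icc hu hK.1 hK.2 w ⟨X, by change w + X • u ∈ K; rw [hxe]; exact interior_subset hxK⟩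
  have hXI : X ∈ Set.Icc a b := by
    rw [← hI]; change w + X • u ∈ K; rw [hxe]; exact interior_subset hxK
  have hYI : Y ∉ Set.Icc a b := by
    rw [← hI]; change w + Y • u ∉ K; rw [hye]; exact hyK
  have haY : Y < a := by
    by_contra! h
    exact hYI ⟨h, by linarith [hXI.2]⟩
  -- equality of the two sets
  have heq : stein u (K ∩ Metric.closedBall 0 r) = stein u K ∩ Metric.closedBall 0 r := by
    have hc := (hK.stein u).inter (cc_ball (E := E) r)
    refine eq_of_vol_le ((hK.inter (cc_ball r)).stein u).1.isClosed hc ⟨w, ?_⟩ (stein_inter hu K r) ?_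
    · rw [interior_inter]
      exact ⟨stein_interior hu hxK, Metric.ball_subset_interior_closedBall (by simpa using hwr)⟩
    · rw [vol_stein_real hu (hK.inter (cc_ball r))]; exact hle
  set P := min X (a + 2 * s) with hP
  have hP1 : P ≤ X := min_le_left _ _
  have hP2 : P ≤ a + 2 * s := min_le_right _ _
  have hP3 : s < P := lt_min hXs (by linarith)
  have haP : a ≤ P := le_min hXI.1 (by linarith)
  have hPI : P ∈ fib u K w := by rw [hI]; exact ⟨haP, hP1.trans hXI.2⟩
  have haI : a ∈ fib u K w := by rw [hI]; exact ⟨le_rfl, hab⟩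
  have hmem : w + (1/2 * P + -1/2 * a) • u ∈ stein u K ∩ Metric.closedBall 0 r := by
    constructor
    · exact ⟨_, hPI, _, haI, by rw [prj_line hu hwo, prj_line hu hwo], by rw [comb_line hu hwo]⟩
    · rw [hBmem, abs_le]; constructor <;> linarith
  rw [← heq] at hmem
  have hmem' : (1/2 * P + -1/2 * a) ∈ fib u (stein u (K ∩ Metric.closedBall 0 r)) w := hmem
  rw [stein, fib_mix hu hwo] at hmem'
  obtain ⟨p, hp', q, hq', hpq⟩ := hmem'
  have h1 : p ≤ s := (abs_le.1 ((hBmem p).1 hp'.2)).2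
  have h2 : a ≤ q := by
    have : q ∈ fib u K w := hq'.1
    rw [hI] at this; exact this.1
  linarith

end Strict
end HL

open MeasureTheory Pointwise
set_option linter.unusedSectionVars false

namespace HL

section Petty

variable {E : Type*} [NormedAddCommGroup E] [InnerProductSpace ℝ E]

/-- `A` lies in the open `ε`-neighbourhood of `B`. -/
def Near (ε : ℝ) (A B : Set E) : Prop := ∀ x ∈ A, ∃ y ∈ B, dist x y < ε

variable [FiniteDimensional ℝ E] [MeasurableSpace E] [BorelSpace E]

lemma near_point {C C' : Set E} {ε : ℝ} (hC' : IsCompact C') (hconv : Convex ℝ C')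
    (hε : 0 < ε) (hn : Near ε C C') {y : E} (hy : Metric.closedBall y ε ⊆ C) : y ∈ C' := by
  have hyC : y ∈ C := hy (Metric.mem_closedBall_self hε.le)
  obtain ⟨c0, hc0, -⟩ := hn y hyC
  obtain ⟨p, hp, hmin⟩ := exists_norm_eq_iInf_of_complete_convex ⟨c0, hc0⟩ hC'.isComplete hconv y
  have hin := (norm_eq_iInf_iff_real_inner_le_zero hconv hp).1 hmin
  by_cases hyp : y = p
  · rw [hyp]; exact hp
  exfalso
  obtain ⟨w, hw, hyw⟩ := exists_unit (sub_ne_zero.2 hyp)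
  have hpos : 0 < ‖y - p‖ := norm_pos_iff.2 (sub_ne_zero.2 hyp)
  have hz : y + ε • w ∈ C := by
    apply hy
    rw [Metric.mem_closedBall, dist_eq_norm, add_sub_cancel_left, norm_smul, hw, mul_one,
      Real.norm_of_nonneg hε.le]
  obtain ⟨c, hc, hd⟩ := hn _ hz
  have h1 := hin c hc
  rw [hyw, real_inner_smul_left] at h1
  have h2 : inner ℝ w (c - p) ≤ (0:ℝ) := by
    by_contra! h
    have := mul_pos hpos h
    linarith
  have h3 : inner ℝ w (y + ε • w - c) ≤ ‖y + ε • w - c‖ := by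
    have := real_inner_le_norm w (y + ε • w - c)
    rwa [hw, one_mul] at this
  have e : y + ε • w - c = (y - p) + ε • w - (c - p) := by abel
  have h4 : inner ℝ w (y + ε • w - c) = ‖y - p‖ + ε - inner ℝ w (c - p) := by
    rw [e, inner_sub_right, inner_add_right, inner_smul_right, inner_self_one hw]
    congr 2
    · nth_rw 1 [hyw]; rw [inner_smul_right, inner_self_one hw, mul_one]
    · ring
  rw [dist_eq_norm] at hd
  linarith

lemma near_ext {K K' : Set E} {x x' : E} {ε : ℝ} (h : Near ε K K') (hx : dist x x' < ε) :
    Near (2 * ε) (HL.ext K x) (HL.ext K' x') := by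
  rintro _ ⟨k, hk, t, ht, rfl⟩
  obtain ⟨k', hk', hd⟩ := h k hk
  refine ⟨_, ⟨k', hk', t, ht, rfl⟩, ?_⟩
  have h1 : dist (t • x) (t • x') ≤ dist x x' := by
    rw [dist_smul₀, Real.norm_of_nonneg ht.1]
    exact mul_le_of_le_one_left dist_nonneg ht.2
  calc _ ≤ dist k k' + dist (t • x) (t • x') := dist_add_add_le _ _ _ _
    _ < _ := by linarith

lemma vol_lsc {C : Set E} (hC : CC C) {a : ℝ}
    (h : ∀ ε > 0, ∃ C', CC C' ∧ Near ε C C' ∧ vol C' ≤ a) : vol C ≤ a := by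
  have ha : 0 ≤ a := by
    obtain ⟨C', -, -, h⟩ := h 1 one_pos
    exact (vol_nonneg _).trans h
  rw [← vol_interior hC.2]
  let A : ℕ → Set E := fun m => {y | Metric.closedBall y (1/((m:ℝ)+1)) ⊆ C}
  have hU : interior C ⊆ ⋃ m, A m := by
    intro y hy
    rw [mem_interior_iff_mem_nhds, Metric.nhds_basis_closedBall.mem_iff] at hy
    obtain ⟨ε, hε, h⟩ := hy
    obtain ⟨m, hm⟩ := exists_nat_one_div_lt hε
    exact Set.mem_iUnion.2 ⟨m, (Metric.closedBall_subset_closedBall hm.le).trans h⟩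
  have hmono : Monotone A := by
    intro m n hmn y hy
    refine (Metric.closedBall_subset_closedBall ?_).trans hy
    gcongr
  have hle : ∀ m, volume (A m) ≤ ENNReal.ofReal a := by
    intro m
    obtain ⟨C', hC', hn, hv⟩ := h (1/((m:ℝ)+1)) (by positivity)
    calc volume (A m) ≤ volume C' :=
          measure_mono fun y hy => near_point hC'.1 hC'.2 (by positivity) hn hy
      _ ≤ _ := (ENNReal.le_ofReal_iff_toReal_le hC'.fin ha).2 hv
  refine ENNReal.toReal_le_of_le_ofReal ha ?_
  calc volume (interior C) ≤ volume (⋃ m, A m) := measure_mono hU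
    _ = ⨆ m, volume (A m) := hmono.measure_iUnion
    _ ≤ _ := iSup_le hle

lemma vol_usc {K B : Set E} (hK : IsCompact K) (hB : MeasurableSet B) {δ : ℝ} (hδ : 0 < δ) :
    ∃ ε > 0, ∀ K', Near ε K' K → vol (K' ∩ B) ≤ vol (K ∩ B) + δ := by
  have ht := tendsto_measure_cthickening_of_isCompact (μ := volume.restrict B) hK
  have hfin : (volume.restrict B) K ≠ ⊤ := hK.measure_lt_top.ne
  have hlt : (volume.restrict B) K < (volume.restrict B) K + ENNReal.ofReal δ :=
    ENNReal.lt_add_right hfin (by simpa using hδ)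
  have := (ht.eventually (gt_mem_nhds hlt))
  rw [Metric.eventually_nhds_iff] at this
  obtain ⟨η, hη, h⟩ := this
  refine ⟨η/2, by positivity, fun K' hn => ?_⟩
  have h1 := h (y := η/2) (by rw [dist_zero_right, Real.norm_of_nonneg (by positivity)]; linarith)
  have hsub : K' ⊆ Metric.cthickening (η/2) K := by
    intro x hx
    obtain ⟨y, hy, hd⟩ := hn x hx
    exact Metric.mem_cthickening_of_dist_le x y _ _ hy hd.le
  have h2 : volume (K' ∩ B) ≤ volume (K ∩ B) + ENNReal.ofReal δ := by
    rw [← Measure.restrict_apply' hB, ← Measure.restrict_apply' hB]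
    exact (measure_mono hsub).trans h1.le
  rw [Measure.restrict_apply' hB] at hfin
  have := ENNReal.toReal_mono (ENNReal.add_ne_top.2 ⟨hfin, ENNReal.ofReal_ne_top⟩) h2
  rwa [ENNReal.toReal_add hfin ENNReal.ofReal_ne_top, ENNReal.toReal_ofReal hδ.le] at this

/-- The class of pairs in which we maximize. -/
def Cl (r ρ a R : ℝ) (K W : Set E) : Prop :=
  CC K ∧ CC W ∧ K ⊆ Metric.closedBall 0 R ∧ W ⊆ Metric.closedBall 0 R ∧
  vol (Metric.closedBall (0:E) r) ≤ vol K ∧ vol (Metric.closedBall (0:E) ρ) ≤ vol W ∧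
  ∀ x ∈ W, vol (HL.ext K x) ≤ a

lemma Cl.stein {r ρ a R : ℝ} {K W : Set E} (h : Cl r ρ a R K W) {u : E} (hu : ‖u‖ = 1) :
    Cl r ρ a R (stein u K) (stein u W) := by
  obtain ⟨hK, hW, hKR, hWR, h1, h2, h3⟩ := h
  refine ⟨hK.stein u, hW.stein u, (stein_mono hKR).trans (stein_ball hu R),
    (stein_mono hWR).trans (stein_ball hu R), ?_, ?_, ?_⟩
  · rwa [vol_stein_real hu hK]
  · rwa [vol_stein_real hu hW]
  · rintro _ ⟨x₁, hx₁, x₂, hx₂, hx, rfl⟩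
    have := phi_stein hu hK hx
    have e1 := h3 x₁ hx₁
    have e2 := h3 x₂ hx₂
    unfold phi at this
    rw [vol_stein_real hu hK] at this
    linarith

lemma near_convex {K : Set E} (hK : IsCompact K)
    (h : ∀ ε > 0, ∃ K', Convex ℝ K' ∧ Near ε K K' ∧ Near ε K' K) : Convex ℝ K := by
  intro x hx y hy a b ha hb hab
  have hne : K.Nonempty := ⟨x, hx⟩
  rw [hK.isClosed.mem_iff_infDist_zero hne]
  apply le_antisymm _ Metric.infDist_nonneg
  apply le_of_forall_pos_le_add
  intro ε hε
  obtain ⟨K', hc, h1, h2⟩ := h (ε/2) (by positivity)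
  obtain ⟨x', hx', hdx⟩ := h1 x hx
  obtain ⟨y', hy', hdy⟩ := h1 y hy
  obtain ⟨z, hz, hdz⟩ := h2 _ (hc hx' hy' ha hb hab)
  have h3 : dist (a • x + b • y) (a • x' + b • y') ≤ ε/2 := by
    calc _ ≤ dist (a • x) (a • x') + dist (b • y) (b • y') := dist_add_add_le _ _ _ _
      _ = a * dist x x' + b * dist y y' := by
        rw [dist_smul₀, dist_smul₀, Real.norm_of_nonneg ha, Real.norm_of_nonneg hb]
      _ ≤ a * (ε/2) + b * (ε/2) := by gcongr
      _ = _ := by rw [← add_mul, hab, one_mul]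
  have := Metric.infDist_le_dist_of_mem (x := a • x + b • y) hz
  have h4 := dist_triangle (a • x + b • y) (a • x' + b • y') z
  linarith

lemma seq_limit {R : ℝ} (K : ℕ → Set E) (hK : ∀ n, IsCompact (K n)) (hne : ∀ n, (K n).Nonempty)
    (hR : ∀ n, K n ⊆ Metric.closedBall 0 R) :
    ∃ L : Set E, IsCompact L ∧ L ⊆ Metric.closedBall 0 R ∧ ∃ σ : ℕ → ℕ, StrictMono σ ∧
      ∀ ε > 0, ∀ᶠ n in Filter.atTop, Near ε (K (σ n)) L ∧ Near ε L (K (σ n)) := by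
  have hc := TopologicalSpace.NonemptyCompacts.isCompact_subsets_of_isCompact
    (isCompact_closedBall (0:E) R)
  let k : ℕ → TopologicalSpace.NonemptyCompacts E := fun n => ⟨⟨K n, hK n⟩, hne n⟩
  obtain ⟨L, hL, σ, hσ, ht⟩ := hc.tendsto_subseq (x := k) (fun n => hR n)
  refine ⟨L, L.isCompact, hL, σ, hσ, fun ε hε => ?_⟩
  rw [Metric.tendsto_nhds] at ht
  filter_upwards [ht ε hε] with n hn
  rw [Metric.NonemptyCompacts.dist_eq] at hn
  have hf : Metric.hausdorffEDist ((k (σ n) : TopologicalSpace.NonemptyCompacts E) : Set E) L ≠ ⊤ :=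
    Metric.hausdorffEDist_ne_top_of_nonempty_of_bounded (hne _) L.nonempty (hK _).isBounded L.isCompact.isBounded
  refine ⟨fun x hx => Metric.exists_dist_lt_of_hausdorffDist_lt (s := k (σ n)) hx hn hf, fun x hx => ?_⟩
  obtain ⟨y, hy, hd⟩ := Metric.exists_dist_lt_of_hausdorffDist_lt' hx hn hf
  exact ⟨y, hy, by rwa [dist_comm]⟩

lemma vol_ball_pos {r : ℝ} (hr : 0 < r) : 0 < vol (Metric.closedBall (0:E) r) :=
  vol_pos (cc_ball r) ⟨0, Metric.ball_subset_interior_closedBall (Metric.mem_ball_self hr)⟩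

lemma nonempty_of_vol {K : Set E} (h : 0 < vol K) : K.Nonempty := by
  by_contra h'
  rw [Set.not_nonempty_iff_eq_empty] at h'
  simp [h', vol] at h

lemma exists_max {r ρ a R : ℝ} (hr : 0 < r) (hρ : 0 < ρ) {K₀ W₀ : Set E} (h₀ : Cl r ρ a R K₀ W₀) :
    ∃ K W : Set E, Cl r ρ a R K W ∧ ∀ K' W' : Set E, Cl r ρ a R K' W' →
      vol (K' ∩ Metric.closedBall 0 r) + vol (W' ∩ Metric.closedBall 0 ρ) ≤
      vol (K ∩ Metric.closedBall 0 r) + vol (W ∩ Metric.closedBall 0 ρ) := by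
  let f : Set E → Set E → ℝ := fun K W =>
    vol (K ∩ Metric.closedBall 0 r) + vol (W ∩ Metric.closedBall 0 ρ)
  let S : Set ℝ := {v | ∃ K W, Cl r ρ a R K W ∧ f K W = v}
  have hSne : S.Nonempty := ⟨_, K₀, W₀, h₀, rfl⟩
  have hSb : BddAbove S := by
    refine ⟨vol (Metric.closedBall (0:E) r) + vol (Metric.closedBall (0:E) ρ), ?_⟩
    rintro _ ⟨K, W, h, rfl⟩
    exact add_le_add (vol_mono (cc_ball r).1 Set.inter_subset_right)
      (vol_mono (cc_ball ρ).1 Set.inter_subset_right)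
  obtain ⟨v, -, hvt, hvS⟩ := exists_seq_tendsto_sSup hSne hSb
  choose K W hcl hf using hvS
  have hKne : ∀ n, (K n).Nonempty := fun n =>
    nonempty_of_vol ((vol_ball_pos hr).trans_le (hcl n).2.2.2.2.1)
  have hWne : ∀ n, (W n).Nonempty := fun n =>
    nonempty_of_vol ((vol_ball_pos hρ).trans_le (hcl n).2.2.2.2.2.1)
  obtain ⟨L, hLc, hLR, σ, hσ, hL⟩ := seq_limit K (fun n => (hcl n).1.1) hKne (fun n => (hcl n).2.2.1)
  obtain ⟨M, hMc, hMR, τ, hτ, hM⟩ := seq_limit (fun n => W (σ n)) (fun n => (hcl _).2.1.1)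
    (fun n => hWne _) (fun n => (hcl _).2.2.2.1)
  have hL' : ∀ ε > 0, ∀ᶠ n in Filter.atTop, Near ε (K (σ (τ n))) L ∧ Near ε L (K (σ (τ n))) :=
    fun ε hε => hτ.tendsto_atTop.eventually (hL ε hε)
  have hvt' : Filter.Tendsto (fun n => v (σ (τ n))) Filter.atTop (nhds (sSup S)) :=
    hvt.comp (hσ.tendsto_atTop.comp hτ.tendsto_atTop)
  have hLcc : CC L := ⟨hLc, near_convex hLc fun ε hε => by
    obtain ⟨n, hn⟩ := (hL' ε hε).exists
    exact ⟨_, (hcl _).1.2, hn.2, hn.1⟩⟩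
  have hMcc : CC M := ⟨hMc, near_convex hMc fun ε hε => by
    obtain ⟨n, hn⟩ := (hM ε hε).exists
    exact ⟨_, (hcl _).2.1.2, hn.2, hn.1⟩⟩
  have husc : ∀ δ > 0, ∃ n, sSup S - δ < v (σ (τ n)) ∧
      vol (K (σ (τ n)) ∩ Metric.closedBall 0 r) ≤ vol (L ∩ Metric.closedBall 0 r) + δ ∧
      vol (W (σ (τ n)) ∩ Metric.closedBall 0 ρ) ≤ vol (M ∩ Metric.closedBall 0 ρ) + δ ∧
      vol (K (σ (τ n))) ≤ vol L + δ ∧ vol (W (σ (τ n))) ≤ vol M + δ := by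
    intro δ hδ
    obtain ⟨ε1, hε1, h1⟩ := vol_usc hLc (measurableSet_closedBall (x := (0:E)) (ε := r)) hδ
    obtain ⟨ε2, hε2, h2⟩ := vol_usc hMc (measurableSet_closedBall (x := (0:E)) (ε := ρ)) hδ
    obtain ⟨ε3, hε3, h3⟩ := vol_usc hLc MeasurableSet.univ hδ
    obtain ⟨ε4, hε4, h4⟩ := vol_usc hMc MeasurableSet.univ hδ
    simp only [Set.inter_univ] at h3 h4
    have h5 : ∀ᶠ n in Filter.atTop, sSup S - δ < v (σ (τ n)) :=
      hvt'.eventually (lt_mem_nhds (by linarith))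
    obtain ⟨n, ⟨⟨⟨⟨n1, n2⟩, n3⟩, n4⟩, n5⟩⟩ := ((((hL' _ hε1).and (hM _ hε2)).and (hL' _ hε3)).and (hM _ hε4)).and h5 |>.exists
    exact ⟨n, n5, h1 _ n1.1, h2 _ n2.1, h3 _ n3.1, h4 _ n4.1⟩
  refine ⟨L, M, ⟨hLcc, hMcc, hLR, hMR, ?_, ?_, ?_⟩, ?_⟩
  · apply le_of_forall_pos_le_add
    intro δ hδ
    obtain ⟨n, -, -, -, h, -⟩ := husc δ hδ
    exact (hcl _).2.2.2.2.1.trans h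
  · apply le_of_forall_pos_le_add
    intro δ hδ
    obtain ⟨n, -, -, -, -, h⟩ := husc δ hδ
    exact (hcl _).2.2.2.2.2.1.trans h
  · intro x hx
    refine vol_lsc (hLcc.ext x) fun ε hε => ?_
    obtain ⟨n, n1, n2⟩ := ((hL' (ε/2) (by positivity)).and (hM (ε/2) (by positivity))).exists
    obtain ⟨x', hx', hd⟩ := n2.2 x hx
    refine ⟨HL.ext (K (σ (τ n))) x', (hcl _).1.ext x', ?_, (hcl _).2.2.2.2.2.2 x' hx'⟩
    have := near_ext n1.2 hd
    rwa [mul_div_cancel₀ _ (two_ne_zero)] at this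
  · intro K' W' h'
    have h1 : f K' W' ≤ sSup S := le_csSup hSb ⟨K', W', h', rfl⟩
    refine h1.trans ?_
    apply le_of_forall_pos_le_add
    intro δ hδ
    obtain ⟨n, hn, h1, h2, -⟩ := husc (δ/3) (by positivity)
    have := hf (σ (τ n))
    simp only [f] at this
    linarith

theorem petty {K W : Set E} (hK : CC K) (hW : CC W) {r ρ a : ℝ} (hr : 0 < r) (hρ : 0 < ρ)
    (h1 : vol (Metric.closedBall (0:E) r) ≤ vol K) (h2 : vol (Metric.closedBall (0:E) ρ) ≤ vol W)
    (h3 : ∀ x ∈ W, vol (HL.ext K x) ≤ a) :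
    ∀ x ∈ Metric.closedBall (0:E) ρ, vol (HL.ext (Metric.closedBall 0 r) x) ≤ a := by
  obtain ⟨R, hR⟩ := (hK.1.union hW.1).isBounded.subset_closedBall 0
  have h0 : Cl r ρ a R K W := ⟨hK, hW, Set.subset_union_left.trans hR, Set.subset_union_right.trans hR, h1, h2, h3⟩
  obtain ⟨L, M, hcl, hmax⟩ := exists_max hr hρ h0
  have hL : Metric.closedBall 0 r ⊆ L := by
    by_contra h
    obtain ⟨u, hu, hlt⟩ := strict_step hcl.1 hr hcl.2.2.2.2.1 h
    have := hmax _ _ (hcl.stein hu)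
    have := vol_stein_inter hu hcl.2.1 ρ
    linarith
  have hM : Metric.closedBall 0 ρ ⊆ M := by
    by_contra h
    obtain ⟨u, hu, hlt⟩ := strict_step hcl.2.1 hρ hcl.2.2.2.2.2.1 h
    have := hmax _ _ (hcl.stein hu)
    have := vol_stein_inter hu hcl.1 r
    linarith
  intro x hx
  exact (vol_mono (hcl.1.ext x).1 (ext_mono hL x)).trans (hcl.2.2.2.2.2.2 x (hM hx))

end Petty
end HL

open MeasureTheory Pointwise
set_option linter.unusedSectionVars false

namespace HL

section OneDim

lemma exists_supergradient {f : ℝ → ℝ} {a b x : ℝ} (hf : ConcaveOn ℝ (Set.Icc a b) f)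
    (hx : x ∈ Set.Ioo a b) : ∃ σ : ℝ, ∀ y ∈ Set.Icc a b, f y ≤ f x + σ * (y - x) := by
  have hxI : x ∈ Set.Icc a b := ⟨hx.1.le, hx.2.le⟩
  have hadj : ∀ y ∈ Set.Ico a x, ∀ z ∈ Set.Ioc x b, (f z - f x)/(z - x) ≤ (f x - f y)/(x - y) := by
    intro y hy z hz
    exact hf.slope_anti_adjacent ⟨hy.1, hy.2.le.trans hxI.2⟩ ⟨hxI.1.trans hz.1.le, hz.2⟩ hy.2 hz.1
  let S : Set ℝ := (fun y => (f x - f y)/(x - y)) '' Set.Ico a x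
  have hne : S.Nonempty := ⟨_, a, ⟨le_rfl, hx.1⟩, rfl⟩
  have hlb : ∀ z ∈ Set.Ioc x b, (f z - f x)/(z - x) ≤ sInf S := by
    intro z hz
    apply le_csInf hne
    rintro _ ⟨y, hy, rfl⟩
    exact hadj y hy z hz
  have hbd : BddBelow S := by
    refine ⟨(f b - f x)/(b - x), ?_⟩
    rintro _ ⟨y, hy, rfl⟩
    exact hadj y hy b ⟨hx.2, le_rfl⟩
  refine ⟨sInf S, fun y hy => ?_⟩
  rcases lt_trichotomy y x with h | h | h
  · have h1 : sInf S ≤ (f x - f y)/(x - y) := csInf_le hbd ⟨y, ⟨hy.1, h⟩, rfl⟩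
    rw [le_div_iff₀ (by linarith)] at h1
    linarith
  · subst h; simp
  · have h1 := hlb y ⟨h, hy.2⟩
    rw [div_le_iff₀ (by linarith)] at h1
    linarith

lemma const_of_bound {Δ σ : ℝ → ℝ} {a b : ℝ}
    (h : ∀ s ∈ Set.Ioo a b, ∀ t ∈ Set.Ioo a b, s ≤ t → |Δ t - Δ s| ≤ (t - s)/2 * (σ s - σ t))
    {s t : ℝ} (hs : s ∈ Set.Ioo a b) (ht : t ∈ Set.Ioo a b) (hst : s ≤ t) : Δ t = Δ s := by
  have key : ∀ n : ℕ, ∀ k : ℝ, 0 ≤ k → s + n * k ≤ t →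
      |Δ (s + n * k) - Δ s| ≤ k/2 * (σ s - σ (s + n * k)) := by
    intro n
    induction n with
    | zero => intro k hk _; simp
    | succ n ih =>
      intro k hk hle
      push_cast at hle ⊢
      have hle' : s + n * k ≤ t := by linarith
      have h1 := ih k hk hle'
      have hnk : 0 ≤ (n:ℝ) * k := by positivity
      have h2 := h (s + n * k) ⟨by linarith [hs.1], by linarith [ht.2]⟩ (s + (n+1) * k)
        ⟨by linarith [hs.1], by linarith [ht.2]⟩ (by linarith)
      have e : (s + (↑n + 1) * k - (s + ↑n * k)) / 2 = k / 2 := by ring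
      rw [e] at h2
      have h3 := abs_add_le (Δ (s + (n+1) * k) - Δ (s + n * k)) (Δ (s + n * k) - Δ s)
      rw [sub_add_sub_cancel] at h3
      linarith
  set c := (t - s)/2 * (σ s - σ t) with hc
  have hb : ∀ n : ℕ, |Δ t - Δ s| ≤ c / (n + 1) := by
    intro n
    have := key (n+1) ((t - s)/(n+1)) (div_nonneg (by linarith) (by positivity))
      (by push_cast; rw [mul_div_cancel₀ _ (by positivity)]; linarith)
    push_cast at this
    rw [mul_div_cancel₀ _ (by positivity), add_sub_cancel] at this
    refine this.trans (le_of_eq ?_)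
    rw [hc]; field_simp
  have hl : Filter.Tendsto (fun n : ℕ => c / ((n:ℝ) + 1)) Filter.atTop (nhds 0) :=
    tendsto_const_div_atTop_nhds_zero_nat c |>.comp (Filter.tendsto_add_atTop_nat 1) |>.congr
      (fun n => by simp)
  have := ge_of_tendsto' hl hb
  have := abs_nonpos_iff.1 this
  linarith

lemma lemmaT {A B : ℝ → ℝ} {a b : ℝ} (hA : ConcaveOn ℝ (Set.Icc a b) A)
    (hB : ConcaveOn ℝ (Set.Icc a b) B)
    (h : ∀ s ∈ Set.Ioo a b, ∀ t ∈ Set.Ioo a b, B s + A t ≤ B ((s+t)/2) + A ((s+t)/2))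
    {s t : ℝ} (hs : s ∈ Set.Ioo a b) (ht : t ∈ Set.Ioo a b) : B s - A s = B t - A t := by
  have hSum := hA.add hB
  have hσ : ∀ x ∈ Set.Ioo a b, ∃ σ : ℝ, ∀ y ∈ Set.Icc a b, (A + B) y ≤ (A + B) x + σ * (y - x) :=
    fun x hx => exists_supergradient hSum hx
  choose! σ hσ using hσ
  have key : ∀ s ∈ Set.Ioo a b, ∀ t ∈ Set.Ioo a b, s ≤ t →
      |(B t - A t) - (B s - A s)| ≤ (t - s)/2 * (σ s - σ t) := by
    intro s hs t ht hst
    have hm : (s+t)/2 ∈ Set.Icc a b := ⟨by linarith [hs.1, ht.1], by linarith [hs.2, ht.2]⟩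
    have h1 := hσ s hs _ hm
    have h2 := hσ t ht _ hm
    have h3 := h s hs t ht
    have h4 := h t ht s hs
    rw [add_comm t s] at h4
    simp only [Pi.add_apply] at h1 h2
    rw [abs_le]
    constructor <;> nlinarith
  rcases le_total s t with hst | hst
  · exact (const_of_bound (Δ := fun x => B x - A x) key hs ht hst).symm
  · exact const_of_bound (Δ := fun x => B x - A x) key ht hs hst

end OneDim

section Ineq

variable {E : Type*} [NormedAddCommGroup E] [InnerProductSpace ℝ E]
variable [FiniteDimensional ℝ E] [MeasurableSpace E] [BorelSpace E]

/-- The constant in the theorem. -/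
noncomputable def bet (n : ℕ) : ℝ := 2 * unitBallVol (n-1) / unitBallVol n

/-- The increments over the difference body are bounded by `C`. -/
def Bd (K : Set E) (C : ℝ) : Prop := ∀ x ∈ K - K, phi K x ≤ C

lemma bd_stein {u : E} (hu : ‖u‖ = 1) {K : Set E} (hK : CC K) {C : ℝ} (h : Bd K C) :
    Bd (stein u K) C := by
  intro x hx
  obtain ⟨x₁, hx₁, x₂, hx₂, hp, rfl⟩ := sub_stein K hx
  have := phi_stein hu hK hp
  have := h x₁ hx₁
  have := h x₂ hx₂
  linarith

lemma coercive {K : Set E} (h : Body K) : ∃ c > 0, ∀ x, c * ‖x‖ ≤ phi K x := by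
  rcases subsingleton_or_nontrivial E with hE | hE
  · refine ⟨1, one_pos, fun x => ?_⟩
    rw [Subsingleton.elim x 0, phi_zero]; simp
  have hne : (Metric.sphere (0:E) 1).Nonempty := NormedSpace.sphere_nonempty.2 zero_le_one
  obtain ⟨u, hu, hmin⟩ := (isCompact_sphere (0:E) 1).exists_isMinOn hne (phi_continuous h.cc).continuousOn
  have hu1 : ‖u‖ = 1 := by simpa using hu
  have hu0 : u ≠ 0 := by rintro rfl; simp at hu1
  refine ⟨phi K u, phi_pos h.cc h.2.2 hu0, fun x => ?_⟩
  by_cases hx : x = 0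
  · simp [hx, phi_zero]
  obtain ⟨w, hw, hxw⟩ := exists_unit hx
  nth_rw 2 [hxw]
  rw [phi_smul h.cc w (norm_nonneg _), mul_comm]
  exact mul_le_mul_of_nonneg_left (hmin (by simpa using hw)) (norm_nonneg _)

lemma sublevel_cc {K : Set E} (h : Body K) (C : ℝ) : CC {x | phi K x ≤ C} := by
  constructor
  · obtain ⟨c, hc, hcx⟩ := coercive h
    refine Metric.isCompact_of_isClosed_isBounded
      (isClosed_le (phi_continuous h.cc) continuous_const) ?_
    refine (Metric.isBounded_closedBall (x := (0:E)) (r := C / c)).subset fun x hx => ?_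
    rw [mem_closedBall_zero_iff, le_div_iff₀ hc]
    have : phi K x ≤ C := hx
    linarith [hcx x]
  · have := (phi_convex h.cc).convex_le C
    simpa using this

lemma exists_radius {n : ℕ} (hn : 0 < n) {v : ℝ} (hv : 0 < v) :
    ∃ r > 0, v = r ^ n * unitBallVol n := by
  have hu := unitBallVol_pos n
  refine ⟨(v / unitBallVol n) ^ ((n:ℝ)⁻¹), by positivity, ?_⟩
  rw [Real.rpow_inv_natCast_pow (by positivity) hn.ne']
  field_simp

lemma petty2 {n : ℕ} (hn : Module.finrank ℝ E = n) (hn0 : 0 < n) {K W : Set E} (hK : CC K) (hW : CC W)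
    {C : ℝ} (hK0 : 0 < vol K) (hW0 : 0 < vol W) (h : ∀ x ∈ W, phi K x ≤ C) :
    ∃ r > 0, ∃ ρ > 0, vol K = r ^ n * unitBallVol n ∧ vol W = ρ ^ n * unitBallVol n ∧
      ρ * (r ^ (n-1) * unitBallVol (n-1)) ≤ C := by
  obtain ⟨r, hr, hr'⟩ := exists_radius hn0 hK0
  obtain ⟨ρ, hρ, hρ'⟩ := exists_radius hn0 hW0
  refine ⟨r, hr, ρ, hρ, hr', hρ', ?_⟩
  have hvr := vol_ball (E := E) hn hr.le
  have hvρ := vol_ball (E := E) hn hρ.le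
  have hp := petty hK hW hr hρ (a := C + vol K) (by rw [hvr, hr']) (by rw [hvρ, hρ'])
    (fun x hx => by have := h x hx; unfold phi at this; linarith)
  have : Nontrivial E := Module.nontrivial_of_finrank_pos (R := ℝ) (by omega)
  obtain ⟨e, he⟩ := exists_norm_eq E hρ.le
  have h1 := hp e (by simp [he])
  have h2 := phi_ball hn hr.le e
  unfold phi at h2
  rw [he] at h2
  linarith

lemma vol_smul {n : ℕ} (hn : Module.finrank ℝ E = n) {c : ℝ} (hc : 0 ≤ c) (K : Set E) :
    vol (c • K) = c ^ n * vol K := by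
  rw [vol, Measure.addHaar_smul, ENNReal.toReal_mul, hn, ENNReal.toReal_ofReal (abs_nonneg _),
    abs_of_nonneg (by positivity), vol]

lemma two_smul_sub {K : Set E} (h : ∀ x ∈ K, -x ∈ K) : (2:ℝ) • K ⊆ K - K := by
  rintro _ ⟨k, hk, rfl⟩
  exact ⟨k, hk, -k, h k hk, by simp only [sub_neg_eq_add]; module⟩

lemma sub_two_smul {K : Set E} (hc : Convex ℝ K) (h : ∀ x ∈ K, -x ∈ K) : K - K ⊆ (2:ℝ) • K := by
  rintro _ ⟨p, hp, q, hq, rfl⟩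
  exact ⟨(1/2:ℝ) • p + (1/2:ℝ) • (-q), hc hp (h q hq) (by norm_num) (by norm_num) (by norm_num),
    by simp only []; module⟩

lemma CC.smul {K : Set E} (h : CC K) (c : ℝ) : CC (c • K) := ⟨h.1.smul c, h.2.smul c⟩

lemma ineq_sym {n : ℕ} (hn : Module.finrank ℝ E = n) (hn0 : 0 < n) {K : Set E} (hK : Body K)
    (hs : ∀ x ∈ K, -x ∈ K) {C : ℝ} (h : Bd K C) : bet n * vol K ≤ C := by
  have hv := vol_pos hK.cc hK.2.2
  obtain ⟨r, hr, ρ, hρ, h1, h2, h3⟩ := petty2 hn hn0 hK.cc (hK.cc.smul 2) (C := C) hv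
    (by rw [vol_smul hn (by norm_num)]; positivity) (fun x hx => h x (two_smul_sub hs hx))
  have hu := unitBallVol_pos n
  have hρr : ρ = 2 * r := by
    rw [vol_smul hn (by norm_num), h1, ← mul_assoc, ← mul_pow] at h2
    exact ((pow_left_inj₀ (by positivity) hρ.le hn0.ne').1 (mul_right_cancel₀ hu.ne' h2)).symm
  refine le_trans (le_of_eq ?_) h3
  rw [bet, h1, hρr]
  have : r ^ n = r * r ^ (n-1) := by rw [← pow_succ']; congr 1; omega
  rw [this]; field_simp

lemma ineq {n : ℕ} (hn : Module.finrank ℝ E = n) (hn0 : 0 < n) {K : Set E} (hK : Body K)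
    {C : ℝ} (h : Bd K C) : bet n * vol K ≤ C := by
  refine stein_induction (P := fun K => Bd K C → bet n * vol K ≤ C) ?_ ?_ K hK h
  · intro K hK hs h
    exact ineq_sym hn hn0 hK hs h
  · intro u hu K hK ih h
    have := ih (bd_stein hu hK.cc h)
    rwa [vol_stein_real hu hK.cc] at this

/-- Central symmetry. -/
def CSym (K : Set E) : Prop := ∃ z : E, ∀ x ∈ K, z - x ∈ K

/-- Extremal bodies. -/
def Extr (n : ℕ) (K : Set E) : Prop := Bd K (bet n * vol K)

lemma extr_stein {n : ℕ} {u : E} (hu : ‖u‖ = 1) {K : Set E} (hK : CC K) (h : Extr n K) :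
    Extr n (stein u K) := by
  unfold Extr
  rw [vol_stein_real hu hK]
  exact bd_stein hu hK h

lemma sublevel_sym {n : ℕ} (hn : Module.finrank ℝ E = n) (hn0 : 0 < n) {K : Set E} (hK : Body K)
    (hs : ∀ x ∈ K, -x ∈ K) (h : Extr n K) {x : E} (hx : phi K x ≤ bet n * vol K) : x ∈ (2:ℝ) • K := by
  set C := bet n * vol K with hC
  have hv := vol_pos hK.cc hK.2.2
  have hu := unitBallVol_pos n
  have hu' := unitBallVol_pos (n-1)
  have hsub : (2:ℝ) • K ⊆ {x | phi K x ≤ C} := fun x hx => h x (two_smul_sub hs hx)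
  have hcc := sublevel_cc hK C
  have h2v := vol_smul hn (c := 2) (by norm_num) K
  have hW0 : 0 < vol {x | phi K x ≤ C} := by
    refine lt_of_lt_of_le ?_ (vol_mono hcc.1 hsub)
    rw [h2v]; positivity
  obtain ⟨r, hr, ρ, hρ, h1, h2, h3⟩ := petty2 hn hn0 hK.cc hcc (C := C) hv hW0 (fun x hx => hx)
  have hρr : ρ ≤ 2 * r := by
    rw [hC, bet, h1] at h3
    have e : 2 * unitBallVol (n-1) / unitBallVol n * (r ^ n * unitBallVol n) =
        (2 * r) * (r ^ (n-1) * unitBallVol (n-1)) := by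
      have : r ^ n = r * r ^ (n-1) := by rw [← pow_succ']; congr 1; omega
      rw [this]; field_simp
    rw [e] at h3
    exact le_of_mul_le_mul_right h3 (by positivity)
  have heq : (2:ℝ) • K = {x | phi K x ≤ C} := by
    refine eq_of_vol_le (hK.cc.smul 2).1.isClosed hcc ?_ hsub ?_
    · refine Set.Nonempty.mono (interior_mono hsub) ?_
      rw [interior_smul₀ (by norm_num)]
      exact hK.2.2.smul_set
    · rw [h2v, h2, h1, ← mul_assoc, ← mul_pow]
      gcongr
  rw [heq]; exact hx

lemma Body.vadd {K : Set E} (h : Body K) (z : E) : Body (z +ᵥ K) :=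
  ⟨h.1.vadd z, h.2.1.vadd z, by rw [interior_vadd]; exact h.2.2.vadd_set⟩

lemma sub_vadd (z : E) (K : Set E) : (z +ᵥ K) - (z +ᵥ K) = K - K := by
  ext x
  constructor
  · rintro ⟨_, ⟨p, hp, rfl⟩, _, ⟨q, hq, rfl⟩, rfl⟩
    exact ⟨p, hp, q, hq, by simp [vadd_eq_add]⟩
  · rintro ⟨p, hp, q, hq, rfl⟩
    exact ⟨_, ⟨p, hp, rfl⟩, _, ⟨q, hq, rfl⟩, by simp [vadd_eq_add]⟩

lemma extr_vadd {n : ℕ} {K : Set E} (h : Extr n K) (z : E) : Extr n (z +ᵥ K) := by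
  unfold Extr Bd
  rw [sub_vadd, vol_vadd]
  intro x hx
  rw [phi_vadd]; exact h x hx

lemma vadd_sym {K : Set E} {z : E} (h : ∀ x ∈ K, z - x ∈ K) :
    ∀ x ∈ (-(1/2:ℝ) • z) +ᵥ K, -x ∈ (-(1/2:ℝ) • z) +ᵥ K := by
  rintro _ ⟨k, hk, rfl⟩
  exact ⟨z - k, h k hk, by simp only [vadd_eq_add]; module⟩

lemma sublevel_csym {n : ℕ} (hn : Module.finrank ℝ E = n) (hn0 : 0 < n) {K : Set E} (hK : Body K)
    (hs : CSym K) (h : Extr n K) {x : E} (hx : phi K x ≤ bet n * vol K) : x ∈ K - K := by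
  obtain ⟨z, hz⟩ := hs
  have hs' := vadd_sym hz
  have := sublevel_sym hn hn0 (hK.vadd _) hs' (extr_vadd h _) (x := x)
    (by rw [phi_vadd, vol_vadd]; exact hx)
  have := two_smul_sub hs' this
  rwa [sub_vadd] at this

end Ineq
end HL

open MeasureTheory Pointwise
set_option linter.unusedSectionVars false

namespace HL

section CSymSec

variable {E : Type*} [NormedAddCommGroup E] [InnerProductSpace ℝ E]
variable [FiniteDimensional ℝ E] [MeasurableSpace E] [BorelSpace E]

/-- Lower end of the fiber. -/
noncomputable def lo (u : E) (K : Set E) (y : E) : ℝ := sInf (fib u K y)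
/-- Upper end of the fiber. -/
noncomputable def hi (u : E) (K : Set E) (y : E) : ℝ := sSup (fib u K y)

lemma mem_fib_prj {u : E} {K : Set E} {p : E} (hp : p ∈ K) : (inner ℝ u p : ℝ) ∈ fib u K (prj u p) := by
  change prj u p + _ ∈ K
  rw [prj_add_inner]; exact hp

lemma fib_nonempty {u : E} {K : Set E} {y : E} (hy : y ∈ prj u '' K) : (fib u K y).Nonempty := by
  obtain ⟨p, hp, rfl⟩ := hy
  exact ⟨_, mem_fib_prj hp⟩

lemma orth_of_mem {u : E} (hu : ‖u‖ = 1) {K : Set E} {y : E} (hy : y ∈ prj u '' K) :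
    inner ℝ u y = (0:ℝ) := by
  obtain ⟨p, hp, rfl⟩ := hy
  exact inner_prj hu p

lemma fib_eq {u : E} (hu : ‖u‖ = 1) {K : Set E} (hK : CC K) {y : E} (hy : y ∈ prj u '' K) :
    fib u K y = Set.Icc (lo u K y) (hi u K y) ∧ lo u K y ≤ hi u K y := by
  obtain ⟨a, b, hab, h⟩ := fib_Icc hu hK.1 hK.2 y (fib_nonempty hy)
  rw [lo, hi, h, csInf_Icc hab, csSup_Icc hab]
  exact ⟨rfl, hab⟩

lemma hi_mem {u : E} (hu : ‖u‖ = 1) {K : Set E} (hK : CC K) {y : E} (hy : y ∈ prj u '' K) :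
    y + hi u K y • u ∈ K := by
  have h := fib_eq hu hK hy
  have : hi u K y ∈ fib u K y := by rw [h.1]; exact ⟨h.2, le_rfl⟩
  exact this

lemma lo_mem {u : E} (hu : ‖u‖ = 1) {K : Set E} (hK : CC K) {y : E} (hy : y ∈ prj u '' K) :
    y + lo u K y • u ∈ K := by
  have h := fib_eq hu hK hy
  have : lo u K y ∈ fib u K y := by rw [h.1]; exact ⟨le_rfl, h.2⟩
  exact this

lemma mem_bounds {u : E} (hu : ‖u‖ = 1) {K : Set E} (hK : CC K) {p : E} (hp : p ∈ K) :
    lo u K (prj u p) ≤ inner ℝ u p ∧ inner ℝ u p ≤ hi u K (prj u p) := by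
  have h := fib_eq hu hK (Set.mem_image_of_mem (prj u) hp)
  have h2 := mem_fib_prj (u := u) hp
  rw [h.1] at h2
  exact h2

lemma convex_shadow {u : E} {K : Set E} (hK : Convex ℝ K) : Convex ℝ (prj u '' K) := by
  rintro _ ⟨p, hp, rfl⟩ _ ⟨q, hq, rfl⟩ a b ha hb hab
  exact ⟨_, hK hp hq ha hb hab, by rw [prj_add, prj_smul, prj_smul]⟩

lemma hi_concave {u : E} (hu : ‖u‖ = 1) {K : Set E} (hK : CC K) :
    ConcaveOn ℝ (prj u '' K) (hi u K) := by
  refine ⟨convex_shadow hK.2, fun x hx y hy a b ha hb hab => ?_⟩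
  have h1 := hK.2 (hi_mem hu hK hx) (hi_mem hu hK hy) ha hb hab
  have e : a • (x + hi u K x • u) + b • (y + hi u K y • u) =
    (a • x + b • y) + (a • hi u K x + b • hi u K y) • u := by simp only [smul_eq_mul]; module
  have ho : inner ℝ u (a • x + b • y) = (0:ℝ) := by
    rw [inner_add_right, inner_smul_right, inner_smul_right, orth_of_mem hu hx, orth_of_mem hu hy]; simp
  rw [e] at h1
  have h2 := (mem_bounds hu hK h1).2
  rwa [prj_line hu ho, inner_line hu ho] at h2

lemma lo_convex {u : E} (hu : ‖u‖ = 1) {K : Set E} (hK : CC K) :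
    ConvexOn ℝ (prj u '' K) (lo u K) := by
  refine ⟨convex_shadow hK.2, fun x hx y hy a b ha hb hab => ?_⟩
  have h1 := hK.2 (lo_mem hu hK hx) (lo_mem hu hK hy) ha hb hab
  have e : a • (x + lo u K x • u) + b • (y + lo u K y • u) =
    (a • x + b • y) + (a • lo u K x + b • lo u K y) • u := by simp only [smul_eq_mul]; module
  have ho : inner ℝ u (a • x + b • y) = (0:ℝ) := by
    rw [inner_add_right, inner_smul_right, inner_smul_right, orth_of_mem hu hx, orth_of_mem hu hy]; simp
  rw [e] at h1
  have h2 := (mem_bounds hu hK h1).1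
  rwa [prj_line hu ho, inner_line hu ho] at h2

lemma mem_stein_abs {u : E} (hu : ‖u‖ = 1) {K : Set E} (hK : CC K) {x : E} (hx : x ∈ stein u K) :
    prj u x ∈ prj u '' K ∧
      |(inner ℝ u x : ℝ)| ≤ (hi u K (prj u x) - lo u K (prj u x)) / 2 := by
  obtain ⟨p, hp, q, hq, hpq, rfl⟩ := hx
  rw [prj_comb hu, inner_comb hu]
  refine ⟨⟨p, hp, rfl⟩, ?_⟩
  have h1 := mem_bounds hu hK hp
  have h2 := mem_bounds hu hK hq
  rw [← hpq] at h2
  rw [abs_le]; constructor <;> linarith [h1.1, h1.2, h2.1, h2.2]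

lemma stein_top {u : E} (hu : ‖u‖ = 1) {K : Set E} (hK : CC K) {y : E} (hy : y ∈ prj u '' K) :
    y + ((hi u K y - lo u K y) / 2) • u ∈ stein u K ∧
    y + (-((hi u K y - lo u K y) / 2)) • u ∈ stein u K := by
  have ho := orth_of_mem hu hy
  constructor
  · refine ⟨_, hi_mem hu hK hy, _, lo_mem hu hK hy, ?_, ?_⟩
    · rw [prj_line hu ho, prj_line hu ho]
    · rw [comb_line hu ho]; congr 2; ring
  · refine ⟨_, lo_mem hu hK hy, _, hi_mem hu hK hy, ?_, ?_⟩
    · rw [prj_line hu ho, prj_line hu ho]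
    · rw [comb_line hu ho]; congr 2; ring

lemma segment_extend {K : Set E} (hK : Convex ℝ K) {x₁ x₂ : E} (h₁ : x₁ ∈ interior K)
    (h₂ : x₂ ∈ interior K) : ∃ ε : ℝ, 0 < ε ∧ ∀ t : ℝ, t ∈ Set.Icc (-ε : ℝ) (1 + ε) → (AffineMap.lineMap x₁ x₂ t : E) ∈ K := by
  have hc : Continuous (fun t : ℝ => (AffineMap.lineMap x₁ x₂ t : E)) := AffineMap.lineMap_continuous
  have ho : IsOpen ((fun t : ℝ => (AffineMap.lineMap x₁ x₂ t : E)) ⁻¹' interior K) :=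
    isOpen_interior.preimage hc
  have h0 : (0:ℝ) ∈ ((fun t : ℝ => (AffineMap.lineMap x₁ x₂ t : E)) ⁻¹' interior K) := by simpa using h₁
  have h1 : (1:ℝ) ∈ ((fun t : ℝ => (AffineMap.lineMap x₁ x₂ t : E)) ⁻¹' interior K) := by simpa using h₂
  obtain ⟨ε0, hε0, hb0⟩ := Metric.isOpen_iff.1 ho 0 h0
  obtain ⟨ε1, hε1, hb1⟩ := Metric.isOpen_iff.1 ho 1 h1
  set ε := min ε0 ε1 / 2 with hε
  have hεp : 0 < ε := by positivity
  have hε0' : ε < ε0 := by have := min_le_left ε0 ε1; linarith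
  have hε1' : ε < ε1 := by have := min_le_right ε0 ε1; linarith
  refine ⟨ε, hεp, fun t ht => ?_⟩
  have m0 : AffineMap.lineMap x₁ x₂ (-ε) ∈ K := interior_subset (hb0 (by
    rw [Metric.mem_ball, dist_zero_right, norm_neg, Real.norm_of_nonneg hεp.le]; exact hε0'))
  have m1 : AffineMap.lineMap x₁ x₂ (1 + ε) ∈ K := interior_subset (hb1 (by
    rw [Metric.mem_ball, Real.dist_eq, add_sub_cancel_left, abs_of_pos hεp]; exact hε1'))
  have hconv : Convex ℝ ((AffineMap.lineMap x₁ x₂ : ℝ →ᵃ[ℝ] E) ⁻¹' K) := hK.affine_preimage _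
  exact hconv.ordConnected.out m0 m1 ht

lemma csym_of_stein {n : ℕ} (hn : Module.finrank ℝ E = n) (hn0 : 0 < n) {K : Set E} (hK : Body K)
    (hE : Extr n K) {u : E} (hu : ‖u‖ = 1) (hs : CSym (stein u K)) : CSym K := by
  have hSE := extr_stein hu hK.cc hE
  have hSB := hK.stein hu
  obtain ⟨z, hz⟩ := id hs
  set P := prj u '' K with hP
  set f := lo u K with hf
  set g := hi u K with hg
  set z0 := prj u z with hz0
  have hcc := hK.cc
  have hPc : Convex ℝ P := convex_shadow hcc.2
  -- reflection facts
  have key : ∀ y ∈ P, z0 - y ∈ P ∧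
      |(inner ℝ u z : ℝ)| + (g y - f y)/2 ≤ (g (z0 - y) - f (z0 - y))/2 := by
    intro y hy
    have ho := orth_of_mem hu hy
    obtain ⟨ht, hb⟩ := stein_top hu hcc hy
    have h1 := mem_stein_abs hu hcc (hz _ ht)
    have h2 := mem_stein_abs hu hcc (hz _ hb)
    rw [prj_sub, prj_line hu ho, inner_sub_right, inner_line hu ho] at h1 h2
    refine ⟨h1.1, ?_⟩
    have a1 := abs_le.1 h1.2
    have a2 := abs_le.1 h2.2
    rcases abs_cases (inner ℝ u z : ℝ) with h | h <;> linarith [a1.1, a1.2, a2.1, a2.2]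
  have hrefl : ∀ y ∈ P, z0 - y ∈ P := fun y hy => (key y hy).1
  obtain ⟨x0, hx0⟩ := hK.2.2
  have hx0P : prj u x0 ∈ P := ⟨x0, interior_subset hx0, rfl⟩
  have hzu : (inner ℝ u z : ℝ) = 0 := by
    have h1 := (key _ hx0P).2
    have h2 := (key _ (hrefl _ hx0P)).2
    rw [sub_sub_cancel] at h2
    have := abs_nonneg (inner ℝ u z : ℝ)
    exact abs_eq_zero.1 (by linarith)
  have hl : ∀ y ∈ P, g (z0 - y) - f (z0 - y) = g y - f y := by
    intro y hy
    have h1 := (key _ hy).2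
    have h2 := (key _ (hrefl _ hy)).2
    rw [sub_sub_cancel] at h2
    rw [hzu, abs_zero] at h1 h2
    linarith
  have hB : ∀ p ∈ P, ∀ p' ∈ P, g p - f (z0 - p') ≤
      g ((1/2:ℝ) • p + (1/2:ℝ) • p') - f (z0 - ((1/2:ℝ) • p + (1/2:ℝ) • p')) := by
    intro p hp p' hp'
    set m := (1/2:ℝ) • p + (1/2:ℝ) • p' with hm
    have hmP : m ∈ P := hPc hp hp' (by norm_num) (by norm_num) (by norm_num)
    have hq := hrefl _ hp'
    have hm' := hrefl _ hmP
    have op := orth_of_mem hu hp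
    have oq := orth_of_mem hu hq
    have om := orth_of_mem hu hmP
    have om' := orth_of_mem hu hm'
    set x₁ := (p + g p • u) - ((z0 - p') + f (z0 - p') • u) with hx₁
    set x₂ := (m + f m • u) - ((z0 - m) + g (z0 - m) • u) with hx₂
    have d1 : x₁ ∈ K - K := Set.sub_mem_sub (hi_mem hu hcc hp) (lo_mem hu hcc hq)
    have d2 : x₂ ∈ K - K := Set.sub_mem_sub (lo_mem hu hcc hmP) (hi_mem hu hcc hm')
    have p1 : prj u x₁ = p - (z0 - p') := by rw [hx₁, prj_sub, prj_line hu op, prj_line hu oq]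
    have p2 : prj u x₂ = m - (z0 - m) := by rw [hx₂, prj_sub, prj_line hu om, prj_line hu om']
    have pe : prj u x₁ = prj u x₂ := by rw [p1, p2, hm]; module
    have i1 : (inner ℝ u x₁ : ℝ) = g p - f (z0 - p') := by
      rw [hx₁, inner_sub_right, inner_line hu op, inner_line hu oq]
    have i2 : (inner ℝ u x₂ : ℝ) = f m - g (z0 - m) := by
      rw [hx₂, inner_sub_right, inner_line hu om, inner_line hu om']
    set c := comb u (1/2) (-1/2) x₁ x₂ with hc
    have hphi : phi (stein u K) c ≤ bet n * vol (stein u K) := by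
      have h1 : phi (stein u K) c ≤ _ := phi_stein hu hcc pe
      have h2 := hE _ d1
      have h3 := hE _ d2
      rw [vol_stein_real hu hcc]
      linarith
    obtain ⟨a, ha, b, hb, hab⟩ := sublevel_csym hn hn0 hSB hs hSE hphi
    simp only at hab
    have hmid : (1/2:ℝ) • a + (1/2:ℝ) • (z - b) ∈ stein u K := hSB.2.1 ha (hz b hb) (by norm_num) (by norm_num) (by norm_num)
    have he : (1/2:ℝ) • a + (1/2:ℝ) • (z - b) = (1/2:ℝ) • (c + z) := by
      rw [← hab]; module
    rw [he] at hmid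
    have h4 := (mem_stein_abs hu hcc hmid).2
    have e1 : prj u ((1/2:ℝ) • (c + z)) = m := by
      rw [prj_smul, prj_add, hc, prj_comb hu, p1, hm]; module
    rw [e1, inner_smul_right, inner_add_right, hzu, hc, inner_comb hu, i1, i2] at h4
    have h5 := (abs_le.1 h4).2
    have h6 := hl m hmP
    linarith
  -- constancy
  have hconc1 : ConcaveOn ℝ P g := hi_concave hu hcc
  have hconc2 : ConcaveOn ℝ P (fun y => -f (z0 - y)) := by
    refine ⟨hPc, fun x hx y hy a b ha hb hab => ?_⟩
    have := (lo_convex hu hcc).2 (hrefl _ hx) (hrefl _ hy) ha hb hab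
    have e : a • (z0 - x) + b • (z0 - y) = z0 - (a • x + b • y) := by
      calc _ = (a + b) • z0 - (a • x + b • y) := by module
        _ = _ := by rw [hab, one_smul]
    rw [e] at this
    simp only [smul_eq_mul] at this ⊢
    linarith
  have hconst : ∀ x ∈ interior K, g (prj u x) + f (z0 - prj u x) =
      g (prj u x0) + f (z0 - prj u x0) := by
    intro x hx
    obtain ⟨ε, hε, hseg⟩ := segment_extend hcc.2 hx hx0
    let ℓ : ℝ →ᵃ[ℝ] E := AffineMap.lineMap (prj u x) (prj u x0)
    have hℓ : ∀ t, ℓ t = prj u (AffineMap.lineMap x x0 t) := by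
      intro t
      simp only [ℓ, AffineMap.lineMap_apply, vsub_eq_sub, vadd_eq_add]
      rw [prj_add, prj_smul, prj_sub]
    have hsub : Set.Icc (-ε : ℝ) (1 + ε) ⊆ (ℓ : ℝ → E) ⁻¹' P := by
      intro t ht
      exact ⟨_, hseg t ht, (hℓ t).symm⟩
    have hc1 := (hconc1.comp_affineMap ℓ).subset hsub (convex_Icc _ _)
    have hc2 := (hconc2.comp_affineMap ℓ).subset hsub (convex_Icc _ _)
    have := lemmaT (a := -ε) (b := 1 + ε) hc2 hc1 ?_ (s := 0) (t := 1) ⟨by linarith, by linarith⟩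
      ⟨by linarith, by linarith⟩
    · simp only [Function.comp, ℓ, AffineMap.lineMap_apply_zero, AffineMap.lineMap_apply_one] at this
      linarith
    · intro s hs t ht
      have hs' := hsub ⟨hs.1.le, hs.2.le⟩
      have ht' := hsub ⟨ht.1.le, ht.2.le⟩
      have h1 := hB _ hs' _ ht'
      have e : (1/2:ℝ) • ℓ s + (1/2:ℝ) • ℓ t = ℓ ((s+t)/2) := by
        simp only [ℓ, AffineMap.lineMap_apply, vsub_eq_sub, vadd_eq_add]
        module
      rw [e] at h1
      simp only [Function.comp]
      linarith
  set c := g (prj u x0) + f (z0 - prj u x0) with hc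
  refine ⟨z0 + c • u, ?_⟩
  have hinK : ∀ x ∈ interior K, (z0 + c • u) - x ∈ K := by
    intro x hx
    have hxK := interior_subset hx
    have hxP : prj u x ∈ P := ⟨x, hxK, rfl⟩
    have h1 := hconst x hx
    have h2 := mem_bounds hu hcc hxK
    have h3 := hl _ hxP
    have h4 := fib_eq hu hcc (hrefl _ hxP)
    have h5 : c - inner ℝ u x ∈ fib u K (z0 - prj u x) := by
      rw [h4.1]; constructor
      · change f _ ≤ _; linarith [h2.2]
      · change _ ≤ g _; linarith [h2.1]
    have h6 : (z0 - prj u x) + (c - inner ℝ u x) • u ∈ K := h5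
    have e : (z0 + c • u) - x = (z0 - prj u x) + (c - inner ℝ u x) • u := by
      nth_rw 1 [← prj_add_inner u x]; module
    rw [e]; exact h6
  intro x hx
  have hcl : K ⊆ closure (interior K) := by
    rw [hcc.2.closure_interior_eq_closure_of_nonempty_interior hK.2.2]; exact subset_closure
  have hclosed : IsClosed {x | (z0 + c • u) - x ∈ K} :=
    hcc.1.isClosed.preimage (continuous_const.sub continuous_id)
  exact closure_minimal hinK hclosed (hcl hx)

lemma extr_csym {n : ℕ} (hn : Module.finrank ℝ E = n) (hn0 : 0 < n) {K : Set E} (hK : Body K)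
    (hE : Extr n K) : CSym K := by
  refine stein_induction (P := fun K => Extr n K → CSym K) ?_ ?_ K hK hE
  · intro K hK hs _
    exact ⟨0, fun x hx => by simpa using hs x hx⟩
  · intro u hu K hK ih h
    exact csym_of_stein hn hn0 hK h hu (ih (extr_stein hu hK.cc h))

end CSymSec
end HL

open MeasureTheory Pointwise
set_option linter.unusedSectionVars false

namespace HL

section LemU

lemma lemmaU {f : ℝ → ℝ} (hf : ConvexOn ℝ Set.univ f) (hcont : Continuous f) {c b : ℝ} (hc : 0 < c)
    (hco : ∀ t, c * |t| - b ≤ f t)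
    (h : ∀ s₁ s₂, ∃ t₁ t₂, f t₁ ≤ (f s₁ + f s₂)/2 ∧ f t₂ ≤ (f s₁ + f s₂)/2 ∧ t₁ - t₂ = s₁ - s₂) :
    ∃ μ, ∀ s, f (μ + s) = f (μ - s) := by
  have hlim : Filter.Tendsto f (Filter.cocompact ℝ) Filter.atTop := by
    refine Filter.tendsto_atTop_mono hco ?_
    refine Filter.tendsto_atTop_add_const_right _ _ ?_
    exact Filter.Tendsto.const_mul_atTop hc (tendsto_norm_cocompact_atTop (E := ℝ))
  obtain ⟨t0, ht0⟩ := hcont.exists_forall_le hlim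
  let m := f t0
  let S : ℝ → Set ℝ := fun y => {t | f t ≤ y}
  have hbd : ∀ y, ∀ t ∈ S y, |t| ≤ (y + b)/c := by
    intro y t ht
    rw [le_div_iff₀ hc]
    have h1 := hco t
    have h2 : f t ≤ y := ht
    linarith
  have hba : ∀ y, BddAbove (S y) := fun y => ⟨(y+b)/c, fun t ht => (abs_le.1 (hbd y t ht)).2⟩
  have hbb : ∀ y, BddBelow (S y) := fun y => ⟨-((y+b)/c), fun t ht => (abs_le.1 (hbd y t ht)).1⟩
  have hne : ∀ y, m ≤ y → (S y).Nonempty := fun y hy => ⟨t0, hy⟩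
  have hcl : ∀ y, IsClosed (S y) := fun y => isClosed_le hcont continuous_const
  let β : ℝ → ℝ := fun y => sSup (S y)
  let α : ℝ → ℝ := fun y => sInf (S y)
  have hβ : ∀ y, m ≤ y → f (β y) ≤ y := fun y hy => (hcl y).csSup_mem (hne y hy) (hba y)
  have hα : ∀ y, m ≤ y → f (α y) ≤ y := fun y hy => (hcl y).csInf_mem (hne y hy) (hbb y)
  have hβ' : ∀ y t, f t ≤ y → t ≤ β y := fun y t ht => le_csSup (hba y) ht
  have hα' : ∀ y t, f t ≤ y → α y ≤ t := fun y t ht => csInf_le (hbb y) ht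
  have hin : ∀ y, m ≤ y → ∀ t, α y ≤ t → t ≤ β y → f t ≤ y := by
    intro y hy t h1 h2
    have hcv : Convex ℝ (S y) := by simpa using hf.convex_le y
    exact hcv.ordConnected.out (hα y hy) (hβ y hy) ⟨h1, h2⟩
  have hBc : ∀ M, ConcaveOn ℝ (Set.Icc m M) β := by
    intro M
    refine ⟨convex_Icc _ _, fun x hx y hy a b ha hb hab => ?_⟩
    refine hβ' _ _ ((hf.2 trivial trivial ha hb hab).trans ?_)
    have := hβ x hx.1
    have := hβ y hy.1
    simp only [smul_eq_mul]; gcongr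
  have hAc : ∀ M, ConcaveOn ℝ (Set.Icc m M) (fun y => - α y) := by
    intro M
    refine ⟨convex_Icc _ _, fun x hx y hy a b ha hb hab => ?_⟩
    have h1 : α (a • x + b • y) ≤ a • α x + b • α y := by
      refine hα' _ _ ((hf.2 trivial trivial ha hb hab).trans ?_)
      have := hα x hx.1
      have := hα y hy.1
      simp only [smul_eq_mul]; gcongr
    simp only [smul_eq_mul] at h1 ⊢
    linarith
  have hconst : ∀ y₁ y₂, m < y₁ → m < y₂ → β y₁ + α y₁ = β y₂ + α y₂ := by
    intro y₁ y₂ h1 h2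
    have hT := lemmaT (a := m) (b := max y₁ y₂ + 1) (hAc _) (hBc _) ?_ (s := y₁) (t := y₂)
      ⟨h1, by linarith [le_max_left y₁ y₂]⟩ ⟨h2, by linarith [le_max_right y₁ y₂]⟩
    · linarith
    · intro s hs t ht
      obtain ⟨t₁, t₂, g1, g2, g3⟩ := h (β s) (α t)
      have e : (f (β s) + f (α t))/2 ≤ (s+t)/2 := by
        linarith [hβ s hs.1.le, hα t ht.1.le]
      have := hβ' _ _ (g1.trans e)
      have := hα' _ _ (g2.trans e)
      linarith
  let μ := (β (m+1) + α (m+1))/2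
  have hle : ∀ s, f (μ - s) ≤ f (μ + s) := by
    intro s
    refine le_of_forall_gt_imp_ge_of_dense fun y hy => ?_
    have hmy : m < y := lt_of_le_of_lt (ht0 _) hy
    have h1 := hconst y (m+1) hmy (by linarith)
    have h2 := hβ' _ _ hy.le
    have h3 := hα' _ _ hy.le
    refine hin y hmy.le _ ?_ ?_ <;> simp only [μ] at * <;> linarith
  refine ⟨μ, fun s => le_antisymm ?_ (hle s)⟩
  have := hle (-s)
  rwa [sub_neg_eq_add, ← sub_eq_add_neg] at this

end LemU

section Refl

variable {E : Type*} [NormedAddCommGroup E] [InnerProductSpace ℝ E]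
variable [FiniteDimensional ℝ E] [MeasurableSpace E] [BorelSpace E]

lemma bet_pos (n : ℕ) : 0 < bet n := by
  have := unitBallVol_pos n
  have := unitBallVol_pos (n-1)
  unfold bet; positivity

lemma extr_pair {n : ℕ} (hn : Module.finrank ℝ E = n) (hn0 : 0 < n) {K : Set E} (hK : Body K)
    (hE : Extr n K) {u v : E} (hu : ‖u‖ = 1) (hv : inner ℝ u v = (0:ℝ)) (s₁ s₂ : ℝ) :
    ∃ t₁ t₂ : ℝ, phi K (v + t₁ • u) ≤ (phi K (v + s₁ • u) + phi K (v + s₂ • u))/2 ∧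
      phi K (v + t₂ • u) ≤ (phi K (v + s₁ • u) + phi K (v + s₂ • u))/2 ∧ t₁ - t₂ = s₁ - s₂ := by
  have hcc := hK.cc
  set y := (phi K (v + s₁ • u) + phi K (v + s₂ • u))/2 with hy
  have n1 := phi_nonneg hcc (v + s₁ • u)
  have n2 := phi_nonneg hcc (v + s₂ • u)
  by_cases hy0 : y = 0
  · exact ⟨s₁, s₂, by linarith, by linarith, rfl⟩
  have hyp : 0 < y := lt_of_le_of_ne (by linarith) (Ne.symm hy0)
  set C := bet n * vol K with hC
  have hCp : 0 < C := mul_pos (bet_pos n) (vol_pos hcc hK.2.2)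
  set l := C / y with hl
  have hlp : 0 < l := by positivity
  have hly : l * y = C := by rw [hl]; field_simp
  have pe : prj u (l • (v + s₁ • u)) = prj u (l • (v + s₂ • u)) := by
    rw [prj_smul, prj_smul, prj_line hu hv, prj_line hu hv]
  have h1 := phi_stein hu hcc pe
  rw [phi_smul hcc _ hlp.le, phi_smul hcc _ hlp.le, comb_smul, comb_line hu hv] at h1
  have e0 : (l * phi K (v + s₁ • u) + l * phi K (v + s₂ • u)) / 2 = bet n * vol K := by
    rw [← hC, ← hly, hy]; ring
  have hSE := extr_stein hu hcc hE
  have hSB := hK.stein hu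
  have h2 := sublevel_csym hn hn0 hSB (extr_csym hn hn0 hSB hSE) hSE
    (x := l • (v + (1/2 * s₁ + -1/2 * s₂) • u)) (by rw [vol_stein_real hu hcc]; linarith)
  obtain ⟨p, hp, q, hq, hpq, he⟩ := sub_stein K h2
  have ep := congrArg (prj u) he
  have ei := congrArg (fun z => (inner ℝ u z : ℝ)) he
  rw [prj_comb hu, prj_smul, prj_line hu hv] at ep
  simp only [inner_comb hu, inner_smul_right, inner_line hu hv] at ei
  have key : ∀ r : E, r ∈ K - K → prj u r = l • v → phi K (v + (l⁻¹ * inner ℝ u r) • u) ≤ y := by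
    intro r hr hpr
    have h3 := hE r hr
    have e : v + (l⁻¹ * (inner ℝ u r : ℝ)) • u = l⁻¹ • r := by
      conv_rhs => rw [← prj_add_inner u r, hpr, smul_add, smul_smul, smul_smul, inv_mul_cancel₀ hlp.ne', one_smul]
    rw [e, phi_smul hcc _ (by positivity)]
    rw [inv_mul_le_iff₀ hlp, hly]; exact h3
  refine ⟨l⁻¹ * inner ℝ u p, l⁻¹ * inner ℝ u q, key p hp ep, key q hq (hpq ▸ ep), ?_⟩
  rw [← mul_sub, inv_mul_eq_iff_eq_mul₀ hlp.ne']
  linarith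

lemma extr_refl {n : ℕ} (hn : Module.finrank ℝ E = n) (hn0 : 0 < n) {K : Set E} (hK : Body K)
    (hE : Extr n K) {u : E} (hu : u ≠ 0) (v : E) :
    ∃ k : ℝ, ∀ s : ℝ, phi K ((v + k • u) + s • u) = phi K ((v + k • u) - s • u) := by
  obtain ⟨w, hw, huw⟩ := exists_unit hu
  have hr : 0 < ‖u‖ := norm_pos_iff.2 hu
  set r := ‖u‖ with hrdef
  set v' := prj w v with hv'
  have ho : inner ℝ w v' = (0:ℝ) := inner_prj hw v
  obtain ⟨c, hc, hco⟩ := coercive hK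
  have hcc := hK.cc
  have hline : ∀ t : ℝ, v' + t • w = (AffineMap.lineMap v' (v' + w) : ℝ →ᵃ[ℝ] E) t := by
    intro t; simp [AffineMap.lineMap_apply, add_comm]
  have f1 : ConvexOn ℝ Set.univ (fun t : ℝ => phi K (v' + t • w)) := by
    simp_rw [hline]
    exact (phi_convex hcc).comp_affineMap _
  have f2 : Continuous (fun t : ℝ => phi K (v' + t • w)) :=
    (phi_continuous hcc).comp (by fun_prop)
  have f3 : ∀ t : ℝ, c * |t| - 0 ≤ (fun t : ℝ => phi K (v' + t • w)) t := by
    intro t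
    have h1 := hco (v' + t • w)
    have h2 : |t| ≤ ‖v' + t • w‖ := by
      have h3 := abs_real_inner_le_norm w (v' + t • w)
      rw [inner_line hw ho, hw, one_mul] at h3; exact h3
    simp only
    nlinarith
  obtain ⟨μ, hμ⟩ := lemmaU f1 f2 hc f3 (extr_pair hn hn0 hK hE hw ho)
  refine ⟨(μ - inner ℝ w v)/r, fun s => ?_⟩
  have h1 := hμ (s * r)
  have e1 : v + ((μ - inner ℝ w v)/r) • u = v' + μ • w := by
    rw [huw, smul_smul, div_mul_cancel₀ _ hr.ne']
    have hvv := prj_add_inner w v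
    calc v + (μ - inner ℝ w v) • w = (prj w v + (inner ℝ w v : ℝ) • w) + (μ - inner ℝ w v) • w := by rw [hvv]
      _ = _ := by rw [hv']; module
  rw [e1, huw]
  convert h1 using 2 <;> module

end Refl
end HL

open MeasureTheory Pointwise
set_option linter.unusedSectionVars false

namespace HL

section Planar

/-- Planar determinant. -/
def dt (p z : ℝ × ℝ) : ℝ := p.1 * z.2 - p.2 * z.1

lemma dt_cont (p : ℝ × ℝ) : Continuous (dt p) := by unfold dt; fun_prop

/-- The moment bilinear form of a planar set. -/
noncomputable def mom (D : Set (ℝ × ℝ)) (p q : ℝ × ℝ) : ℝ := ∫ z in D, dt p z * dt q z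

lemma mom_int {D : Set (ℝ × ℝ)} (hD : IsCompact D) (p q : ℝ × ℝ) :
    IntegrableOn (fun z => dt p z * dt q z) D :=
  ((dt_cont p).mul (dt_cont q)).continuousOn.integrableOn_compact hD

lemma mom_comm (D : Set (ℝ × ℝ)) (p q : ℝ × ℝ) : mom D p q = mom D q p := by
  unfold mom; simp_rw [mul_comm]

lemma mom_add {D : Set (ℝ × ℝ)} (hD : IsCompact D) (p p' q : ℝ × ℝ) :
    mom D (p + p') q = mom D p q + mom D p' q := by
  unfold mom
  rw [← integral_add (mom_int hD p q) (mom_int hD p' q)]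
  congr 1; ext z; simp only [dt, Prod.fst_add, Prod.snd_add]; ring

lemma mom_smul (D : Set (ℝ × ℝ)) (c : ℝ) (p q : ℝ × ℝ) :
    mom D (c • p) q = c * mom D p q := by
  unfold mom
  rw [← integral_const_mul]
  congr 1; ext z; simp only [dt, Prod.smul_fst, Prod.smul_snd, smul_eq_mul]; ring

lemma mom_pos {D : Set (ℝ × ℝ)} (hD : IsCompact D) (h0 : (0 : ℝ × ℝ) ∈ interior D) {p : ℝ × ℝ}
    (hp : p ≠ 0) : 0 < mom D p p := by
  unfold mom
  have hnn : 0 ≤ᵐ[volume.restrict D] fun z => dt p z * dt p z :=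
    Filter.Eventually.of_forall fun z => mul_self_nonneg _
  rw [setIntegral_pos_iff_support_of_nonneg_ae hnn (mom_int hD p p)]
  have hs : 0 < p.1^2 + p.2^2 := by
    rcases p with ⟨a, b⟩
    have : ¬ (a = 0 ∧ b = 0) := by simpa using hp
    by_cases ha : a = 0
    · have hb : b ≠ 0 := fun hb => this ⟨ha, hb⟩
      positivity
    · positivity
  have hopen : IsOpen (interior D ∩ {z | dt p z ≠ 0}) :=
    isOpen_interior.inter (isOpen_ne_fun (dt_cont p) continuous_const)
  have hne : (interior D ∩ {z | dt p z ≠ 0}).Nonempty := by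
    have hc : Continuous (fun t : ℝ => t • ((-p.2, p.1) : ℝ × ℝ)) := by fun_prop
    have ho : (fun t : ℝ => t • ((-p.2, p.1) : ℝ × ℝ)) ⁻¹' interior D ∈ nhds (0:ℝ) :=
      (isOpen_interior.preimage hc).mem_nhds (by
        change (0:ℝ) • ((-p.2, p.1) : ℝ × ℝ) ∈ interior D
        rw [zero_smul]; exact h0)
    obtain ⟨ε, hε, hb⟩ := Metric.mem_nhds_iff.1 ho
    refine ⟨(ε/2) • ((-p.2, p.1) : ℝ × ℝ), hb ?_, ?_⟩
    · rw [Metric.mem_ball, dist_zero_right, Real.norm_of_nonneg (by positivity)]; linarith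
    · have : dt p ((ε/2) • ((-p.2, p.1) : ℝ × ℝ)) = (ε/2) * (p.1^2+p.2^2) := by
        simp [dt]; ring
      change dt p _ ≠ 0
      rw [this]; positivity
  refine lt_of_lt_of_le (hopen.measure_pos volume hne) (measure_mono ?_)
  rintro z ⟨h1, h2⟩
  exact ⟨mul_self_ne_zero.2 h2, interior_subset h1⟩

/-- The linear reflection. -/
noncomputable def rfl2 (w u : ℝ × ℝ) : (ℝ × ℝ) →ₗ[ℝ] (ℝ × ℝ) where
  toFun z := z - (2 * (dt w z / dt w u)) • u
  map_add' x y := by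
    ext <;> simp [dt] <;> ring
  map_smul' c x := by
    ext <;> simp [dt] <;> ring

lemma rfl2_mp {w u : ℝ × ℝ} (hd : dt w u ≠ 0) : MeasurePreserving (rfl2 w u) volume volume := by
  have hinv : (rfl2 w u) ∘ₗ (rfl2 w u) = LinearMap.id := by
    refine LinearMap.ext fun z => ?_
    change z - (2 * (dt w z / dt w u)) • u - (2 * (dt w (z - (2 * (dt w z / dt w u)) • u) / dt w u)) • u = z
    have : dt w (z - (2 * (dt w z / dt w u)) • u) = - dt w z := by
      have : dt w (z - (2 * (dt w z / dt w u)) • u) = dt w z - (2 * (dt w z / dt w u)) * dt w u := by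
        simp [dt]; ring
      rw [this]; field_simp; ring
    rw [this, neg_div]; module
  have hdet : LinearMap.det (rfl2 w u) * LinearMap.det (rfl2 w u) = 1 := by
    rw [← LinearMap.det_comp, hinv, LinearMap.det_id]
  have h1 : |LinearMap.det (rfl2 w u)| = 1 := by
    have := congrArg abs hdet
    rw [abs_mul, abs_one] at this
    nlinarith [abs_nonneg (LinearMap.det (rfl2 w u))]
  have hne : LinearMap.det (rfl2 w u) ≠ 0 := by
    intro h; rw [h] at h1; simp at h1
  refine ⟨(rfl2 w u).continuous_of_finiteDimensional.measurable, ?_⟩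
  rw [Measure.map_linearMap_addHaar_eq_smul_addHaar volume hne, abs_inv, h1]
  simp

lemma mom_refl {D : Set (ℝ × ℝ)} (hD : IsCompact D) {w u : ℝ × ℝ} (hd : dt w u ≠ 0)
    (hR : ∀ z ∈ D, rfl2 w u z ∈ D) : mom D w u = 0 := by
  have hcomp : ∀ z, rfl2 w u (rfl2 w u z) = z := by
    intro z
    change z - (2 * (dt w z / dt w u)) • u - (2 * (dt w (z - (2 * (dt w z / dt w u)) • u) / dt w u)) • u = z
    have : dt w (z - (2 * (dt w z / dt w u)) • u) = - dt w z := by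
      have : dt w (z - (2 * (dt w z / dt w u)) • u) = dt w z - (2 * (dt w z / dt w u)) * dt w u := by
        simp [dt]; ring
      rw [this]; field_simp; ring
    rw [this, neg_div]; module
  have hw : ∀ z, dt w (rfl2 w u z) = - dt w z := by
    intro z
    change dt w (z - (2 * (dt w z / dt w u)) • u) = - dt w z
    have : dt w (z - (2 * (dt w z / dt w u)) • u) = dt w z - (2 * (dt w z / dt w u)) * dt w u := by
      simp [dt]; ring
    rw [this]; field_simp; ring
  have hu : ∀ z, dt u (rfl2 w u z) = dt u z := by
    intro z
    change dt u (z - (2 * (dt w z / dt w u)) • u) = dt u z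
    simp [dt]; ring
  unfold mom
  rw [← integral_indicator hD.measurableSet]
  set g := D.indicator (fun z => dt w z * dt u z) with hg
  have hgT : ∀ z, g (rfl2 w u z) = - g z := by
    intro z
    by_cases hz : z ∈ D
    · rw [hg, Set.indicator_of_mem (hR z hz), Set.indicator_of_mem hz, hw, hu]; ring
    · have : rfl2 w u z ∉ D := fun h => hz (by rw [← hcomp z]; exact hR _ h)
      rw [hg, Set.indicator_of_notMem this, Set.indicator_of_notMem hz]; simp
  have hmp := rfl2_mp hd
  have hgm : AEStronglyMeasurable g (Measure.map (rfl2 w u) volume) := by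
    rw [hmp.map_eq]
    exact ((dt_cont w).mul (dt_cont u)).aestronglyMeasurable.indicator hD.measurableSet
  have h1 := integral_map hmp.measurable.aemeasurable hgm
  rw [hmp.map_eq] at h1
  simp_rw [hgT] at h1
  rw [integral_neg] at h1
  linarith

lemma planar {F : ℝ × ℝ → ℝ} (hcont : Continuous F) (hnn : ∀ p, 0 ≤ F p)
    (hsm : ∀ (c : ℝ) p, F (c • p) = |c| * F p) {c : ℝ} (hc : 0 < c) (hco : ∀ p, c * ‖p‖ ≤ F p)
    (hR : ∀ u : ℝ × ℝ, u ≠ 0 → ∃ w, dt w u ≠ 0 ∧ ∀ s : ℝ, F (w + s • u) = F (w - s • u)) (p q : ℝ × ℝ) :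
    F (p + q) ^ 2 + F (p - q) ^ 2 = 2 * (F p ^ 2 + F q ^ 2) := by
  have hF0 : F 0 = 0 := by simpa using hsm 0 0
  let D : Set (ℝ × ℝ) := {z | F z ≤ 1}
  have hD : IsCompact D := by
    refine (isCompact_closedBall (0 : ℝ × ℝ) (1/c)).of_isClosed_subset (isClosed_le hcont continuous_const) ?_
    intro z hz
    have : F z ≤ 1 := hz
    rw [mem_closedBall_zero_iff, le_div_iff₀ hc]
    linarith [hco z]
  have h0 : (0 : ℝ × ℝ) ∈ interior D := by
    refine interior_mono (s := {z | F z < 1}) (fun z hz => by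
      have : F z < 1 := hz
      exact this.le) ?_
    rw [(isOpen_lt hcont continuous_const).interior_eq]
    change F 0 < 1
    rw [hF0]; norm_num
  have hR2 : ∀ u : ℝ × ℝ, u ≠ 0 → ∃ w, dt w u ≠ 0 ∧ ∀ t s : ℝ, F (t • w + s • u) = F (t • w - s • u) := by
    intro u hu
    obtain ⟨w, hd, hw⟩ := hR u hu
    refine ⟨w, hd, fun t s => ?_⟩
    by_cases ht : t = 0
    · rw [ht, zero_smul, zero_add, zero_sub, ← neg_smul, hsm, hsm, abs_neg]
    · have e1 : t • w + s • u = t • (w + (s/t) • u) := by rw [smul_add, smul_smul, mul_div_cancel₀ _ ht]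
      have e2 : t • w - s • u = t • (w - (s/t) • u) := by rw [smul_sub, smul_smul, mul_div_cancel₀ _ ht]
      rw [e1, e2, hsm, hsm, hw]
  have hdec : ∀ w u z : ℝ × ℝ, dt w u ≠ 0 → z = (-(dt u z / dt w u)) • w + (dt w z / dt w u) • u := by
    intro w u z hd
    ext
    · simp only [Prod.fst_add, Prod.smul_fst, smul_eq_mul]
      field_simp
      simp only [dt]; ring
    · simp only [Prod.snd_add, Prod.smul_snd, smul_eq_mul]
      field_simp
      simp only [dt]; ring
  have heq : ∀ p q, mom D p p = mom D q q → F p = F q := by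
    intro p q hpq
    by_cases hpe : p = q
    · rw [hpe]
    have hu : p - q ≠ 0 := sub_ne_zero.2 hpe
    obtain ⟨w, hd, hw⟩ := hR2 _ hu
    set u := p - q with hudef
    have hwu : mom D w u = 0 := by
      refine mom_refl hD hd fun z hz => ?_
      change F (z - (2 * (dt w z / dt w u)) • u) ≤ 1
      have hz' : F z ≤ 1 := hz
      have e1 := hdec w u z hd
      have := hw (-(dt u z / dt w u)) (dt w z / dt w u)
      rw [← e1] at this
      rw [this] at hz'
      convert hz' using 2
      nth_rw 1 [e1]; module
    have huv : mom D (p + q) u = 0 := by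
      have e : u = p + (-1:ℝ) • q := by rw [hudef]; module
      rw [mom_comm, e, mom_add hD, mom_smul, mom_comm, mom_add hD, mom_comm D q (p+q), mom_add hD, mom_comm D q p]
      linarith
    have e2 := hdec w u (p + q) hd
    rw [e2, mom_add hD, mom_smul, mom_smul, hwu] at huv
    have hup := mom_pos hD h0 hu
    have hb : dt w (p + q) / dt w u = 0 := by
      rcases mul_eq_zero.1 (by linarith : dt w (p + q) / dt w u * mom D u u = 0) with h | h
      · exact h
      · exact absurd h hup.ne'
    rw [hb, zero_smul, add_zero] at e2
    have := hw (1/2 * -(dt u (p + q) / dt w u)) (1/2)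
    rw [mul_smul, ← e2] at this
    have a1 : (1/2:ℝ) • (p + q) + (1/2:ℝ) • u = p := by rw [hudef]; module
    have a2 : (1/2:ℝ) • (p + q) - (1/2:ℝ) • u = q := by rw [hudef]; module
    rwa [a1, a2] at this
  have he : ((1:ℝ), (0:ℝ)) ≠ 0 := by simp
  set e : ℝ × ℝ := (1, 0) with hedef
  have hep := mom_pos hD h0 he
  have hmnn : ∀ p, 0 ≤ mom D p p := by
    intro p
    by_cases hp : p = 0
    · subst hp; simp [mom, dt]
    · exact (mom_pos hD h0 hp).le
  have hk : ∀ p, F p ^ 2 = (F e ^ 2 / mom D e e) * mom D p p := by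
    intro p
    have h1 : mom D p p = mom D (Real.sqrt (mom D p p / mom D e e) • e) (Real.sqrt (mom D p p / mom D e e) • e) := by
      rw [mom_smul, mom_comm D e (_ • e), mom_smul, ← mul_assoc, Real.mul_self_sqrt (div_nonneg (hmnn p) hep.le)]
      field_simp
    rw [heq _ _ h1, hsm, mul_pow, sq_abs, Real.sq_sqrt (div_nonneg (hmnn p) hep.le)]
    ring
  have ea : mom D (p + q) (p + q) = mom D p p + 2 * mom D p q + mom D q q := by
    rw [mom_add hD, mom_comm D p, mom_comm D q, mom_add hD, mom_add hD, mom_comm D q p]; ring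
  have es : mom D (p - q) (p - q) = mom D p p - 2 * mom D p q + mom D q q := by
    have e : p - q = p + (-1:ℝ) • q := by module
    rw [e, mom_add hD, mom_smul, mom_comm D p, mom_comm D q, mom_add hD, mom_add hD, mom_smul, mom_smul, mom_comm D q p]; ring
  rw [hk (p + q), hk (p - q), hk p, hk q, ea, es]; ring

end Planar
end HL

open MeasureTheory Pointwise
set_option linter.unusedSectionVars false

namespace HL

section Euclid

lemma euclid_of_normed {V : Type*} [NormedAddCommGroup V] [NormedSpace ℝ V] [FiniteDimensional ℝ V]
    {n : ℕ} (hn : Module.finrank ℝ V = n)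
    (h : ∀ x y : V, ‖x + y‖ * ‖x + y‖ + ‖x - y‖ * ‖x - y‖ = 2 * (‖x‖ * ‖x‖ + ‖y‖ * ‖y‖)) :
    ∃ L : V ≃ₗ[ℝ] EuclideanSpace ℝ (Fin n), ∀ x, ‖L x‖ = ‖x‖ := by
  letI : InnerProductSpace ℝ V := InnerProductSpace.ofNorm ℝ h
  subst hn
  exact ⟨(stdOrthonormalBasis ℝ V).repr.toLinearEquiv, fun x => (stdOrthonormalBasis ℝ V).repr.norm_map x⟩

lemma euclid_of_norm {V : Type*} [AddCommGroup V] [Module ℝ V] [FiniteDimensional ℝ V]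
    {n : ℕ} (hn : Module.finrank ℝ V = n) (N : V → ℝ) (h0 : ∀ x, 0 ≤ N x)
    (hs : ∀ (c : ℝ) x, N (c • x) = |c| * N x) (ht : ∀ x y, N (x + y) ≤ N x + N y)
    (hz : ∀ x, N x = 0 → x = 0)
    (h : ∀ x y : V, N (x + y) ^ 2 + N (x - y) ^ 2 = 2 * (N x ^ 2 + N y ^ 2)) :
    ∃ L : V ≃ₗ[ℝ] EuclideanSpace ℝ (Fin n), ∀ x, ‖L x‖ = N x := by
  letI : Norm V := ⟨N⟩
  have core : NormedSpace.Core ℝ V :=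
    { norm_nonneg := h0
      norm_smul := hs
      norm_triangle := ht
      norm_eq_zero_iff := fun x => ⟨hz x, fun hx => by
        change N x = 0
        have := hs 0 0
        rw [hx]; simpa using this⟩ }
  letI : NormedAddCommGroup V := NormedAddCommGroup.ofCore core
  letI : NormedSpace ℝ V := NormedSpace.ofCore core
  refine euclid_of_normed hn fun x y => ?_
  have := h x y
  simp only [← pow_two]
  exact this

end Euclid

section Ell

variable {E : Type*} [NormedAddCommGroup E] [InnerProductSpace ℝ E]
variable [FiniteDimensional ℝ E] [MeasurableSpace E] [BorelSpace E]

lemma phi_abs {K : Set E} (h : CC K) (c : ℝ) (x : E) : phi K (c • x) = |c| * phi K x := by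
  rcases le_total 0 c with hc | hc
  · rw [phi_smul h _ hc, abs_of_nonneg hc]
  · rw [← phi_neg, ← neg_smul, phi_smul h _ (neg_nonneg.2 hc), abs_of_nonpos hc]

lemma phi_add {K : Set E} (h : CC K) (x y : E) : phi K (x + y) ≤ phi K x + phi K y := by
  have h1 : phi K ((1/2:ℝ) • (2:ℝ) • x + (1/2:ℝ) • (2:ℝ) • y) ≤
      (1/2:ℝ) • phi K ((2:ℝ) • x) + (1/2:ℝ) • phi K ((2:ℝ) • y) :=
    (phi_convex h).2 (Set.mem_univ _) (Set.mem_univ _) (by norm_num) (by norm_num) (by norm_num)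
  rw [phi_smul h _ (by norm_num), phi_smul h _ (by norm_num)] at h1
  have e : (1/2:ℝ) • (2:ℝ) • x + (1/2:ℝ) • (2:ℝ) • y = x + y := by module
  rw [e] at h1
  simp only [smul_eq_mul] at h1
  linarith

lemma extr_para {n : ℕ} (hn : Module.finrank ℝ E = n) (hn0 : 0 < n) {K : Set E} (hK : Body K)
    (hE : Extr n K) (x y : E) :
    phi K (x + y) ^ 2 + phi K (x - y) ^ 2 = 2 * (phi K x ^ 2 + phi K y ^ 2) := by
  have hcc := hK.cc
  let f : (ℝ × ℝ) →ₗ[ℝ] E := (LinearMap.toSpanSingleton ℝ E x).coprod (LinearMap.toSpanSingleton ℝ E y)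
  have hf : ∀ p, f p = p.1 • x + p.2 • y := fun p => rfl
  have dep : ∀ (c : ℝ) (x : E), phi K (c • x + x) ^ 2 + phi K (c • x - x) ^ 2 =
      2 * (phi K (c • x) ^ 2 + phi K x ^ 2) := by
    intro c x
    have e1 : c • x + x = (c + 1) • x := by module
    have e2 : c • x - x = (c - 1) • x := by module
    rw [e1, e2, phi_abs hcc, phi_abs hcc, phi_abs hcc, mul_pow, mul_pow, mul_pow, sq_abs, sq_abs, sq_abs]
    ring
  by_cases hker : LinearMap.ker f = ⊥
  · obtain ⟨k, hk, hanti⟩ := LinearMap.exists_antilipschitzWith f hker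
    obtain ⟨c, hc, hco⟩ := coercive hK
    have hk' : (0:ℝ) < k := by exact_mod_cast hk
    have := planar (F := fun p => phi K (f p)) ((phi_continuous hcc).comp f.continuous_of_finiteDimensional)
      (fun p => phi_nonneg hcc _) (fun c p => by rw [map_smul]; exact phi_abs hcc c _)
      (c := c / k) (by positivity) (fun p => by
        have h1 := hco (f p)
        have h2 := hanti.le_mul_dist p 0
        rw [map_zero, dist_zero_right, dist_zero_right] at h2
        refine le_trans ?_ h1
        rw [div_mul_eq_mul_div, div_le_iff₀ hk']
        nlinarith) ?_ (1, 0) (0, 1)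
    · simpa [hf, ← sub_eq_add_neg] using this
    · rintro ⟨a, b⟩ hu
      have hfu : f (a, b) ≠ 0 := by
        intro h
        have : (a, b) ∈ LinearMap.ker f := h
        rw [hker] at this
        exact hu this
      obtain ⟨k, hk⟩ := extr_refl hn hn0 hK hE hfu (f (-b, a))
      refine ⟨(-b, a) + k • (a, b), ?_, fun s => ?_⟩
      · have e : dt ((-b, a) + k • (a, b)) (a, b) = -(a^2+b^2) := by
          simp [dt]; ring
        rw [e]
        have : ¬ (a = 0 ∧ b = 0) := by simpa using hu
        intro h
        apply this
        constructor <;> nlinarith [sq_nonneg a, sq_nonneg b]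
      · simp only [map_add, map_sub, map_smul]
        exact hk s
  · obtain ⟨⟨a, b⟩, hp, hp0⟩ := (Submodule.ne_bot_iff _).1 hker
    have h0 : a • x + b • y = 0 := hp
    by_cases ha : a = 0
    · have hb : b ≠ 0 := by
        intro hb; apply hp0; rw [ha, hb]; rfl
      have hy : y = (0:ℝ) • x := by
        rw [ha, zero_smul, zero_add] at h0
        rw [zero_smul]; exact (smul_eq_zero.1 h0).resolve_left hb
      have := dep 0 x
      rw [← hy, add_comm y x, ← phi_neg K (y - x), neg_sub] at this
      rw [this]; ring
    · have hx : x = (-(b/a)) • y := by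
        have h1 : a • x = -(b • y) := eq_neg_of_add_eq_zero_left h0
        have h2 : x = a⁻¹ • (a • x) := by rw [smul_smul, inv_mul_cancel₀ ha, one_smul]
        rw [h2, h1]; module
      have := dep (-(b/a)) y
      rwa [← hx] at this

lemma extr_ellipsoid {n : ℕ} (hn : Module.finrank ℝ E = n) (hn0 : 0 < n) {K : Set E} (hK : Body K)
    (hE : Extr n K) : ∃ T : EuclideanSpace ℝ (Fin n) ≃ᵃ[ℝ] E, K = T '' Metric.closedBall 0 1 := by
  obtain ⟨z, hz⟩ := extr_csym hn hn0 hK hE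
  have hs := vadd_sym hz
  set K' := (-(1/2:ℝ) • z) +ᵥ K with hK'def
  have hK' : Body K' := hK.vadd _
  have hE' : Extr n K' := extr_vadd hE _
  have hcc := hK'.cc
  set C := bet n * vol K' with hC
  have hCp : 0 < C := mul_pos (bet_pos n) (vol_pos hcc hK'.2.2)
  have hmem : ∀ x, x ∈ K' ↔ 2 / C * phi K' x ≤ 1 := by
    intro x
    have e : 2 / C * phi K' x ≤ 1 ↔ phi K' ((2:ℝ) • x) ≤ C := by
      rw [phi_smul hcc _ (by norm_num), div_mul_eq_mul_div, div_le_one hCp]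
    rw [e]
    constructor
    · intro hx
      exact hE' _ (two_smul_sub hs (Set.smul_mem_smul_set hx))
    · intro hx
      have h1 := sublevel_sym hn hn0 hK' hs hE' hx
      exact (Set.smul_mem_smul_set_iff₀ (by norm_num) _ _).1 h1
  obtain ⟨L, hL⟩ := euclid_of_norm hn (fun x => 2 / C * phi K' x)
    (fun x => mul_nonneg (by positivity) (phi_nonneg hcc x))
    (fun c x => by rw [phi_abs hcc]; ring)
    (fun x y => by rw [← mul_add]; exact mul_le_mul_of_nonneg_left (phi_add hcc x y) (by positivity))
    (fun x hx => by
      by_contra hne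
      have := phi_pos hcc hK'.2.2 hne
      have : 0 < 2 / C * phi K' x := by positivity
      linarith)
    (fun x y => by
      have := extr_para hn hn0 hK' hE' x y
      simp only [mul_pow]
      rw [← mul_add, this]; ring)
  refine ⟨L.symm.toAffineEquiv.trans (AffineEquiv.constVAdd ℝ E ((1/2:ℝ) • z)), ?_⟩
  ext x
  have hx : x ∈ K ↔ x - (1/2:ℝ) • z ∈ K' := by
    rw [hK'def, Set.mem_vadd_set_iff_neg_vadd_mem, vadd_eq_add]
    have : -(-(1/2:ℝ) • z) + (x - (1/2:ℝ) • z) = x := by module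
    rw [this]
  rw [hx, hmem]
  constructor
  · intro h
    refine ⟨L (x - (1/2:ℝ) • z), ?_, ?_⟩
    · rw [mem_closedBall_zero_iff, hL]; exact h
    · simp
  · rintro ⟨w, hw, rfl⟩
    rw [mem_closedBall_zero_iff] at hw
    have e : (L.symm.toAffineEquiv.trans (AffineEquiv.constVAdd ℝ E ((1/2:ℝ) • z))) w - (1/2:ℝ) • z = L.symm w := by
      simp
    rw [e]
    have := hL (L.symm w)
    rw [LinearEquiv.apply_symm_apply] at this
    rw [← this]; exact hw

lemma image_affine (T : E ≃ᵃ[ℝ] E) (S : Set E) : T '' S = T 0 +ᵥ ((T.linear : E →ₗ[ℝ] E) '' S) := by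
  have h : ∀ x, T x = T 0 + T.linear x := by
    intro x
    have := T.map_vadd 0 x
    simp only [vadd_eq_add, add_zero] at this
    rw [this, add_comm]
  ext y
  constructor
  · rintro ⟨x, hx, rfl⟩
    exact ⟨T.linear x, ⟨x, hx, rfl⟩, (h x).symm⟩
  · rintro ⟨_, ⟨x, hx, rfl⟩, rfl⟩
    exact ⟨x, hx, h x⟩

lemma vol_linear (A : E →ₗ[ℝ] E) (S : Set E) : vol (A '' S) = |LinearMap.det A| * vol S := by
  unfold vol
  rw [Measure.addHaar_image_linearMap, ENNReal.toReal_mul, ENNReal.toReal_ofReal (abs_nonneg _)]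

lemma ext_linear (A : E →ₗ[ℝ] E) (S : Set E) (x : E) : HL.ext (A '' S) (A x) = A '' HL.ext S x := by
  ext y
  constructor
  · rintro ⟨_, ⟨k, hk, rfl⟩, t, ht, rfl⟩
    exact ⟨k + t • x, ⟨k, hk, t, ht, rfl⟩, by simp⟩
  · rintro ⟨_, ⟨k, hk, t, ht, rfl⟩, rfl⟩
    exact ⟨A k, ⟨k, hk, rfl⟩, t, ht, by simp⟩

lemma ball_extr {n : ℕ} (hn : Module.finrank ℝ E = n) : Extr n (Metric.closedBall (0:E) 1) := by
  intro x hx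
  obtain ⟨p, hp, q, hq, rfl⟩ := hx
  rw [mem_closedBall_zero_iff] at hp hq
  have h1 : ‖p - q‖ ≤ 2 := (norm_sub_le p q).trans (by linarith)
  have hu := unitBallVol_pos n
  have hu' := unitBallVol_pos (n-1)
  have e1 := phi_ball hn zero_le_one (p - q)
  have e2 := vol_ball (E := E) hn zero_le_one
  simp only [one_pow, one_mul] at e1 e2
  rw [e1, e2, bet, div_mul_cancel₀ _ hu.ne']
  gcongr

lemma ellipsoid_extr {n : ℕ} (hn : Module.finrank ℝ E = n) (T : E ≃ᵃ[ℝ] E) :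
    Extr n (T '' Metric.closedBall (0:E) 1) := by
  rw [image_affine]
  refine extr_vadd ?_ _
  rintro _ ⟨_, ⟨p, hp, rfl⟩, _, ⟨q, hq, rfl⟩, rfl⟩
  have h1 := ball_extr hn _ (Set.sub_mem_sub hp hq)
  simp only
  rw [← map_sub, phi, ext_linear, vol_linear, vol_linear, ← mul_sub]
  rw [phi] at h1
  calc _ ≤ |LinearMap.det (T.linear : E →ₗ[ℝ] E)| * (bet n * vol (Metric.closedBall (0:E) 1)) :=
        mul_le_mul_of_nonneg_left h1 (abs_nonneg _)
    _ = _ := by ring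

lemma hull_eq {K : Set E} (hK : CC K) (x : E) : convexHull ℝ (K ∪ (x +ᵥ K)) = HL.ext K x := by
  apply Set.Subset.antisymm
  · refine convexHull_min ?_ (hK.ext x).2
    rintro y (hy | ⟨k, hk, rfl⟩)
    · exact ⟨y, hy, 0, ⟨le_rfl, zero_le_one⟩, by simp⟩
    · exact ⟨k, hk, 1, ⟨zero_le_one, le_rfl⟩, by simp [add_comm]⟩
  · rintro _ ⟨k, hk, t, ht, rfl⟩
    have h1 : k ∈ convexHull ℝ (K ∪ (x +ᵥ K)) := subset_convexHull _ _ (Or.inl hk)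
    have h2 : x + k ∈ convexHull ℝ (K ∪ (x +ᵥ K)) := subset_convexHull _ _ (Or.inr ⟨k, hk, rfl⟩)
    have := convex_convexHull ℝ (K ∪ (x +ᵥ K)) h1 h2 (a := 1 - t) (b := t) (by linarith [ht.2]) ht.1 (by ring)
    convert this using 1; module

lemma inter_iff {K : Set E} (x : E) : (K ∩ (x +ᵥ K)).Nonempty ↔ x ∈ K - K := by
  constructor
  · rintro ⟨_, h1, ⟨k, hk, rfl⟩⟩
    exact ⟨_, h1, k, hk, by simp⟩
  · rintro ⟨p, hp, q, hq, rfl⟩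
    exact ⟨p, hp, q, hq, by simp⟩

end Ell

lemma ctr_main {d : ℕ} (hd : 0 < d) {K : Set (EuclideanSpace ℝ (Fin d))} (hK : Body K) :
    1 + bet d ≤ ctr K ∧ (ctr K ≤ 1 + bet d ↔ Extr d K) := by
  have hcc := hK.cc
  have hv := vol_pos hcc hK.2.2
  set S : Set ℝ := {v : ℝ | ∃ x : EuclideanSpace ℝ (Fin d), (K ∩ (x +ᵥ K)).Nonempty ∧
    v = (volume (convexHull ℝ (K ∪ (x +ᵥ K)))).toReal} with hS
  have hctr : ctr K = 1 / vol K * sSup S := rfl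
  have hSe : S = (fun x => vol K + phi K x) '' (K - K) := by
    ext v
    constructor
    · rintro ⟨x, hx, rfl⟩
      rw [inter_iff] at hx
      refine ⟨x, hx, ?_⟩
      rw [hull_eq hcc]; simp [phi, vol]
    · rintro ⟨x, hx, rfl⟩
      refine ⟨x, (inter_iff x).2 hx, ?_⟩
      rw [hull_eq hcc]; simp [phi, vol]
  obtain ⟨k0, hk0⟩ := hK.2.2
  have hne : S.Nonempty := by
    rw [hSe]; exact ⟨_, _, Set.sub_mem_sub (interior_subset hk0) (interior_subset hk0), rfl⟩
  have hbdd : BddAbove S := by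
    rw [hSe]
    have hKK : IsCompact (K - K) := by
      rw [sub_eq_add_neg]
      exact hcc.1.add hcc.1.neg
    exact (hKK.image (continuous_const.add (phi_continuous hcc))).bddAbove
  have hn : Module.finrank ℝ (EuclideanSpace ℝ (Fin d)) = d := finrank_euclideanSpace_fin
  have hB : Bd K (sSup S - vol K) := by
    intro x hx
    have : vol K + phi K x ≤ sSup S := le_csSup hbdd (by rw [hSe]; exact ⟨x, hx, rfl⟩)
    linarith
  have h1 := ineq hn hd hK hB
  rw [hctr, one_div, inv_mul_eq_div]
  refine ⟨by rw [le_div_iff₀ hv]; linarith, ?_⟩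
  rw [div_le_iff₀ hv, csSup_le_iff hbdd hne]
  constructor
  · intro h x hx
    have := h (vol K + phi K x) (by rw [hSe]; exact ⟨x, hx, rfl⟩)
    linarith
  · intro h v hv'
    rw [hSe] at hv'
    obtain ⟨x, hx, rfl⟩ := hv'
    have := h x hx
    simp only
    linarith

end HL

theorem ctr_ge_ball_value (d : ℕ) (hd : 2 ≤ d) (K : Set (EuclideanSpace ℝ (Fin d)))
    (hKc : IsCompact K) (hKconv : Convex ℝ K) (hKint : (interior K).Nonempty) :
    ctr K ≥ 1 + 2 * unitBallVol (d - 1) / unitBallVol d ∧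
      (ctr K = 1 + 2 * unitBallVol (d - 1) / unitBallVol d ↔
        ∃ T : EuclideanSpace ℝ (Fin d) ≃ᵃ[ℝ] EuclideanSpace ℝ (Fin d), K = T '' Metric.closedBall 0 1) := by
  have hK : HL.Body K := ⟨hKc, hKconv, hKint⟩
  have hd0 : 0 < d := by omega
  have hn : Module.finrank ℝ (EuclideanSpace ℝ (Fin d)) = d := finrank_euclideanSpace_fin
  obtain ⟨h1, h2⟩ := HL.ctr_main hd0 hK
  refine ⟨h1, fun h => ?_, ?_⟩
  · exact HL.extr_ellipsoid hn hd0 hK (h2.1 (le_of_eq h))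
  · rintro ⟨T, hT⟩
    refine le_antisymm (h2.2 ?_) h1
    rw [hT]; exact HL.ellipsoid_extr hn T
end
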